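/- Let b be a rational function in the closed unit ball of H∞ with ‖b‖∞ = 1 that is not a finite Blaschke product. Let φ ∈ H(b) ∩ ball(H∞) with φ(ξ_j) ∈ Z_T(a) for 1 ≤ j ≤ p and φ(ξ_j) ∈ D for p+1 ≤ j ≤ n, let u = (a₁ ∘ φ) · ∏_{j=p+1}^n (φ − φ(ξ_j))^{m_j} / a₁, and let μ_{u,φ}(E) = ∫_{φ⁻¹(E)∩T} |u|² dm. Then the following are equivalent: (i) C_φ : H(b) → H(b) is compact; (ii) μ_{u,φ} is a vanishing Carleson measure; (iii) ∫_T (1 − |w|²)|u(ξ)|²/|1 − conj(w)φ(ξ)|² dm(ξ) → 0 as |w| → 1. -/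

import Mathlib

open Complex MeasureTheory Set Filter

noncomputable section

attribute [local instance] Classical.propDecidable

/-- The open unit disk in `ℂ`. -/
def unitDisk : Set ℂ := Metric.ball 0 1

/-- The unit circle in `ℂ`. -/
def unitCircle : Set ℂ := Metric.sphere 0 1

/-- Membership in `H^∞`: analytic and bounded on the unit disk. -/
def MemHinf (f : ℂ → ℂ) : Prop :=
  DifferentiableOn ℂ f unitDisk ∧ ∃ C : ℝ, ∀ z ∈ unitDisk, ‖f z‖ ≤ C

/-- Membership in the closed unit ball of `H^∞`. -/
def MemBallHinf (f : ℂ → ℂ) : Prop :=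
  DifferentiableOn ℂ f unitDisk ∧ ∀ z ∈ unitDisk, ‖f z‖ ≤ 1

/-- `f` agrees on the closed unit disk with a rational function without poles there. -/
def IsRationalOnDisk (f : ℂ → ℂ) : Prop :=
  ∃ P Q : Polynomial ℂ, ∀ z ∈ Metric.closedBall (0:ℂ) 1,
    Q.eval z ≠ 0 ∧ f z = P.eval z / Q.eval z

/-- `f` is a finite Blaschke product (multiplicities are encoded by repetition). -/
def IsFiniteBlaschke (f : ℂ → ℂ) : Prop :=
  ∃ (γ : ℂ) (k : ℕ) (lam : Fin k → ℂ), ‖γ‖ = 1 ∧ (∀ i, lam i ∈ unitDisk) ∧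
    ∀ z ∈ unitDisk, f z = γ * ∏ i, (z - lam i) / (1 - (starRingEnd ℂ) (lam i) * z)

/-- The `k`-th Taylor coefficient of `f` at the origin. -/
def taylorCoeff (f : ℂ → ℂ) (k : ℕ) : ℂ := iteratedDeriv k f 0 / k.factorial

/-- Membership in the Hardy space `H²` (square-summable Taylor coefficients). -/
def MemH2 (f : ℂ → ℂ) : Prop :=
  DifferentiableOn ℂ f unitDisk ∧ Summable fun k => ‖taylorCoeff f k‖ ^ 2

/-- The squared `H²` norm. -/
def h2NormSq (f : ℂ → ℂ) : ℝ := ∑' k, ‖taylorCoeff f k‖ ^ 2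

/-- The `H²` inner product. -/
def h2Inner (f g : ℂ → ℂ) : ℂ :=
  ∑' k, (starRingEnd ℂ) (taylorCoeff f k) * taylorCoeff g k

/-- The polynomial `a₁(z) = ∏ⱼ (z − ξⱼ)^{mⱼ}`. -/
def a1fun {n : ℕ} (ξ : Fin n → ℂ) (m : Fin n → ℕ) : ℂ → ℂ :=
  fun z => ∏ j, (z - ξ j) ^ (m j)

/-- A decomposition `f = a₁ g + q` with `g ∈ H²`, `deg q ≤ N − 1`, witnessing membership
in `H(b) = a₁H² ⊕ P_{N−1}`. -/
def HbDecompOf {n : ℕ} (ξ : Fin n → ℂ) (m : Fin n → ℕ)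
    (f g : ℂ → ℂ) (q : Polynomial ℂ) : Prop :=
  MemH2 g ∧ q.degree < ((∑ j, m j : ℕ) : WithBot ℕ) ∧
    ∀ z ∈ unitDisk, f z = a1fun ξ m z * g z + q.eval z

/-- Membership in `H(b) = a₁ H² ⊕ P_{N−1}` (description of `H(b)` for `b` rational,
not a finite Blaschke product, whose pythagorean mate has boundary zeros `ξ` with
multiplicities `m`). -/
def MemHb {n : ℕ} (ξ : Fin n → ℂ) (m : Fin n → ℕ) (f : ℂ → ℂ) : Prop :=
  ∃ gq : (ℂ → ℂ) × Polynomial ℂ, HbDecompOf ξ m f gq.1 gq.2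

/-- The (unique) decomposition of a member of `H(b)`. -/
def hbDecomp {n : ℕ} (ξ : Fin n → ℂ) (m : Fin n → ℕ) (f : ℂ → ℂ) :
    (ℂ → ℂ) × Polynomial ℂ :=
  if h : MemHb ξ m f then h.choose else (0, 0)

/-- The squared norm `⦀a₁g + q⦀² = ‖g‖²_{H²} + ‖q‖²_{H²}` on `H(b)`. -/
def hbNormSq {n : ℕ} (ξ : Fin n → ℂ) (m : Fin n → ℕ) (f : ℂ → ℂ) : ℝ :=
  h2NormSq (hbDecomp ξ m f).1 + h2NormSq fun z => ((hbDecomp ξ m f).2).eval z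

/-- The inner product on `H(b)` induced by the decomposition. -/
def hbInner {n : ℕ} (ξ : Fin n → ℂ) (m : Fin n → ℕ) (f g : ℂ → ℂ) : ℂ :=
  h2Inner (hbDecomp ξ m f).1 (hbDecomp ξ m g).1 +
    h2Inner (fun z => ((hbDecomp ξ m f).2).eval z)
      (fun z => ((hbDecomp ξ m g).2).eval z)

/-- The Stolz angle (non-tangential approach region) at a boundary point `ξ`. -/
def stolzAngle (ξ : ℂ) (M : ℝ) : Set ℂ := {z ∈ unitDisk | ‖z - ξ‖ ≤ M * (1 - ‖z‖)}

/-- `f` has non-tangential limit `L` at `ξ`. -/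
def NTLimit (f : ℂ → ℂ) (ξ L : ℂ) : Prop :=
  ∀ M : ℝ, 1 < M → Tendsto f (nhdsWithin ξ (stolzAngle ξ M)) (nhds L)

/-- Radial boundary value of `f` at `ζ` (junk value if the radial limit does not exist). -/
def bdryVal (f : ℂ → ℂ) (ζ : ℂ) : ℂ :=
  limUnder (nhdsWithin (1:ℝ) (Set.Iio 1)) fun r : ℝ => f ((r : ℂ) * ζ)

/-- The full setting: `b` is a rational function in the closed unit ball of `H^∞` with
`‖b‖_∞ = 1` which is not a finite Blaschke product; `a` is its pythagorean mate (rational,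
outer — i.e. zero-free on the disk —, `a(0) > 0`, `|a|² + |b|² = 1` on the circle); the
`ξ j` are the distinct zeros of `a` on the unit circle, with multiplicities `m j`. -/
structure RationalSetting (b a : ℂ → ℂ) (n : ℕ) (ξ : Fin n → ℂ) (m : Fin n → ℕ) :
    Prop where
  b_diff : DifferentiableOn ℂ b unitDisk
  b_rat : IsRationalOnDisk b
  b_le_one : ∀ z ∈ unitDisk, ‖b z‖ ≤ 1
  b_norm_one : sSup ((fun z => ‖b z‖) '' unitDisk) = 1
  b_not_fbp : ¬ IsFiniteBlaschke b
  a_diff : DifferentiableOn ℂ a unitDisk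
  a_rat : IsRationalOnDisk a
  a_outer : ∀ z ∈ unitDisk, a z ≠ 0
  a_zero_pos : 0 < (a 0).re ∧ (a 0).im = 0
  pyth : ∀ ζ ∈ unitCircle, ‖a ζ‖ ^ 2 + ‖b ζ‖ ^ 2 = 1
  zeros_mem : ∀ j, ξ j ∈ unitCircle
  zeros_inj : Function.Injective ξ
  mult_pos : ∀ j, 0 < m j
  factor : ∃ g : ℂ → ℂ, IsRationalOnDisk g ∧ (∀ ζ ∈ unitCircle, g ζ ≠ 0) ∧
    ∀ z ∈ Metric.closedBall (0:ℂ) 1, a z = a1fun ξ m z * g z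

/-- The composition operator `C_φ` maps `H(b)` into itself and is bounded there
(with respect to the equivalent norm `⦀·⦀_b`). -/
def CompBddHb {n : ℕ} (ξ : Fin n → ℂ) (m : Fin n → ℕ) (φ : ℂ → ℂ) : Prop :=
  (∀ f, MemHb ξ m f → MemHb ξ m fun z => f (φ z)) ∧
  ∃ C : ℝ, ∀ f, MemHb ξ m f →
    hbNormSq ξ m (fun z => f (φ z)) ≤ C * hbNormSq ξ m f

/-- The composition operator `C_φ` is compact on `H(b)`: it is bounded and the image of
every sequence in the unit ball has a subsequence whose image converges in `H(b)`. -/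
def CompCompactHb {n : ℕ} (ξ : Fin n → ℂ) (m : Fin n → ℕ) (φ : ℂ → ℂ) : Prop :=
  CompBddHb ξ m φ ∧
  ∀ f : ℕ → ℂ → ℂ, (∀ k, MemHb ξ m (f k) ∧ hbNormSq ξ m (f k) ≤ 1) →
    ∃ (κ : ℕ → ℕ) (g : ℂ → ℂ), StrictMono κ ∧ MemHb ξ m g ∧
      Tendsto (fun i => hbNormSq ξ m fun z => f (κ i) (φ z) - g z) atTop (nhds 0)

/-- The composition operator `C_φ` is Hilbert–Schmidt on `H(b)`: it is bounded and the sum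
of `⦀C_φ e⦀²` over the orthonormal basis `{a₁ z^k}ₖ ∪ {z^j}_{j<N}` of
`(H(b), ⦀·⦀_b)` is finite (the finite part of the sum being automatically finite). -/
def CompHSHb {n : ℕ} (ξ : Fin n → ℂ) (m : Fin n → ℕ) (φ : ℂ → ℂ) : Prop :=
  CompBddHb ξ m φ ∧
  Summable fun k : ℕ => hbNormSq ξ m fun z => a1fun ξ m (φ z) * φ z ^ k

/-- The weighted composition operator `W_{u,φ} f = u · (f ∘ φ)` maps `H²` boundedly
into itself. -/
def WCompBddH2 (u φ : ℂ → ℂ) : Prop :=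
  (∀ f, MemH2 f → MemH2 fun z => u z * f (φ z)) ∧
  ∃ C : ℝ, ∀ f, MemH2 f →
    h2NormSq (fun z => u z * f (φ z)) ≤ C * h2NormSq f

/-- The weighted composition operator `W_{u,φ}` is compact on `H²`. -/
def WCompCompactH2 (u φ : ℂ → ℂ) : Prop :=
  WCompBddH2 u φ ∧
  ∀ f : ℕ → ℂ → ℂ, (∀ k, MemH2 (f k) ∧ h2NormSq (f k) ≤ 1) →
    ∃ (κ : ℕ → ℕ) (g : ℂ → ℂ), StrictMono κ ∧ MemH2 g ∧
      Tendsto (fun i => h2NormSq fun z => u z * f (κ i) (φ z) - g z) atTop (nhds 0)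

/-- The weighted composition operator `W_{u,φ}` is Hilbert–Schmidt on `H²`
(sum over the orthonormal basis `{z^k}` of `H²`). -/
def WCompHSH2 (u φ : ℂ → ℂ) : Prop :=
  WCompBddH2 u φ ∧ Summable fun k : ℕ => h2NormSq fun z => u z * φ z ^ k

/-- The function `u = (a₁ ∘ φ) · ∏_{j ≥ p} (φ − φ(ξⱼ))^{mⱼ} / a₁`, where `Λ j = φ(ξ j)`
are the non-tangential limits of `φ` at the zeros of the mate. -/
def ufun {n : ℕ} (p : ℕ) (ξ : Fin n → ℂ) (m : Fin n → ℕ) (Λ : Fin n → ℂ)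
    (φ : ℂ → ℂ) : ℂ → ℂ :=
  fun z => a1fun ξ m (φ z) *
    (∏ j ∈ Finset.univ.filter fun j : Fin n => p ≤ (j : ℕ), (φ z - Λ j) ^ (m j)) /
      a1fun ξ m z

/-- The reproducing kernel of the de Branges–Rovnyak space `H(c)`:
`k_λ^c(z) = (1 − conj(c(λ)) c(z)) / (1 − conj(λ) z)`, as a function of the parameter `λ`
and the evaluation point `z`. -/
def rkKernel (c : ℂ → ℂ) (lam z : ℂ) : ℂ :=
  (1 - (starRingEnd ℂ) (c lam) * c z) / (1 - (starRingEnd ℂ) lam * z)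

/-- `f` belongs to the reproducing kernel Hilbert space `H(c)` with squared norm at
most `t`: for all finite linear combinations of kernels,
`|⟨f, Σ αᵢ k_{λᵢ}⟩|² ≤ t · ‖Σ αᵢ k_{λᵢ}‖²`. -/
def HbRKBound (c f : ℂ → ℂ) (t : ℝ) : Prop :=
  ∀ (k : ℕ) (lam α : Fin k → ℂ), (∀ i, lam i ∈ unitDisk) →
    ‖∑ i, (starRingEnd ℂ) (α i) * f (lam i)‖ ^ 2 ≤
      t * (∑ i, ∑ j, α i * (starRingEnd ℂ) (α j) * rkKernel c (lam i) (lam j)).re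

/-- Membership in the de Branges–Rovnyak space `H(c)` (general RKHS definition). -/
def MemHbRK (c f : ℂ → ℂ) : Prop := ∃ t : ℝ, HbRKBound c f t

/-- `φ` has an angular derivative in the sense of Carathéodory at `ξ`:
`φ` and `φ'` have non-tangential limits at `ξ` and `|φ(ξ)| = 1`. -/
def HasADC (φ : ℂ → ℂ) (ξ : ℂ) : Prop :=
  ∃ L L' : ℂ, ‖L‖ = 1 ∧ NTLimit φ ξ L ∧ NTLimit (deriv φ) ξ L'









/-- The measure `μ_{u,φ}(E) = ∫_{φ⁻¹(E) ∩ T} |u|² dm` (boundary values on the circle,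
normalized Lebesgue measure). -/
def muMeas (u φ : ℂ → ℂ) (E : Set ℂ) : ENNReal :=
  (ENNReal.ofReal (2 * Real.pi))⁻¹ *
    ∫⁻ θ in Set.Ioc (0:ℝ) (2 * Real.pi),
      (if bdryVal φ (Complex.exp (θ * Complex.I)) ∈ E then
        ENNReal.ofReal (‖bdryVal u (Complex.exp (θ * Complex.I))‖ ^ 2) else 0)

/-- `μ_{u,φ}` is a Carleson measure: `μ(S(ζ,r)) ≤ M r` for all Carleson windows
`S(ζ,r) = {z : |z| ≤ 1, |z − ζ| ≤ r}`, `ζ ∈ T`, `0 < r < 1`. -/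
def IsCarleson (u φ : ℂ → ℂ) : Prop :=
  ∃ M : ℝ, 0 < M ∧ ∀ ζ ∈ unitCircle, ∀ r ∈ Set.Ioo (0:ℝ) 1,
    muMeas u φ (Metric.closedBall ζ r ∩ Metric.closedBall 0 1) ≤ ENNReal.ofReal (M * r)

/-- `μ_{u,φ}` is a vanishing Carleson measure: `sup_{ζ∈T} μ(S(ζ,r))/r → 0` as `r → 0`. -/
def IsVanishingCarleson (u φ : ℂ → ℂ) : Prop :=
  ∀ ε > (0:ℝ), ∃ r₀ ∈ Set.Ioo (0:ℝ) 1, ∀ r ∈ Set.Ioo (0:ℝ) r₀, ∀ ζ ∈ unitCircle,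
    muMeas u φ (Metric.closedBall ζ r ∩ Metric.closedBall 0 1) ≤ ENNReal.ofReal (ε * r)

/-- The reproducing kernel integral
`∫_T (1 − |w|²) |u(ξ)|² / |1 − conj(w) φ(ξ)|² dm(ξ)`. -/
def repKerInt (u φ : ℂ → ℂ) (w : ℂ) : ENNReal :=
  (ENNReal.ofReal (2 * Real.pi))⁻¹ *
    ∫⁻ θ in Set.Ioc (0:ℝ) (2 * Real.pi),
      ENNReal.ofReal ((1 - ‖w‖ ^ 2) * ‖bdryVal u (Complex.exp (θ * Complex.I))‖ ^ 2 /
        ‖1 - (starRingEnd ℂ) w * bdryVal φ (Complex.exp (θ * Complex.I))‖ ^ 2)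

open scoped Topology ENNReal

/-- normalized Lebesgue measure on the circle, parametrized by the angle -/
def lam : Measure ℝ :=
  (ENNReal.ofReal (2 * Real.pi))⁻¹ • volume.restrict (Ioc (0:ℝ) (2 * Real.pi))

/-- point on the circle -/
def ee (θ : ℝ) : ℂ := Complex.exp (θ * Complex.I)

lemma ofReal_two_pi_ne_zero : ENNReal.ofReal (2 * Real.pi) ≠ 0 := by
  simp [Real.pi_pos]

instance lam_prob : IsProbabilityMeasure lam := by
  constructor
  simp only [lam, Measure.smul_apply, Measure.restrict_apply MeasurableSet.univ, univ_inter,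
    Real.volume_Ioc, sub_zero, smul_eq_mul]
  exact ENNReal.inv_mul_cancel ofReal_two_pi_ne_zero ENNReal.ofReal_ne_top

@[simp] lemma norm_ee (θ : ℝ) : ‖ee θ‖ = 1 := by
  simp [ee, Complex.norm_exp_ofReal_mul_I]

lemma ee_ne_zero (θ : ℝ) : ee θ ≠ 0 := by simp [ee]

@[fun_prop]
lemma continuous_ee : Continuous ee := by unfold ee; fun_prop

lemma muMeas_eq (u φ : ℂ → ℂ) (E : Set ℂ) : muMeas u φ E =
    ∫⁻ θ, (if bdryVal φ (ee θ) ∈ E then ENNReal.ofReal (‖bdryVal u (ee θ)‖ ^ 2) else 0) ∂lam := by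
  rw [lam, lintegral_smul_measure]; rfl

lemma repKerInt_eq (u φ : ℂ → ℂ) (w : ℂ) : repKerInt u φ w =
    ∫⁻ θ, ENNReal.ofReal ((1 - ‖w‖ ^ 2) * ‖bdryVal u (ee θ)‖ ^ 2 /
        ‖1 - (starRingEnd ℂ) w * bdryVal φ (ee θ)‖ ^ 2) ∂lam := by
  rw [lam, lintegral_smul_measure]; rfl

lemma circleAverage_eq_lam {E : Type*} [NormedAddCommGroup E] [NormedSpace ℝ E]
    (f : ℂ → E) (R : ℝ) : Real.circleAverage f 0 R = ∫ θ, f (R * ee θ) ∂lam := by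
  rw [lam, integral_smul_measure, Real.circleAverage,
    intervalIntegral.integral_of_le Real.two_pi_pos.le]
  simp only [circleMap_zero, ee]
  rw [ENNReal.toReal_inv, ENNReal.toReal_ofReal Real.two_pi_pos.le]

lemma integrable_lam_of_continuous {E : Type*} [NormedAddCommGroup E] {f : ℝ → E}
    (hf : Continuous f) : Integrable f lam := by
  unfold lam
  refine Integrable.smul_measure ?_ (by simp [Real.pi_pos])
  exact (hf.integrableOn_Icc (a := 0) (b := 2 * Real.pi)).mono_set Ioc_subset_Icc_self

lemma unitDisk_mem {z : ℂ} : z ∈ unitDisk ↔ ‖z‖ < 1 := by simp [unitDisk]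
lemma unitCircle_mem {z : ℂ} : z ∈ unitCircle ↔ ‖z‖ = 1 := by simp [unitCircle]
lemma isOpen_unitDisk : IsOpen unitDisk := Metric.isOpen_ball

lemma poisson_lam {f : ℂ → ℂ} (hf : DiffContOnCl ℂ f (Metric.ball 0 1)) {w : ℂ} (hw : ‖w‖ < 1) :
    ∫ θ, (((1 - ‖w‖ ^ 2) / ‖ee θ - w‖ ^ 2 : ℝ) : ℂ) * f (ee θ) ∂lam = f w := by
  have := hf.circleAverage_poissonKernel_smul' (w := w) (by simpa using hw)
  rw [circleAverage_eq_lam] at this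
  simpa using this

lemma poisson_lam_one {w : ℂ} (hw : ‖w‖ < 1) :
    ∫ θ, ((1 - ‖w‖ ^ 2) / ‖ee θ - w‖ ^ 2 : ℝ) ∂lam = 1 := by
  have := poisson_lam (f := fun _ => 1) diffContOnCl_const hw
  simp only [mul_one] at this
  rw [integral_complex_ofReal] at this
  exact_mod_cast this

lemma mean_value_lam {f : ℂ → ℂ} (hf : DiffContOnCl ℂ f (Metric.ball 0 1)) :
    ∫ θ, f (ee θ) ∂lam = f 0 := by
  have := DiffContOnCl.circleAverage (f := f) (c := 0) (R := 1) (by simpa using hf)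
  rw [circleAverage_eq_lam] at this
  simpa using this

/-! Taylor coefficients -/

lemma hasSum_taylor {f : ℂ → ℂ} (hf : DifferentiableOn ℂ f unitDisk) {z : ℂ} (hz : ‖z‖ < 1) :
    HasSum (fun k => taylorCoeff f k * z ^ k) (f z) := by
  have := Complex.hasSum_taylorSeries_on_ball hf (z := z) (by simpa [unitDisk] using hz)
  have e : (fun k => taylorCoeff f k * z ^ k) =
      fun n : ℕ => ((n.factorial : ℂ))⁻¹ • (z - 0) ^ n • iteratedDeriv n f 0 := by
    funext k
    simp only [taylorCoeff, sub_zero, smul_eq_mul, div_eq_mul_inv]; ring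
  rw [e]; exact this

lemma summable_norm_taylor {f : ℂ → ℂ} (hf : DifferentiableOn ℂ f unitDisk) {r : ℝ}
    (hr0 : 0 ≤ r) (hr : r < 1) : Summable (fun k => ‖taylorCoeff f k‖ * r ^ k) := by
  have := (hasSum_taylor hf (z := (r:ℂ)) (by simpa [abs_of_nonneg hr0] using hr)).summable.norm
  simpa [abs_of_nonneg hr0] using this

lemma powerSeries_unique {f : ℂ → ℂ} {c : ℕ → ℂ}
    (h : ∀ z : ℂ, ‖z‖ < 1 → HasSum (fun k => c k * z ^ k) (f z)) :
    DifferentiableOn ℂ f unitDisk ∧ ∀ k, taylorCoeff f k = c k := by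
  have hps : HasFPowerSeriesOnBall f (FormalMultilinearSeries.ofScalars ℂ c) 0 1 := by
    refine ⟨?_, by norm_num, ?_⟩
    · refine ENNReal.le_of_forall_nnreal_lt fun r hr => ?_
      have hr1 : (r:ℝ) < 1 := by exact_mod_cast hr
      apply FormalMultilinearSeries.le_radius_of_summable_norm
      have := (h (r:ℂ) (by simpa using hr1)).summable.norm
      simpa [FormalMultilinearSeries.ofScalars_norm] using this
    · intro y hy
      have hy' : ‖y‖ < 1 := by
        rw [← ENNReal.coe_one, Metric.eball_coe] at hy
        simpa using hy
      have := h y hy'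
      simpa [FormalMultilinearSeries.ofScalars_apply_eq, mul_comm] using this
  refine ⟨?_, fun k => ?_⟩
  · have := hps.differentiableOn
    rwa [← ENNReal.coe_one, Metric.eball_coe] at this
  · have h1 := hps.hasFPowerSeriesAt
    have h2 := h1.analyticAt.hasFPowerSeriesAt
    have h3 := h2.eq_formalMultilinearSeries h1
    have := congrArg (fun p => FormalMultilinearSeries.coeff p k) h3
    simpa [FormalMultilinearSeries.coeff_ofScalars, taylorCoeff] using this

lemma taylorCoeff_congr {f g : ℂ → ℂ} (h : ∀ z, ‖z‖ < 1 → f z = g z) (k : ℕ) :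
    taylorCoeff f k = taylorCoeff g k := by
  unfold taylorCoeff
  congr 1
  apply Filter.EventuallyEq.iteratedDeriv_eq
  filter_upwards [Metric.ball_mem_nhds (0:ℂ) one_pos] with z hz
  exact h z (by simpa using hz)

/-- integral mean -/
def Mr (f : ℂ → ℂ) (r : ℝ) : ℝ≥0∞ := ∫⁻ θ, ENNReal.ofReal (‖f (r * ee θ)‖ ^ 2) ∂lam

/-- extended H2 norm squared -/
def N2 (f : ℂ → ℂ) : ℝ≥0∞ := ∑' k, ENNReal.ofReal (‖taylorCoeff f k‖ ^ 2)

lemma norm_r_ee {r : ℝ} (hr0 : 0 ≤ r) (θ : ℝ) : ‖(r:ℂ) * ee θ‖ = r := by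
  simp [abs_of_nonneg hr0]

lemma continuous_circle {f : ℂ → ℂ} (hf : ContinuousOn f unitDisk) {r : ℝ}
    (hr0 : 0 ≤ r) (hr : r < 1) : Continuous fun θ => f (r * ee θ) := by
  apply hf.comp_continuous (by fun_prop)
  intro θ; rw [unitDisk_mem, norm_r_ee hr0]; exact hr

lemma sum_norm_sq_poly (n : ℕ) (c : ℕ → ℂ) :
    ∫ θ, ‖∑ k ∈ Finset.range n, c k * ee θ ^ k‖ ^ 2 ∂lam = ∑ k ∈ Finset.range n, ‖c k‖ ^ 2 := by
  let p : Polynomial ℂ := ∑ k ∈ Finset.range n, Polynomial.monomial k (c k)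
  have h := p.sum_sq_norm_coeff_eq_circleAverage
  rw [circleAverage_eq_lam] at h
  have hc : ∀ k, p.coeff k = if k < n then c k else 0 := by
    intro k
    simp [p, Polynomial.finsetSum_coeff, Polynomial.coeff_monomial]
  have he : ∀ z, p.eval z = ∑ k ∈ Finset.range n, c k * z ^ k := by
    intro z; simp [p, Polynomial.eval_finsetSum]
  simp only [he] at h
  simp only [ofReal_one, one_mul] at h
  rw [← h]
  rw [Finset.sum_subset (s₁ := p.support) (s₂ := Finset.range n)]
  · exact Finset.sum_congr rfl fun k hk => by rw [hc, if_pos (Finset.mem_range.1 hk)]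
  · intro k hk
    rw [Polynomial.mem_support_iff, hc] at hk
    by_contra hh
    simp at hh
    simp [not_lt.2 hh] at hk
  · intro k _ hk
    simp [Polynomial.notMem_support_iff.1 hk]

lemma parseval {f : ℂ → ℂ} (hf : DifferentiableOn ℂ f unitDisk) {r : ℝ}
    (hr0 : 0 ≤ r) (hr : r < 1) :
    HasSum (fun k => ‖taylorCoeff f k‖ ^ 2 * (r ^ 2) ^ k) (∫ θ, ‖f (r * ee θ)‖ ^ 2 ∂lam) := by
  have hs := summable_norm_taylor hf hr0 hr
  rw [hasSum_iff_tendsto_nat_of_nonneg (fun k => by positivity)]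
  have h1 : ∀ n, ∑ k ∈ Finset.range n, ‖taylorCoeff f k‖ ^ 2 * (r ^ 2) ^ k =
      ∫ θ, ‖∑ k ∈ Finset.range n, (taylorCoeff f k * r ^ k) * ee θ ^ k‖ ^ 2 ∂lam := by
    intro n
    rw [sum_norm_sq_poly]
    refine Finset.sum_congr rfl fun k _ => ?_
    rw [norm_mul, norm_pow, Complex.norm_real, Real.norm_of_nonneg hr0]; ring
  simp_rw [h1]
  apply tendsto_integral_of_dominated_convergence
    (fun _ => (∑' k, ‖taylorCoeff f k‖ * r ^ k) ^ 2)
  · intro n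
    apply Continuous.aestronglyMeasurable
    fun_prop
  · exact integrable_const _
  · intro n
    refine Eventually.of_forall fun θ => ?_
    simp only [norm_pow, norm_norm]
    gcongr
    refine (norm_sum_le _ _).trans ?_
    refine le_trans (Finset.sum_le_sum (g := fun k => ‖taylorCoeff f k‖ * r ^ k) fun k _ => ?_)
      (hs.sum_le_tsum _ fun k _ => by positivity)
    simp [abs_of_nonneg hr0]
  · refine Eventually.of_forall fun θ => ?_
    have := (hasSum_taylor hf (z := r * ee θ) (by rw [norm_r_ee hr0]; exact hr)).tendsto_sum_nat
    have := (this.norm).pow 2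
    simpa [mul_pow, mul_assoc] using this

lemma Mr_eq {f : ℂ → ℂ} (hf : DifferentiableOn ℂ f unitDisk) {r : ℝ}
    (hr0 : 0 ≤ r) (hr : r < 1) :
    Mr f r = ∑' k, ENNReal.ofReal (‖taylorCoeff f k‖ ^ 2 * (r ^ 2) ^ k) := by
  have h := parseval hf hr0 hr
  rw [← ENNReal.ofReal_tsum_of_nonneg (fun k => by positivity) h.summable, h.tsum_eq, Mr,
    ofReal_integral_eq_lintegral_ofReal]
  · apply integrable_lam_of_continuous
    exact (continuous_circle hf.continuousOn hr0 hr).norm.pow 2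
  · exact Eventually.of_forall fun θ => by positivity

lemma Mr_mono {f : ℂ → ℂ} (hf : DifferentiableOn ℂ f unitDisk) {r s : ℝ}
    (hr0 : 0 ≤ r) (hrs : r ≤ s) (hs : s < 1) : Mr f r ≤ Mr f s := by
  rw [Mr_eq hf hr0 (hrs.trans_lt hs), Mr_eq hf (hr0.trans hrs) hs]
  refine ENNReal.tsum_le_tsum fun k => ?_
  gcongr

lemma Mr_le_N2 {f : ℂ → ℂ} (hf : DifferentiableOn ℂ f unitDisk) {r : ℝ}
    (hr0 : 0 ≤ r) (hr : r < 1) : Mr f r ≤ N2 f := by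
  rw [Mr_eq hf hr0 hr]
  refine ENNReal.tsum_le_tsum fun k => ENNReal.ofReal_le_ofReal ?_
  have : (r ^ 2) ^ k ≤ 1 := pow_le_one₀ (by positivity) (pow_le_one₀ hr0 hr.le)
  nlinarith [sq_nonneg ‖taylorCoeff f k‖]

lemma N2_le {f : ℂ → ℂ} (hf : DifferentiableOn ℂ f unitDisk) {r0 : ℝ} (h0 : r0 < 1) {C : ℝ≥0∞}
    (h : ∀ r, r0 < r → 0 ≤ r → r < 1 → Mr f r ≤ C) : N2 f ≤ C := by
  unfold N2
  rw [ENNReal.tsum_eq_iSup_nat]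
  refine iSup_le fun n => ?_
  have ht : Tendsto (fun r : ℝ => ∑ k ∈ Finset.range n,
      ENNReal.ofReal (‖taylorCoeff f k‖ ^ 2 * (r ^ 2) ^ k)) (𝓝[<] 1)
      (𝓝 (∑ k ∈ Finset.range n, ENNReal.ofReal (‖taylorCoeff f k‖ ^ 2))) := by
    refine tendsto_finsetSum _ fun k _ => ?_
    have : Tendsto (fun r : ℝ => ENNReal.ofReal (‖taylorCoeff f k‖ ^ 2 * (r ^ 2) ^ k)) (𝓝 1)
      (𝓝 (ENNReal.ofReal (‖taylorCoeff f k‖ ^ 2 * ((1:ℝ) ^ 2) ^ k))) := by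
      apply Continuous.tendsto
      exact ENNReal.continuous_ofReal.comp (by fun_prop)
    simp only [one_pow, mul_one] at this
    exact this.mono_left nhdsWithin_le_nhds
  refine le_of_tendsto ht ?_
  filter_upwards [Ioo_mem_nhdsLT (show max r0 0 < 1 by simp [h0])] with r hr
  have h1 := (max_lt_iff.1 hr.1)
  refine le_trans ?_ (h r h1.1 h1.2.le hr.2)
  rw [Mr_eq hf h1.2.le hr.2]
  exact ENNReal.sum_le_tsum _

lemma MemH2_iff {f : ℂ → ℂ} : MemH2 f ↔ DifferentiableOn ℂ f unitDisk ∧ N2 f ≠ ⊤ := by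
  unfold MemH2 N2
  refine and_congr_right fun _ => ?_
  constructor
  · intro h; exact h.tsum_ofReal_ne_top
  · intro h
    have := ENNReal.summable_toReal h
    simpa using this

lemma N2_eq {f : ℂ → ℂ} (hf : MemH2 f) : N2 f = ENNReal.ofReal (h2NormSq f) := by
  unfold N2 h2NormSq
  rw [ENNReal.ofReal_tsum_of_nonneg (fun k => by positivity) hf.2]

lemma h2NormSq_eq {f : ℂ → ℂ} : h2NormSq f = (N2 f).toReal := by
  unfold N2 h2NormSq
  rw [ENNReal.tsum_toReal_eq (fun _ => ENNReal.ofReal_ne_top)]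
  simp

lemma N2_congr {f g : ℂ → ℂ} (h : ∀ z, ‖z‖ < 1 → f z = g z) : N2 f = N2 g := by
  unfold N2; simp_rw [taylorCoeff_congr h]

lemma h2NormSq_nonneg (f : ℂ → ℂ) : 0 ≤ h2NormSq f := by
  rw [h2NormSq_eq]; positivity

open scoped Topology ENNReal

/-! H2 operations -/

lemma taylorCoeff_add {f g : ℂ → ℂ} (hf : DifferentiableOn ℂ f unitDisk)
    (hg : DifferentiableOn ℂ g unitDisk) (k : ℕ) :
    taylorCoeff (fun z => f z + g z) k = taylorCoeff f k + taylorCoeff g k := by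
  refine (powerSeries_unique (c := fun k => taylorCoeff f k + taylorCoeff g k) fun z hz => ?_).2 k
  simp only [add_mul]
  exact (hasSum_taylor hf hz).add (hasSum_taylor hg hz)

lemma taylorCoeff_sub {f g : ℂ → ℂ} (hf : DifferentiableOn ℂ f unitDisk)
    (hg : DifferentiableOn ℂ g unitDisk) (k : ℕ) :
    taylorCoeff (fun z => f z - g z) k = taylorCoeff f k - taylorCoeff g k := by
  refine (powerSeries_unique (c := fun k => taylorCoeff f k - taylorCoeff g k) fun z hz => ?_).2 k
  simp only [sub_mul]
  exact (hasSum_taylor hf hz).sub (hasSum_taylor hg hz)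

lemma taylorCoeff_const_mul {f : ℂ → ℂ} (hf : DifferentiableOn ℂ f unitDisk) (c : ℂ) (k : ℕ) :
    taylorCoeff (fun z => c * f z) k = c * taylorCoeff f k := by
  refine (powerSeries_unique (c := fun k => c * taylorCoeff f k) fun z hz => ?_).2 k
  simp only [mul_assoc]
  exact (hasSum_taylor hf hz).mul_left c

lemma taylorCoeff_poly (q : Polynomial ℂ) (k : ℕ) :
    taylorCoeff (fun z => q.eval z) k = q.coeff k := by
  refine (powerSeries_unique (c := fun k => q.coeff k) fun z hz => ?_).2 k
  rw [Polynomial.eval_eq_sum, Polynomial.sum]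
  apply hasSum_sum_of_ne_finset_zero
  intro b hb
  simp [Polynomial.notMem_support_iff.1 hb]

lemma diff_poly (q : Polynomial ℂ) : DifferentiableOn ℂ (fun z => q.eval z) unitDisk :=
  q.differentiable.differentiableOn

lemma memH2_poly (q : Polynomial ℂ) : MemH2 fun z => q.eval z := by
  refine ⟨diff_poly q, ?_⟩
  apply summable_of_ne_finset_zero (s := q.support)
  intro b hb
  simp [taylorCoeff_poly, Polynomial.notMem_support_iff.1 hb]

lemma h2NormSq_poly (q : Polynomial ℂ) : h2NormSq (fun z => q.eval z) =
    ∑ k ∈ q.support, ‖q.coeff k‖ ^ 2 := by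
  unfold h2NormSq
  simp only [taylorCoeff_poly]
  apply tsum_eq_sum
  intro b hb
  simp [Polynomial.notMem_support_iff.1 hb]

lemma coeff_sq_le_h2NormSq {f : ℂ → ℂ} (hf : MemH2 f) (k : ℕ) :
    ‖taylorCoeff f k‖ ^ 2 ≤ h2NormSq f :=
  hf.2.le_tsum k (fun _ _ => by positivity)

lemma norm_add_sq_le (x y : ℂ) : ‖x + y‖ ^ 2 ≤ 2 * ‖x‖ ^ 2 + 2 * ‖y‖ ^ 2 := by
  have := norm_add_le x y
  nlinarith [sq_nonneg (‖x‖ - ‖y‖), norm_nonneg (x + y)]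

lemma N2_add_le {f g : ℂ → ℂ} (hf : DifferentiableOn ℂ f unitDisk)
    (hg : DifferentiableOn ℂ g unitDisk) :
    N2 (fun z => f z + g z) ≤ 2 * N2 f + 2 * N2 g := by
  unfold N2
  rw [← ENNReal.tsum_mul_left, ← ENNReal.tsum_mul_left, ← ENNReal.tsum_add]
  refine ENNReal.tsum_le_tsum fun k => ?_
  rw [taylorCoeff_add hf hg]
  rw [show (2:ℝ≥0∞) = ENNReal.ofReal 2 by simp, ← ENNReal.ofReal_mul (by norm_num),
    ← ENNReal.ofReal_mul (by norm_num), ← ENNReal.ofReal_add (by positivity) (by positivity)]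
  exact ENNReal.ofReal_le_ofReal (norm_add_sq_le _ _)

lemma MemH2.add {f g : ℂ → ℂ} (hf : MemH2 f) (hg : MemH2 g) : MemH2 fun z => f z + g z := by
  rw [MemH2_iff] at *
  refine ⟨hf.1.add hg.1, ?_⟩
  refine ne_top_of_le_ne_top ?_ (N2_add_le hf.1 hg.1)
  finiteness [hf.2, hg.2]

lemma N2_const_mul {f : ℂ → ℂ} (hf : DifferentiableOn ℂ f unitDisk) (c : ℂ) :
    N2 (fun z => c * f z) = ENNReal.ofReal (‖c‖ ^ 2) * N2 f := by
  unfold N2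
  rw [← ENNReal.tsum_mul_left]
  congr 1; funext k
  rw [taylorCoeff_const_mul hf, ← ENNReal.ofReal_mul (by positivity), norm_mul, mul_pow]

lemma MemH2.const_mul {f : ℂ → ℂ} (hf : MemH2 f) (c : ℂ) : MemH2 fun z => c * f z := by
  rw [MemH2_iff] at *
  refine ⟨hf.1.const_mul c, ?_⟩
  rw [N2_const_mul hf.1]
  exact ENNReal.mul_ne_top ENNReal.ofReal_ne_top hf.2

lemma MemH2.congr {f g : ℂ → ℂ} (hf : MemH2 f) (h : ∀ z, ‖z‖ < 1 → f z = g z) : MemH2 g := by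
  refine ⟨hf.1.congr fun z hz => (h z (unitDisk_mem.1 hz)).symm, ?_⟩
  have := hf.2
  simpa only [taylorCoeff_congr h] using this

lemma h2NormSq_congr {f g : ℂ → ℂ} (h : ∀ z, ‖z‖ < 1 → f z = g z) : h2NormSq f = h2NormSq g := by
  rw [h2NormSq_eq, h2NormSq_eq, N2_congr h]

lemma MemH2.sub {f g : ℂ → ℂ} (hf : MemH2 f) (hg : MemH2 g) : MemH2 fun z => f z - g z :=
  (hf.add (hg.const_mul (-1))).congr fun z _ => by ring

lemma memH2_zero : MemH2 fun _ => 0 := by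
  simpa using memH2_poly 0

lemma N2_zero : N2 (fun _ => 0) = 0 := by
  have := h2NormSq_poly 0
  simp only [Polynomial.eval_zero, Polynomial.support_zero, Finset.sum_empty] at this
  rw [N2_eq memH2_zero, this]; simp

lemma MemH2.sum {ι : Type*} (s : Finset ι) {f : ι → ℂ → ℂ} (hf : ∀ i ∈ s, MemH2 (f i)) :
    MemH2 fun z => ∑ i ∈ s, f i z := by
  induction s using Finset.induction_on with
  | empty => simpa using memH2_zero
  | insert a s ha ih =>
    simp only [Finset.sum_insert ha]
    exact (hf a (by simp)).add (ih fun i hi => hf i (by simp [hi]))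

lemma N2_sum_le {ι : Type*} (s : Finset ι) {f : ι → ℂ → ℂ}
    (hf : ∀ i ∈ s, DifferentiableOn ℂ (f i) unitDisk) :
    N2 (fun z => ∑ i ∈ s, f i z) ≤ 2 ^ s.card * ∑ i ∈ s, N2 (f i) := by
  induction s using Finset.induction_on with
  | empty => simp [N2_zero]
  | insert a s ha ih =>
    simp only [Finset.sum_insert ha]
    refine (N2_add_le (hf a (by simp)) (DifferentiableOn.fun_sum fun i hi => hf i (by simp [hi]))).trans ?_
    have h1 := ih fun i hi => hf i (by simp [hi])
    rw [Finset.card_insert_of_notMem ha, mul_add]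
    gcongr ?_ + ?_
    · gcongr
      calc (2:ℝ≥0∞) = 2 ^ 1 := by simp
        _ ≤ 2 ^ (s.card + 1) := pow_le_pow_right₀ (by norm_num) (by omega)
    · calc _ ≤ 2 * (2 ^ s.card * ∑ i ∈ s, N2 (f i)) := by gcongr
        _ = _ := by ring

lemma Mr_bdd_mul {v f : ℂ → ℂ} {C : ℝ} (hC : 0 ≤ C) {r : ℝ} (hr0 : 0 ≤ r) (hr : r < 1)
    (hv : ∀ z, ‖z‖ < 1 → ‖v z‖ ≤ C) :
    Mr (fun z => v z * f z) r ≤ ENNReal.ofReal (C ^ 2) * Mr f r := by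
  unfold Mr
  rw [← lintegral_const_mul' _ _ ENNReal.ofReal_ne_top]
  refine lintegral_mono fun θ => ?_
  simp only
  rw [← ENNReal.ofReal_mul (by positivity)]
  apply ENNReal.ofReal_le_ofReal
  rw [norm_mul, mul_pow]
  gcongr
  exact hv _ (by rw [norm_r_ee hr0]; exact hr)

lemma N2_bdd_mul {v f : ℂ → ℂ} {C : ℝ} (hC : 0 ≤ C) (hv : DifferentiableOn ℂ v unitDisk)
    (hvb : ∀ z, ‖z‖ < 1 → ‖v z‖ ≤ C) (hf : DifferentiableOn ℂ f unitDisk) :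
    N2 (fun z => v z * f z) ≤ ENNReal.ofReal (C ^ 2) * N2 f := by
  refine N2_le (hv.mul hf) (r0 := 0) one_pos fun r _ hr0 hr => ?_
  refine (Mr_bdd_mul hC hr0 hr hvb).trans ?_
  gcongr
  exact Mr_le_N2 hf hr0 hr

lemma MemH2.bdd_mul {v f : ℂ → ℂ} {C : ℝ} (hv : DifferentiableOn ℂ v unitDisk)
    (hvb : ∀ z, ‖z‖ < 1 → ‖v z‖ ≤ C) (hf : MemH2 f) : MemH2 fun z => v z * f z := by
  have hC : 0 ≤ C := (norm_nonneg _).trans (hvb 0 (by simp))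
  rw [MemH2_iff] at *
  exact ⟨hv.mul hf.1, ne_top_of_le_ne_top (ENNReal.mul_ne_top ENNReal.ofReal_ne_top hf.2)
    (N2_bdd_mul hC hv hvb hf.1)⟩

lemma poly_bdd (q : Polynomial ℂ) (R : ℝ) : ∃ C, 0 ≤ C ∧ ∀ z : ℂ, ‖z‖ ≤ R → ‖q.eval z‖ ≤ C := by
  obtain ⟨C, hC⟩ := (isCompact_closedBall (0:ℂ) R).exists_bound_of_continuousOn
    (f := fun z => q.eval z) q.continuous.continuousOn
  exact ⟨max C 0, le_max_right _ _, fun z hz => (hC z (by simpa using hz)).trans (le_max_left _ _)⟩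

lemma MemH2.poly_mul {f : ℂ → ℂ} (hf : MemH2 f) (q : Polynomial ℂ) :
    MemH2 fun z => q.eval z * f z := by
  obtain ⟨C, _, hC⟩ := poly_bdd q 1
  exact hf.bdd_mul (diff_poly q) fun z hz => hC z hz.le

/-- function with given coefficients -/
def ofCoeff (c : ℕ → ℂ) (z : ℂ) : ℂ := ∑' k, c k * z ^ k

lemma cs_partial {c : ℕ → ℂ} (hc : Summable fun k => ‖c k‖ ^ 2) {r : ℝ} (hr0 : 0 ≤ r)
    (hr : r < 1) (n : ℕ) : (∑ k ∈ Finset.range n, ‖c k‖ * r ^ k) ^ 2 * (1 - r ^ 2) ≤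
      ∑' k, ‖c k‖ ^ 2 := by
  have hr2 : r ^ 2 < 1 := pow_lt_one₀ hr0 hr (by norm_num)
  have h1 := Finset.sum_mul_sq_le_sq_mul_sq (Finset.range n) (fun k => ‖c k‖) (fun k => r ^ k)
  have h2 : ∑ k ∈ Finset.range n, ‖c k‖ ^ 2 ≤ ∑' k, ‖c k‖ ^ 2 :=
    hc.sum_le_tsum _ fun k _ => by positivity
  have h3 : ∑ k ∈ Finset.range n, (r ^ k) ^ 2 ≤ (1 - r ^ 2)⁻¹ := by
    have := (summable_geometric_of_lt_one (by positivity) hr2).sum_le_tsum (Finset.range n)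
      fun k _ => by positivity
    rw [tsum_geometric_of_lt_one (by positivity) hr2] at this
    refine le_trans (le_of_eq ?_) this
    exact Finset.sum_congr rfl fun k _ => by ring
  have h4 : (∑ k ∈ Finset.range n, ‖c k‖ * r ^ k) ^ 2 ≤ (∑' k, ‖c k‖ ^ 2) * (1 - r ^ 2)⁻¹ := by
    refine h1.trans ?_
    gcongr
  calc _ ≤ (∑' k, ‖c k‖ ^ 2) * (1 - r ^ 2)⁻¹ * (1 - r ^ 2) := by
        gcongr
    _ = _ := by rw [mul_assoc, inv_mul_cancel₀ (by linarith), mul_one]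

lemma summable_of_sq {c : ℕ → ℂ} (hc : Summable fun k => ‖c k‖ ^ 2) {r : ℝ} (hr0 : 0 ≤ r)
    (hr : r < 1) : Summable fun k => ‖c k‖ * r ^ k := by
  have hr2 : r ^ 2 < 1 := pow_lt_one₀ hr0 hr (by norm_num)
  have := hc.add (summable_geometric_of_lt_one (r := r ^ 2) (by positivity) hr2)
  refine Summable.of_nonneg_of_le (fun k => by positivity) (fun k => ?_) this
  rw [← pow_mul, mul_comm 2 k, pow_mul]
  nlinarith [sq_nonneg (‖c k‖ - r ^ k), sq_nonneg ‖c k‖, sq_nonneg (r ^ k)]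

lemma ofCoeff_hasSum {c : ℕ → ℂ} (hc : Summable fun k => ‖c k‖ ^ 2) {z : ℂ} (hz : ‖z‖ < 1) :
    HasSum (fun k => c k * z ^ k) (ofCoeff c z) := by
  apply Summable.hasSum
  apply Summable.of_norm
  simpa using summable_of_sq hc (norm_nonneg z) hz

lemma memH2_ofCoeff {c : ℕ → ℂ} (hc : Summable fun k => ‖c k‖ ^ 2) :
    MemH2 (ofCoeff c) ∧ ∀ k, taylorCoeff (ofCoeff c) k = c k := by
  obtain ⟨h1, h2⟩ := powerSeries_unique fun z hz => ofCoeff_hasSum hc hz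
  exact ⟨⟨h1, by simpa only [h2] using hc⟩, h2⟩

lemma growth {f : ℂ → ℂ} (hf : MemH2 f) {z : ℂ} (hz : ‖z‖ < 1) :
    ‖f z‖ ^ 2 * (1 - ‖z‖ ^ 2) ≤ h2NormSq f := by
  have h1 := (((hasSum_taylor hf.1 hz).tendsto_sum_nat.norm).pow 2).mul_const (1 - ‖z‖ ^ 2)
  refine le_of_tendsto h1 (Eventually.of_forall fun n => ?_)
  refine le_trans ?_ (cs_partial hf.2 (norm_nonneg z) hz n)
  have hz2 : ‖z‖ ^ 2 < 1 := pow_lt_one₀ (norm_nonneg z) hz (by norm_num)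
  gcongr
  refine (norm_sum_le _ _).trans (le_of_eq ?_)
  simp

/-- little-oh growth along radii, crude form -/
lemma growth_radial {f : ℂ → ℂ} (hf : MemH2 f) {ζ : ℂ} (hζ : ‖ζ‖ = 1) :
    Tendsto (fun r : ℝ => ((r:ℂ) * ζ - ζ) * f (r * ζ)) (𝓝[<] 1) (𝓝 0) := by
  have key : ∀ᶠ r : ℝ in 𝓝[<] 1, ‖((r:ℂ) * ζ - ζ) * f (r * ζ)‖ ≤
      Real.sqrt ((1 - r) * h2NormSq f) := by
    filter_upwards [Ioo_mem_nhdsLT (show (0:ℝ) < 1 by norm_num)] with r hr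
    apply Real.le_sqrt_of_sq_le
    have hn : ‖(r:ℂ) * ζ‖ = r := by simp [hζ, abs_of_pos hr.1]
    have h1 := growth hf (z := r * ζ) (by rw [hn]; exact hr.2)
    rw [hn] at h1
    have h2 : ‖(r:ℂ) * ζ - ζ‖ = 1 - r := by
      rw [show (r:ℂ) * ζ - ζ = -((1 - r : ℝ) : ℂ) * ζ by push_cast; ring, norm_mul, norm_neg, hζ,
        Complex.norm_real, Real.norm_of_nonneg (by linarith [hr.2]), mul_one]
    rw [norm_mul, h2]
    have h3 : 0 ≤ ‖f (r * ζ)‖ ^ 2 * r := mul_nonneg (sq_nonneg _) hr.1.le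
    have h4 : 0 < 1 - r := by linarith [hr.2]
    calc ((1 - r) * ‖f (r * ζ)‖) ^ 2 = (1 - r) * (‖f (r * ζ)‖ ^ 2 * (1 - r)) := by ring
      _ ≤ (1 - r) * (‖f (r * ζ)‖ ^ 2 * (1 - r ^ 2)) := by
        gcongr; nlinarith [hr.1]
      _ ≤ _ := by gcongr
  refine squeeze_zero_norm' key ?_
  have : Tendsto (fun r : ℝ => Real.sqrt ((1 - r) * h2NormSq f)) (𝓝 1)
      (𝓝 (Real.sqrt ((1 - 1) * h2NormSq f))) := by
    apply Continuous.tendsto; fun_prop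
  simp only [sub_self, zero_mul, Real.sqrt_zero] at this
  exact this.mono_left nhdsWithin_le_nhds

lemma tendsto_radial (ζ : ℂ) : Tendsto (fun r : ℝ => (r:ℂ) * ζ) (𝓝[<] 1) (𝓝 ζ) := by
  have : Tendsto (fun r : ℝ => (r:ℂ) * ζ) (𝓝 1) (𝓝 (((1:ℝ):ℂ) * ζ)) := by
    apply Continuous.tendsto; fun_prop
  simp only [ofReal_one, one_mul] at this
  exact this.mono_left nhdsWithin_le_nhds

lemma poly_radial (q : Polynomial ℂ) (ζ : ℂ) :
    Tendsto (fun r : ℝ => q.eval ((r:ℂ) * ζ)) (𝓝[<] 1) (𝓝 (q.eval ζ)) :=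
  (q.continuous.tendsto ζ).comp (tendsto_radial ζ)

lemma radial_mem : ∀ᶠ r : ℝ in 𝓝[<] 1, 0 < r ∧ r < 1 := by
  filter_upwards [Ioo_mem_nhdsLT (show (0:ℝ) < 1 by norm_num)] with r hr
  exact hr

lemma radial_norm {ζ : ℂ} (hζ : ‖ζ‖ = 1) {r : ℝ} (hr : 0 < r ∧ r < 1) : ‖(r:ℂ) * ζ‖ < 1 := by
  simp [hζ, abs_of_pos hr.1, hr.2]

lemma radial_ne {ζ : ℂ} (hζ : ‖ζ‖ = 1) {r : ℝ} (hr : 0 < r ∧ r < 1) : (r:ℂ) * ζ - ζ ≠ 0 := by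
  intro h
  have := radial_norm hζ hr
  rw [sub_eq_zero.1 h, hζ] at this
  exact lt_irrefl _ this

lemma ntlimit_radial {f : ℂ → ℂ} {ζ L : ℂ} (hζ : ‖ζ‖ = 1) (h : NTLimit f ζ L) :
    Tendsto (fun r : ℝ => f ((r:ℂ) * ζ)) (𝓝[<] 1) (𝓝 L) := by
  refine (h 2 (by norm_num)).comp ?_
  refine tendsto_nhdsWithin_iff.2 ⟨tendsto_radial ζ, ?_⟩
  filter_upwards [radial_mem] with r hr
  refine ⟨unitDisk_mem.2 (radial_norm hζ hr), ?_⟩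
  have h2 : ‖(r:ℂ) * ζ - ζ‖ = 1 - r := by
    rw [show (r:ℂ) * ζ - ζ = -((1 - r : ℝ) : ℂ) * ζ by push_cast; ring, norm_mul, norm_neg, hζ,
      Complex.norm_real, Real.norm_of_nonneg (by linarith [hr.2]), mul_one]
  have hn : ‖(r:ℂ) * ζ‖ = r := by simp [hζ, abs_of_pos hr.1]
  rw [h2, hn]; linarith [hr.2]

open scoped Topology ENNReal

/-- the polynomial a1 -/
def A1 {n : ℕ} (ξ : Fin n → ℂ) (m : Fin n → ℕ) : Polynomial ℂ :=
  ∏ j, (Polynomial.X - Polynomial.C (ξ j)) ^ (m j)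

lemma A1_eval {n : ℕ} (ξ : Fin n → ℂ) (m : Fin n → ℕ) (z : ℂ) :
    (A1 ξ m).eval z = a1fun ξ m z := by
  simp [A1, a1fun, Polynomial.eval_prod]

lemma A1_monic {n : ℕ} (ξ : Fin n → ℂ) (m : Fin n → ℕ) : (A1 ξ m).Monic :=
  Polynomial.monic_prod_of_monic _ _ fun j _ => (Polynomial.monic_X_sub_C _).pow _

lemma A1_degree {n : ℕ} (ξ : Fin n → ℂ) (m : Fin n → ℕ) :
    (A1 ξ m).degree = ((∑ j, m j : ℕ) : WithBot ℕ) := by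
  simp [A1, Polynomial.degree_prod]

lemma a1_ne_zero {n : ℕ} {ξ : Fin n → ℂ} {m : Fin n → ℕ} (hξ : ∀ j, ‖ξ j‖ = 1) {z : ℂ}
    (hz : ‖z‖ < 1) : a1fun ξ m z ≠ 0 := by
  unfold a1fun
  refine Finset.prod_ne_zero_iff.2 fun j _ => pow_ne_zero _ ?_
  intro h
  rw [sub_eq_zero.1 h, hξ j] at hz
  exact lt_irrefl _ hz

lemma PL {ζ : ℂ} (hζ : ‖ζ‖ = 1) (k : ℕ) : ∀ {L : ℂ} {q : Polynomial ℂ},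
    Tendsto (fun r : ℝ => q.eval ((r:ℂ) * ζ) / ((r:ℂ) * ζ - ζ) ^ k) (𝓝[<] 1) (𝓝 L) →
    ∃ q1 : Polynomial ℂ, q = (Polynomial.X - Polynomial.C ζ) ^ k * q1 ∧ q1.eval ζ = L := by
  induction k with
  | zero =>
    intro L q h
    refine ⟨q, by simp, ?_⟩
    simp only [pow_zero, div_one] at h
    exact tendsto_nhds_unique (poly_radial q ζ) h
  | succ k ih =>
    intro L q h
    have h1 : Tendsto (fun r : ℝ => q.eval ((r:ℂ) * ζ) / ((r:ℂ) * ζ - ζ) ^ k) (𝓝[<] 1) (𝓝 0) := by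
      have h2 : Tendsto (fun r : ℝ => (r:ℂ) * ζ - ζ) (𝓝[<] 1) (𝓝 0) := by
        simpa using (tendsto_radial ζ).sub_const ζ
      have h3 := h.mul h2
      rw [mul_zero] at h3
      refine h3.congr' ?_
      filter_upwards [radial_mem] with r hr
      have := radial_ne hζ hr
      rw [pow_succ, ← div_div, div_mul_cancel₀ _ this]
    obtain ⟨q1, hq, hq1⟩ := ih h1
    obtain ⟨q2, hq2⟩ := Polynomial.dvd_iff_isRoot.2 hq1
    have hq' : q = (Polynomial.X - Polynomial.C ζ) ^ (k + 1) * q2 := by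
      rw [hq, hq2]; ring
    refine ⟨q2, hq', ?_⟩
    refine tendsto_nhds_unique (poly_radial q2 ζ) (h.congr' ?_)
    filter_upwards [radial_mem] with r hr
    have := radial_ne hζ hr
    rw [hq']
    simp only [Polynomial.eval_mul, Polynomial.eval_pow, Polynomial.eval_sub, Polynomial.eval_X,
      Polynomial.eval_C]
    rw [mul_div_cancel_left₀ _ (pow_ne_zero _ this)]

lemma A1_dvd {n : ℕ} {ξ : Fin n → ℂ} {m : Fin n → ℕ} (hinj : Function.Injective ξ)
    {q : Polynomial ℂ} (h : ∀ j, (Polynomial.X - Polynomial.C (ξ j)) ^ (m j) ∣ q) :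
    A1 ξ m ∣ q := by
  unfold A1
  apply Finset.prod_dvd_of_coprime
  · intro i _ j _ hij
    apply IsCoprime.pow
    exact Polynomial.isCoprime_X_sub_C_of_isUnit_sub
      (sub_ne_zero.2 (fun h => hij (hinj h))).isUnit
  · intro j _; exact h j

lemma dvd_of_radial {ζ : ℂ} (hζ : ‖ζ‖ = 1) {m : ℕ} (hm : 0 < m) {q : Polynomial ℂ}
    (h : Tendsto (fun r : ℝ => q.eval ((r:ℂ) * ζ) / ((r:ℂ) * ζ - ζ) ^ (m - 1)) (𝓝[<] 1) (𝓝 0)) :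
    (Polynomial.X - Polynomial.C ζ) ^ m ∣ q := by
  obtain ⟨q1, hq, hq1⟩ := PL hζ _ h
  obtain ⟨q2, hq2⟩ := Polynomial.dvd_iff_isRoot.2 hq1
  refine ⟨q2, ?_⟩
  rw [hq, hq2, ← mul_assoc, ← pow_succ, Nat.sub_add_cancel hm]

/-- `a1 g` vanishes radially to order `m j - 1`, and any smaller order. -/
lemma a1g_radial {n : ℕ} {ξ : Fin n → ℂ} {m : Fin n → ℕ} (hξ : ∀ j, ‖ξ j‖ = 1) (j : Fin n)
    {k : ℕ} (hk : k < m j) {g : ℂ → ℂ} (hg : MemH2 g) :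
    Tendsto (fun r : ℝ => a1fun ξ m (r * ξ j) * g (r * ξ j) / ((r:ℂ) * ξ j - ξ j) ^ k)
      (𝓝[<] 1) (𝓝 0) := by
  let R : Polynomial ℂ := (Polynomial.X - Polynomial.C (ξ j)) ^ (m j - 1 - k) *
    ∏ i ∈ Finset.univ.erase j, (Polynomial.X - Polynomial.C (ξ i)) ^ (m i)
  have h1 := (poly_radial R (ξ j)).mul (growth_radial hg (hξ j))
  rw [mul_zero] at h1
  refine h1.congr' ?_
  filter_upwards [radial_mem] with r hr
  have hne := radial_ne (hξ j) hr
  have : a1fun ξ m (r * ξ j) = ((r:ℂ) * ξ j - ξ j) ^ (m j) *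
      ∏ i ∈ Finset.univ.erase j, ((r:ℂ) * ξ j - ξ i) ^ (m i) := by
    unfold a1fun
    rw [Finset.mul_prod_erase _ (fun i => ((r:ℂ) * ξ j - ξ i) ^ (m i)) (Finset.mem_univ j)]
  rw [this, eq_div_iff (pow_ne_zero _ hne)]
  simp only [R, Polynomial.eval_mul, Polynomial.eval_pow, Polynomial.eval_sub, Polynomial.eval_X,
      Polynomial.eval_C, Polynomial.eval_prod]
  have e : m j = (m j - 1 - k) + 1 + k := by omega
  conv_rhs => rw [e, pow_add, pow_add]
  ring

lemma decomp_unique {n : ℕ} {ξ : Fin n → ℂ} {m : Fin n → ℕ} (hξ : ∀ j, ‖ξ j‖ = 1)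
    (hinj : Function.Injective ξ) (hm : ∀ j, 0 < m j) {f g g' : ℂ → ℂ} {q q' : Polynomial ℂ}
    (h : HbDecompOf ξ m f g q) (h' : HbDecompOf ξ m f g' q') :
    q = q' ∧ ∀ z, ‖z‖ < 1 → g z = g' z := by
  have hq : q - q' = 0 := by
    have hdvd : A1 ξ m ∣ q - q' := by
      refine A1_dvd hinj fun j => dvd_of_radial (hξ j) (hm j) ?_
      have hk : m j - 1 < m j := by have := hm j; omega
      refine (a1g_radial hξ j hk (h'.1.sub h.1)).congr' ?_
      filter_upwards [radial_mem] with r hr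
      have hz := unitDisk_mem.2 (radial_norm (hξ j) hr)
      have e1 := h.2.2 _ hz
      have e2 := h'.2.2 _ hz
      congr 1
      rw [Polynomial.eval_sub]
      rw [e1] at e2
      linear_combination -e2
    refine Polynomial.eq_zero_of_dvd_of_degree_lt hdvd ?_
    rw [A1_degree]
    exact (Polynomial.degree_sub_le _ _).trans_lt (max_lt h.2.1 h'.2.1)
  have hq' := sub_eq_zero.1 hq
  refine ⟨hq', fun z hz => ?_⟩
  have e1 := h.2.2 _ (unitDisk_mem.2 hz)
  have e2 := h'.2.2 _ (unitDisk_mem.2 hz)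
  rw [e1, hq'] at e2
  exact mul_left_cancel₀ (a1_ne_zero hξ hz) (add_right_cancel e2)

lemma hbNormSq_of_decomp {n : ℕ} {ξ : Fin n → ℂ} {m : Fin n → ℕ} (hξ : ∀ j, ‖ξ j‖ = 1)
    (hinj : Function.Injective ξ) (hm : ∀ j, 0 < m j) {f g : ℂ → ℂ} {q : Polynomial ℂ}
    (h : HbDecompOf ξ m f g q) :
    hbNormSq ξ m f = h2NormSq g + h2NormSq fun z => q.eval z := by
  have hm' : MemHb ξ m f := ⟨(g, q), h⟩
  have hd : HbDecompOf ξ m f (hbDecomp ξ m f).1 (hbDecomp ξ m f).2 := by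
    unfold hbDecomp; rw [dif_pos hm']; exact hm'.choose_spec
  obtain ⟨h1, h2⟩ := decomp_unique hξ hinj hm hd h
  unfold hbNormSq
  rw [h1, h2NormSq_congr h2]

lemma memHb_of_poly {n : ℕ} {ξ : Fin n → ℂ} {m : Fin n → ℕ} {f g : ℂ → ℂ} {Q : Polynomial ℂ}
    (hg : MemH2 g) (h : ∀ z, ‖z‖ < 1 → f z = a1fun ξ m z * g z + Q.eval z) :
    HbDecompOf ξ m f (fun z => g z + (Q /ₘ A1 ξ m).eval z) (Q %ₘ A1 ξ m) := by
  refine ⟨hg.add (memH2_poly _), ?_, fun z hz => ?_⟩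
  · rw [← A1_degree]
    exact Polynomial.degree_modByMonic_lt _ (A1_monic ξ m)
  · rw [h z (unitDisk_mem.1 hz)]
    conv_lhs => rw [← Polynomial.modByMonic_add_div Q (A1 ξ m)]
    simp only [Polynomial.eval_add, Polynomial.eval_mul, A1_eval]
    ring

lemma HbDecompOf.sub' {n : ℕ} {ξ : Fin n → ℂ} {m : Fin n → ℕ} {f f' g g' : ℂ → ℂ}
    {q q' : Polynomial ℂ} (h : HbDecompOf ξ m f g q) (h' : HbDecompOf ξ m f' g' q') :
    HbDecompOf ξ m (fun z => f z - f' z) (fun z => g z - g' z) (q - q') := by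
  refine ⟨h.1.sub h'.1, (Polynomial.degree_sub_le _ _).trans_lt (max_lt h.2.1 h'.2.1), ?_⟩
  intro z hz
  simp only [Polynomial.eval_sub]
  rw [h.2.2 z hz, h'.2.2 z hz]; ring

/-- good pair -/
def GP {n : ℕ} (ξ : Fin n → ℂ) (m : Fin n → ℕ) (v : ℂ → ℂ) (Q : Polynomial ℂ) : Prop :=
  DifferentiableOn ℂ v unitDisk ∧ (∃ C, ∀ z, ‖z‖ < 1 → ‖v z‖ ≤ C) ∧
    ∃ h, MemH2 h ∧ ∀ z, ‖z‖ < 1 → v z = a1fun ξ m z * h z + Q.eval z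

lemma GP.add {n : ℕ} {ξ : Fin n → ℂ} {m : Fin n → ℕ} {v v' : ℂ → ℂ} {Q Q' : Polynomial ℂ}
    (h : GP ξ m v Q) (h' : GP ξ m v' Q') : GP ξ m (fun z => v z + v' z) (Q + Q') := by
  obtain ⟨h1, ⟨C, hC⟩, g, hg, e⟩ := h
  obtain ⟨h1', ⟨C', hC'⟩, g', hg', e'⟩ := h'
  refine ⟨h1.add h1', ⟨C + C', fun z hz => (norm_add_le _ _).trans (add_le_add (hC z hz) (hC' z hz))⟩,
    _, hg.add hg', fun z hz => ?_⟩
  simp only [Polynomial.eval_add]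
  linear_combination e z hz + e' z hz

lemma GP.mul {n : ℕ} {ξ : Fin n → ℂ} {m : Fin n → ℕ} {v v' : ℂ → ℂ} {Q Q' : Polynomial ℂ}
    (h : GP ξ m v Q) (h' : GP ξ m v' Q') : GP ξ m (fun z => v z * v' z) (Q * Q') := by
  obtain ⟨h1, ⟨C, hC⟩, g, hg, e⟩ := h
  obtain ⟨h1', ⟨C', hC'⟩, g', hg', e'⟩ := h'
  refine ⟨h1.mul h1', ⟨C * C', fun z hz => ?_⟩,
    fun z => v z * g' z + Q'.eval z * g z, (hg'.bdd_mul h1 hC).add (hg.poly_mul Q'), fun z hz => ?_⟩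
  · rw [norm_mul]
    exact mul_le_mul (hC z hz) (hC' z hz) (norm_nonneg _) ((norm_nonneg _).trans (hC z hz))
  · simp only [Polynomial.eval_mul]
    linear_combination v z * e' z hz + Q'.eval z * e z hz

lemma GP.const {n : ℕ} {ξ : Fin n → ℂ} {m : Fin n → ℕ} (c : ℂ) :
    GP ξ m (fun _ => c) (Polynomial.C c) :=
  ⟨differentiableOn_const c, ⟨‖c‖, fun _ _ => le_rfl⟩, fun _ => 0, memH2_zero, fun z _ => by simp⟩

lemma GP.comp {n : ℕ} {ξ : Fin n → ℂ} {m : Fin n → ℕ} {v : ℂ → ℂ} {Q : Polynomial ℂ}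
    (h : GP ξ m v Q) (F : Polynomial ℂ) : GP ξ m (fun z => F.eval (v z)) (F.comp Q) := by
  induction F using Polynomial.induction_on' with
  | add p q hp hq => simpa using hp.add hq
  | monomial k c =>
    have hp : ∀ k : ℕ, GP ξ m (fun z => v z ^ k) (Q ^ k) := by
      intro k
      induction k with
      | zero => simpa using GP.const (ξ := ξ) (m := m) 1
      | succ k ih => simpa [pow_succ] using ih.mul h
    simpa using (GP.const c).mul (hp k)

lemma GP.congr {n : ℕ} {ξ : Fin n → ℂ} {m : Fin n → ℕ} {v v' : ℂ → ℂ} {Q : Polynomial ℂ}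
    (h : GP ξ m v Q) (e : ∀ z, ‖z‖ < 1 → v z = v' z) : GP ξ m v' Q := by
  obtain ⟨h1, ⟨C, hC⟩, g, hg, e1⟩ := h
  exact ⟨h1.congr fun z hz => (e z (unitDisk_mem.1 hz)).symm,
    ⟨C, fun z hz => by rw [← e z hz]; exact hC z hz⟩, g, hg, fun z hz => by rw [← e z hz, e1 z hz]⟩

/-- If the polynomial part is divisible by a1 then `v/a1` is in H2. -/
lemma GP.div {n : ℕ} {ξ : Fin n → ℂ} {m : Fin n → ℕ} {v : ℂ → ℂ} {Q : Polynomial ℂ}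
    (hξ : ∀ j, ‖ξ j‖ = 1)
    (h : GP ξ m v Q) (hQ : A1 ξ m ∣ Q) : MemH2 fun z => v z / a1fun ξ m z := by
  obtain ⟨h1, ⟨C, hC⟩, g, hg, e1⟩ := h
  obtain ⟨d, rfl⟩ := hQ
  refine (hg.add (memH2_poly d)).congr fun z hz => ?_
  rw [e1 z hz, eq_div_iff (a1_ne_zero hξ hz), Polynomial.eval_mul, A1_eval]
  ring

/-- the value of the polynomial part at `ξ j` is the radial limit -/
lemma GP.eval_eq {n : ℕ} {ξ : Fin n → ℂ} {m : Fin n → ℕ} {v : ℂ → ℂ} {Q : Polynomial ℂ}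
    (hξ : ∀ j, ‖ξ j‖ = 1) (hm : ∀ j, 0 < m j) (h : GP ξ m v Q) {j : Fin n} {L : ℂ}
    (hL : Tendsto (fun r : ℝ => v ((r:ℂ) * ξ j)) (𝓝[<] 1) (𝓝 L)) : Q.eval (ξ j) = L := by
  obtain ⟨_, _, g, hg, e⟩ := h
  have h1 := (a1g_radial hξ j (hm j) hg).add (poly_radial Q (ξ j))
  rw [zero_add] at h1
  refine tendsto_nhds_unique h1 (hL.congr' ?_)
  filter_upwards [radial_mem] with r hr
  rw [e _ (radial_norm (hξ j) hr)]; simp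

open scoped Topology ENNReal

/-! Fatou's theorem on radial limits -/

lemma conj_ee (θ : ℝ) : (starRingEnd ℂ) (ee θ) = (ee θ)⁻¹ := by
  rw [Complex.inv_def, Complex.normSq_eq_norm_sq, norm_ee]; simp

lemma ee_sub_ne {w : ℂ} (hw : ‖w‖ < 1) (θ : ℝ) : ee θ - w ≠ 0 := by
  intro h
  have := norm_ee θ
  rw [sub_eq_zero.1 h] at this
  linarith

lemma one_sub_mul_ne {w z : ℂ} (hw : ‖w‖ < 1) (hz : ‖z‖ ≤ 1) : 1 - w * z ≠ 0 := by
  intro h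
  have h1 : ‖w * z‖ = 1 := by rw [← sub_eq_zero.1 h]; simp
  rw [norm_mul] at h1
  nlinarith [norm_nonneg w, norm_nonneg z]

lemma cont_closed {f : ℂ → ℂ} (hf : ContinuousOn f (Metric.closedBall 0 1)) :
    Continuous fun θ => f (ee θ) := by
  apply hf.comp_continuous (by fun_prop)
  intro θ; simp

lemma dcl_cont {f : ℂ → ℂ} (hf : DiffContOnCl ℂ f (Metric.ball 0 1)) :
    ContinuousOn f (Metric.closedBall 0 1) := by
  have := hf.continuousOn
  rwa [closure_ball (0:ℂ) one_ne_zero] at this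

lemma dcl_mk {f : ℂ → ℂ} (h1 : DifferentiableOn ℂ f (Metric.ball 0 1))
    (h2 : ContinuousOn f (Metric.closedBall 0 1)) : DiffContOnCl ℂ f (Metric.ball 0 1) :=
  ⟨h1, by rwa [closure_ball (0:ℂ) one_ne_zero]⟩

lemma dcl_kernel {w : ℂ} (hw : ‖w‖ < 1) :
    DiffContOnCl ℂ (fun z => z / (1 - w * z) ^ 2) (Metric.ball 0 1) := by
  apply DifferentiableOn.diffContOnCl
  rw [closure_ball (0:ℂ) one_ne_zero]
  intro z hz
  have h : (1 - w * z) ^ 2 ≠ 0 := pow_ne_zero _ (one_sub_mul_ne hw (by simpa using hz))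
  apply DifferentiableAt.differentiableWithinAt
  exact DifferentiableAt.fun_div (by fun_prop) (by fun_prop) h

lemma cauchy_deriv {f : ℂ → ℂ} (hf : DiffContOnCl ℂ f (Metric.ball 0 1)) {r : ℝ} (hr0 : 0 ≤ r)
    (hr : r < 1) :
    ∫ θ, (1 - r ^ 2) * ((ee θ)⁻¹ - ee θ) / (‖ee θ - r‖ ^ 4 : ℝ) * f (ee θ) ∂lam = deriv f r := by
  have hrn : ‖(r:ℂ)‖ < 1 := by simpa [abs_of_nonneg hr0] using hr
  have hrm : (r:ℂ) ∈ Metric.ball (0:ℂ) 1 := by simpa using hrn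
  have hfc := dcl_cont hf
  have hd : DiffContOnCl ℂ (dslope f r) (Metric.ball 0 1) := by
    apply dcl_mk
    · exact (differentiableOn_dslope (Metric.isOpen_ball.mem_nhds hrm)).2 hf.differentiableOn
    · refine (continuousOn_dslope (mem_of_superset (Metric.isOpen_ball.mem_nhds hrm)
        Metric.ball_subset_closedBall)).2 ⟨hfc, ?_⟩
      exact hf.differentiableOn.differentiableAt (Metric.isOpen_ball.mem_nhds hrm)
  have hne : ∀ θ, ee θ - r ≠ 0 := fun θ => ee_sub_ne hrn θ
  have hne2 : ∀ θ, 1 - (r:ℂ) * ee θ ≠ 0 := fun θ => one_sub_mul_ne hrn (by simp)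
  have hcf := cont_closed hfc
  have h1 : ∫ θ, ee θ / (ee θ - r) * ((f (ee θ) - f r) / (ee θ - r)) ∂lam = deriv f r := by
    have := DiffContOnCl.circleAverage_smul_div (c := 0) (R := 1) (w := (r:ℂ)) (f := dslope f r)
      (by simpa using hd) (by simpa using hrm)
    rw [circleAverage_eq_lam] at this
    simp only [ofReal_one, one_mul, sub_zero, smul_eq_mul, dslope_same] at this
    rw [← this]
    congr 1; funext θ
    rw [dslope_of_ne _ (sub_ne_zero.1 (hne θ)), slope_def_field]
  have h2 : ∫ θ, ee θ / (1 - r * ee θ) ^ 2 * f (ee θ) ∂lam = 0 := by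
    have := mean_value_lam ((dcl_kernel hrn).smul hf)
    simpa using this
  have h3 : ∫ θ, ee θ / (ee θ - r) ^ 2 ∂lam = 0 := by
    have h4 := mean_value_lam (dcl_kernel hrn)
    simp only [zero_div] at h4
    have h5 := congrArg (starRingEnd ℂ) h4
    rw [← integral_conj, map_zero] at h5
    rw [← h5]
    congr 1; funext θ
    simp only [map_div₀, map_pow, map_sub, map_mul, map_one, conj_ee, conj_ofReal]
    have := ee_ne_zero θ
    have e : 1 - (r:ℂ) * (ee θ)⁻¹ = (ee θ - r) * (ee θ)⁻¹ := by field_simp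
    rw [e]
    field_simp [hne θ]
  have c1 : Continuous fun θ => ee θ / (ee θ - r) * ((f (ee θ) - f r) / (ee θ - r)) := by
    refine Continuous.mul (continuous_ee.div (by fun_prop) hne) ((hcf.sub continuous_const).div (by fun_prop) hne)
  have c2 : Continuous fun θ => ee θ / (1 - r * ee θ) ^ 2 * f (ee θ) := by
    refine Continuous.mul (continuous_ee.div (by fun_prop) fun θ => pow_ne_zero _ (hne2 θ)) hcf
  have c3 : Continuous fun θ => f r * (ee θ / (ee θ - r) ^ 2) := by
    exact continuous_const.mul (continuous_ee.div (by fun_prop) fun θ => pow_ne_zero _ (hne θ))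
  have key : ∫ θ, ((ee θ / (ee θ - r) * ((f (ee θ) - f r) / (ee θ - r)) +
      f r * (ee θ / (ee θ - r) ^ 2)) - ee θ / (1 - r * ee θ) ^ 2 * f (ee θ)) ∂lam = deriv f r := by
    have c13 : Continuous fun θ => ee θ / (ee θ - r) * ((f (ee θ) - f r) / (ee θ - r)) +
        f r * (ee θ / (ee θ - r) ^ 2) := c1.add c3
    rw [integral_sub (integrable_lam_of_continuous c13)
      (integrable_lam_of_continuous c2),
      integral_add (integrable_lam_of_continuous c1) (integrable_lam_of_continuous c3),
      integral_const_mul, h1, h2, h3]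
    simp
  rw [← key]
  congr 1; funext θ
  have e0 := ee_ne_zero θ
  have e1 := hne θ
  have e2 := hne2 θ
  have e3 : ((‖ee θ - r‖ ^ 4 : ℝ) : ℂ) = ((ee θ - r) * (1 - r * ee θ) * (ee θ)⁻¹) ^ 2 := by
    have : ((‖ee θ - r‖ ^ 2 : ℝ) : ℂ) = (ee θ - r) * (1 - r * ee θ) * (ee θ)⁻¹ := by
      rw [← Complex.normSq_eq_norm_sq, Complex.normSq_eq_conj_mul_self, map_sub, conj_ee, conj_ofReal]
      field_simp
    rw [← this]; push_cast; ring
  rw [e3]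
  field_simp
  ring

lemma norm_ee_sub_one_le {r : ℝ} (hr0 : 0 ≤ r) (hr : r < 1) (θ : ℝ) :
    ‖ee θ - 1‖ ≤ 2 * ‖ee θ - r‖ := by
  have h1 : ‖ee θ - 1‖ ≤ ‖ee θ - r‖ + ‖(r:ℂ) - 1‖ := by
    simpa using norm_add_le (ee θ - r) ((r:ℂ) - 1)
  have h2 : ‖(r:ℂ) - 1‖ = 1 - r := by
    rw [← ofReal_one, ← ofReal_sub, Complex.norm_real, Real.norm_eq_abs, abs_of_neg (by linarith)]
    ring
  have h3 : 1 - r ≤ ‖ee θ - r‖ := by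
    have := norm_sub_norm_le (ee θ) (r:ℂ)
    rw [norm_ee, Complex.norm_real, Real.norm_eq_abs, abs_of_nonneg hr0] at this
    exact this
  linarith

lemma fatou_deriv_bound {E : ℂ → ℂ} (hE : DiffContOnCl ℂ E (Metric.ball 0 1)) {ε C : ℝ}
    (hε : 0 ≤ ε) (hC : 0 ≤ C)
    (hb : ∀ θ, ‖E (ee θ)‖ ≤ ε * ‖ee θ - 1‖ + C * ‖ee θ - 1‖ ^ 3) {r : ℝ} (hr0 : 0 ≤ r)
    (hr : r < 1) : ‖deriv E r‖ ≤ 8 * ε + 32 * C * (1 - r ^ 2) := by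
  have hrn : ‖(r:ℂ)‖ < 1 := by simpa [abs_of_nonneg hr0] using hr
  have hr2 : 0 < 1 - r ^ 2 := by nlinarith
  have hne : ∀ θ, ee θ - r ≠ 0 := fun θ => ee_sub_ne hrn θ
  rw [← cauchy_deriv hE hr0 hr]
  have hP : Continuous fun θ => (1 - r ^ 2) / ‖ee θ - r‖ ^ 2 :=
    continuous_const.div (by fun_prop) fun θ => pow_ne_zero _ (norm_ne_zero_iff.2 (hne θ))
  have hI : ∫ θ, (8 * ε * ((1 - r ^ 2) / ‖ee θ - r‖ ^ 2) + 32 * C * (1 - r ^ 2)) ∂lam =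
      8 * ε + 32 * C * (1 - r ^ 2) := by
    rw [integral_add (integrable_lam_of_continuous (hP.const_mul _)) (integrable_const _),
      integral_const_mul]
    have := poisson_lam_one hrn
    rw [Complex.norm_real, Real.norm_eq_abs, sq_abs] at this
    rw [this]; simp
  rw [← hI]
  refine norm_integral_le_of_norm_le (integrable_lam_of_continuous (by fun_prop)) ?_
  refine Eventually.of_forall fun θ => ?_
  have hd : 0 < ‖ee θ - r‖ := norm_pos_iff.2 (hne θ)
  have h1 : ‖(ee θ)⁻¹ - ee θ‖ ≤ 2 * ‖ee θ - 1‖ := by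
    have : (ee θ)⁻¹ - ee θ = -((ee θ - 1) * (ee θ + 1) * (ee θ)⁻¹) := by
      have := ee_ne_zero θ
      field_simp; ring
    rw [this, norm_neg, norm_mul, norm_mul, norm_inv, norm_ee, inv_one, mul_one, mul_comm]
    gcongr
    refine (norm_add_le _ _).trans ?_
    simp; norm_num
  have h2 := norm_ee_sub_one_le hr0 hr θ
  set x := ‖ee θ - 1‖ with hx
  set d := ‖ee θ - r‖
  have hx0 : 0 ≤ x := norm_nonneg _
  have hn : ‖((1:ℂ) - (r:ℂ) ^ 2)‖ = 1 - r ^ 2 := by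
    rw [← ofReal_one, ← ofReal_pow, ← ofReal_sub, Complex.norm_real, Real.norm_of_nonneg hr2.le]
  rw [norm_mul, norm_div, norm_mul, hn, Complex.norm_real, Real.norm_of_nonneg (by positivity)]
  calc (1 - r ^ 2) * ‖(ee θ)⁻¹ - ee θ‖ / d ^ 4 * ‖E (ee θ)‖
      ≤ (1 - r ^ 2) * (2 * x) / d ^ 4 * (ε * x + C * x ^ 3) := by
        gcongr; exact hb θ
    _ = (1 - r ^ 2) / d ^ 4 * (2 * ε * x ^ 2 + 2 * C * x ^ 4) := by ring
    _ ≤ (1 - r ^ 2) / d ^ 4 * (2 * ε * (2 * d) ^ 2 + 2 * C * (2 * d) ^ 4) := by gcongr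
    _ = _ := by field_simp; ring

lemma ee_arg {z : ℂ} (hz : ‖z‖ = 1) : ee (arg z) = z := by
  have := norm_mul_exp_arg_mul_I z
  rw [hz] at this; simpa [ee] using this

lemma ee_zero : ee 0 = 1 := by simp [ee]

lemma hasDerivAt_ee (θ : ℝ) : HasDerivAt ee (ee θ * I) θ := by
  unfold ee
  have := ((hasDerivAt_id (θ:ℂ)).mul_const I).cexp.comp_ofReal
  simpa using this

lemma fatou_point {E : ℂ → ℂ} (hE : DiffContOnCl ℂ E (Metric.ball 0 1))
    (h0 : E 1 = 0) (hd : HasDerivAt (fun θ : ℝ => E (ee θ)) 0 0) :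
    Tendsto (fun r : ℝ => deriv E r) (𝓝[<] 1) (𝓝 0) := by
  have hEc := dcl_cont hE
  obtain ⟨M, hM⟩ := (isCompact_closedBall (0:ℂ) 1).exists_bound_of_continuousOn hEc
  have hM0 : 0 ≤ M := (norm_nonneg _).trans (hM 0 (by simp))
  have hlog : (fun z : ℂ => arg z) =O[𝓝 1] fun z => z - 1 := by
    have h1 : (fun z : ℂ => Complex.log z - Complex.log 1) =O[𝓝 1] fun z => z - 1 :=
      (Complex.hasDerivAt_log (z := 1) (by simp)).isBigO_sub
    refine Asymptotics.IsBigO.trans ?_ h1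
    refine Asymptotics.IsBigO.of_bound 1 (Eventually.of_forall fun z => ?_)
    simp only [Complex.log_one, sub_zero, one_mul]
    have := abs_im_le_norm (Complex.log z)
    simpa [Complex.log_im] using this
  have ho : (fun z : ℂ => E (ee (arg z))) =o[𝓝 1] fun z => z - 1 := by
    have h1 : (fun θ : ℝ => E (ee θ)) =o[𝓝 0] fun θ : ℝ => θ := by
      have := hd.isLittleO
      simpa [ee_zero, h0] using this
    have h2 : Tendsto (fun z : ℂ => arg z) (𝓝 1) (𝓝 0) := by
      have := (Complex.continuousAt_arg (x := 1) (by simp)).tendsto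
      simpa using this
    exact (h1.comp_tendsto h2).trans_isBigO hlog
  rw [Metric.tendsto_nhds]
  intro ε hε
  have h3 := ho.bound (show (0:ℝ) < ε / 16 by positivity)
  rw [Metric.eventually_nhds_iff] at h3
  obtain ⟨δ, hδ, h3⟩ := h3
  have hb : ∀ θ, ‖E (ee θ)‖ ≤ ε / 16 * ‖ee θ - 1‖ + M / δ ^ 3 * ‖ee θ - 1‖ ^ 3 := by
    intro θ
    rcases lt_or_ge ‖ee θ - 1‖ δ with h | h
    · have := h3 (y := ee θ) (by simpa [dist_eq_norm] using h)
      rw [ee_arg (norm_ee θ)] at this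
      have h4 : 0 ≤ M / δ ^ 3 * ‖ee θ - 1‖ ^ 3 := by positivity
      linarith
    · have h4 := hM (ee θ) (by simp)
      have h5 : M ≤ M / δ ^ 3 * ‖ee θ - 1‖ ^ 3 := by
        rw [div_mul_eq_mul_div, le_div_iff₀ (by positivity)]
        gcongr
      have h6 : 0 ≤ ε / 16 * ‖ee θ - 1‖ := by positivity
      linarith
  have h4 : ∀ᶠ r : ℝ in 𝓝[<] 1, 32 * (M / δ ^ 3) * (1 - r ^ 2) < ε / 2 := by
    have : Tendsto (fun r : ℝ => 32 * (M / δ ^ 3) * (1 - r ^ 2)) (𝓝 1)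
        (𝓝 (32 * (M / δ ^ 3) * (1 - 1 ^ 2))) := by
      apply Continuous.tendsto; fun_prop
    simp only [one_pow, sub_self, mul_zero] at this
    exact (this.mono_left nhdsWithin_le_nhds).eventually (gt_mem_nhds (by positivity))
  filter_upwards [h4, radial_mem] with r hr1 hr2
  have := fatou_deriv_bound hE (by positivity) (by positivity) hb hr2.1.le hr2.2
  rw [dist_zero_right]
  linarith

lemma fatou_rot {Ψ : ℂ → ℂ} (hΨ : DiffContOnCl ℂ Ψ (Metric.ball 0 1)) {θ₀ : ℝ}
    (hd : DifferentiableAt ℝ (fun θ : ℝ => Ψ (ee θ)) θ₀) :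
    ∃ L, Tendsto (fun r : ℝ => deriv Ψ (r * ee θ₀)) (𝓝[<] 1) (𝓝 L) := by
  set ζ := ee θ₀ with hζ
  have hζ1 : ‖ζ‖ = 1 := norm_ee _
  set d := deriv (fun θ : ℝ => Ψ (ee θ)) θ₀ with hdd
  set c := d / I with hc
  let E : ℂ → ℂ := fun z => Ψ (ζ * z) - Ψ ζ - c * (z - 1)
  have hdc : DiffContOnCl ℂ (fun z => Ψ (ζ * z)) (Metric.ball 0 1) := by
    apply dcl_mk
    · refine hΨ.differentiableOn.comp (by fun_prop) fun z hz => ?_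
      simpa [hζ1] using hz
    · refine (dcl_cont hΨ).comp (by fun_prop) fun z hz => ?_
      simpa [hζ1] using hz
  have hE : DiffContOnCl ℂ E (Metric.ball 0 1) := by
    have h2 : DiffContOnCl ℂ (fun z : ℂ => c * (z - 1)) (Metric.ball 0 1) :=
      (by fun_prop : Differentiable ℂ fun z : ℂ => c * (z - 1)).diffContOnCl
    exact (hdc.sub diffContOnCl_const).sub h2
  have hadd : ∀ θ, ζ * ee θ = ee (θ + θ₀) := by
    intro θ; rw [hζ, ee, ee, ee, ← Complex.exp_add]; push_cast; congr 1; ring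
  have hder : HasDerivAt (fun θ : ℝ => E (ee θ)) 0 0 := by
    have h1 : HasDerivAt (fun θ : ℝ => Ψ (ee (θ + θ₀))) d 0 := by
      have : HasDerivAt (fun θ : ℝ => Ψ (ee θ)) d (0 + θ₀) := by rw [zero_add]; exact hd.hasDerivAt
      exact this.comp_add_const 0 θ₀
    have h2 : HasDerivAt (fun θ : ℝ => c * (ee θ - 1)) (c * (ee 0 * I)) 0 :=
      ((hasDerivAt_ee 0).sub_const 1).const_mul c
    have h3 := (h1.sub_const (Ψ ζ)).sub h2
    rw [ee_zero, one_mul, hc, div_mul_cancel₀ _ I_ne_zero, sub_self] at h3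
    refine h3.congr_of_eventuallyEq (Eventually.of_forall fun θ => ?_)
    simp only [E, hadd, Pi.sub_apply, hc]
  have h := fatou_point hE (by simp [E]) hder
  refine ⟨c / ζ, ?_⟩
  have hζ0 : ζ ≠ 0 := ee_ne_zero _
  have h' := (h.add_const c).div_const ζ
  rw [zero_add] at h'
  refine h'.congr' ?_
  filter_upwards [radial_mem] with r hr
  have hm : (r:ℂ) * ζ ∈ Metric.ball (0:ℂ) 1 := by simpa using radial_norm hζ1 hr
  have hΨd : HasDerivAt Ψ (deriv Ψ (r * ζ)) (ζ * r) := by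
    rw [mul_comm ζ]
    exact (hΨ.differentiableOn.differentiableAt (Metric.isOpen_ball.mem_nhds hm)).hasDerivAt
  have h5 : HasDerivAt (fun z => Ψ (ζ * z)) (deriv Ψ (r * ζ) * ζ) (r:ℂ) := by
    have := hΨd.comp (r:ℂ) ((hasDerivAt_id (r:ℂ)).const_mul ζ)
    rw [mul_one] at this
    exact this
  have h6 : HasDerivAt E (deriv Ψ (r * ζ) * ζ - c) (r:ℂ) := by
    have := (h5.sub_const (Ψ ζ)).sub (((hasDerivAt_id (r:ℂ)).sub_const 1).const_mul c)
    rw [mul_one] at this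
    exact this
  rw [h6.deriv]
  field_simp
  ring

/-- Fatou: bounded analytic functions have radial limits a.e. -/
lemma fatou {φ : ℂ → ℂ} (hφ : DifferentiableOn ℂ φ unitDisk) {C : ℝ}
    (hC : ∀ z, ‖z‖ < 1 → ‖φ z‖ ≤ C) :
    ∀ᵐ θ ∂lam, ∃ L, Tendsto (fun r : ℝ => φ (r * ee θ)) (𝓝[<] 1) (𝓝 L) := by
  have hC0 : 0 ≤ C := (norm_nonneg _).trans (hC 0 (by simp))
  obtain ⟨Φ, hΦ⟩ := hφ.isExactOn_ball
  have hL : LipschitzOnWith ⟨C, hC0⟩ Φ (Metric.ball 0 1) := by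
    refine Convex.lipschitzOnWith_of_nnnorm_hasDerivWithin_le (convex_ball 0 1)
      (fun x hx => (hΦ x hx).hasDerivWithinAt) fun x hx => ?_
    exact_mod_cast hC x (by simpa using hx)
  obtain ⟨Ψ, hΨL, hΨ⟩ := hL.extend_finite_dimension
  have hΨd : ∀ z ∈ Metric.ball (0:ℂ) 1, HasDerivAt Ψ (φ z) z := by
    intro z hz
    refine (hΦ z hz).congr_of_eventuallyEq ?_
    filter_upwards [Metric.isOpen_ball.mem_nhds hz] with y hy
    exact (hΨ hy).symm
  have hdc : DiffContOnCl ℂ Ψ (Metric.ball 0 1) :=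
    dcl_mk (fun z hz => (hΨd z hz).differentiableAt.differentiableWithinAt)
      hΨL.continuous.continuousOn
  have heL : LipschitzWith 1 ee := by
    apply lipschitzWith_of_nnnorm_deriv_le (fun θ => (hasDerivAt_ee θ).differentiableAt)
    intro θ
    rw [(hasDerivAt_ee θ).deriv]
    have : ‖ee θ * I‖ ≤ 1 := by simp
    exact_mod_cast this
  have hae := (hΨL.comp heL).ae_differentiableAt_real
  have hae' : ∀ᵐ θ ∂lam, DifferentiableAt ℝ (Ψ ∘ ee) θ := by
    unfold lam
    exact Measure.ae_smul_measure (ae_restrict_of_ae hae) _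
  filter_upwards [hae'] with θ hθ
  obtain ⟨L, h⟩ := fatou_rot hdc hθ
  refine ⟨L, h.congr' ?_⟩
  filter_upwards [radial_mem] with r hr
  exact (hΨd _ (by simpa using radial_norm (norm_ee θ) hr)).deriv

open scoped Topology ENNReal

/-- The polynomial built from the interior values. -/
def BB {n : ℕ} (p : ℕ) (m : Fin n → ℕ) (Λ : Fin n → ℂ) : Polynomial ℂ :=
  ∏ j ∈ Finset.univ.filter (fun j : Fin n => p ≤ (j : ℕ)),
    (Polynomial.X - Polynomial.C (Λ j)) ^ (m j)

/-- numerator polynomial -/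
def GG {n : ℕ} (p : ℕ) (ξ : Fin n → ℂ) (m : Fin n → ℕ) (Λ : Fin n → ℂ) : Polynomial ℂ :=
  A1 ξ m * BB p m Λ

lemma ufun_eq {n : ℕ} (p : ℕ) (ξ : Fin n → ℂ) (m : Fin n → ℕ) (Λ : Fin n → ℂ) (φ : ℂ → ℂ) (z : ℂ) :
    ufun p ξ m Λ φ z = (GG p ξ m Λ).eval (φ z) / a1fun ξ m z := by
  simp [ufun, GG, BB, A1_eval, Polynomial.eval_prod]

/-- Standing assumptions. -/
structure Stp {n : ℕ} (p : ℕ) (ξ : Fin n → ℂ) (m : Fin n → ℕ) (Λ : Fin n → ℂ) (φ : ℂ → ℂ) :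
    Prop where
  hξ : ∀ j, ‖ξ j‖ = 1
  hinj : Function.Injective ξ
  hm : ∀ j, 0 < m j
  hφd : DifferentiableOn ℂ φ unitDisk
  hφ1 : ∀ z, ‖z‖ < 1 → ‖φ z‖ < 1
  hrad : ∀ j, Tendsto (fun r : ℝ => φ ((r:ℂ) * ξ j)) (𝓝[<] 1) (𝓝 (Λ j))
  hΛc : ∀ j : Fin n, (j : ℕ) < p → ‖Λ j‖ = 1
  hΛd : ∀ j : Fin n, p ≤ (j : ℕ) → ‖Λ j‖ < 1
  hb : MemHb ξ m φ

lemma bdryVal_eq {f : ℂ → ℂ} {ζ L : ℂ}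
    (h : Tendsto (fun r : ℝ => f ((r:ℂ) * ζ)) (𝓝[<] 1) (𝓝 L)) : bdryVal f ζ = L :=
  h.limUnder_eq

lemma bdry_tendsto {f : ℂ → ℂ} {ζ L : ℂ}
    (h : Tendsto (fun r : ℝ => f ((r:ℂ) * ζ)) (𝓝[<] 1) (𝓝 L)) :
    Tendsto (fun r : ℝ => f ((r:ℂ) * ζ)) (𝓝[<] 1) (𝓝 (bdryVal f ζ)) := by
  rw [bdryVal_eq h]; exact h

lemma fatou_bdry {φ : ℂ → ℂ} (hφ : DifferentiableOn ℂ φ unitDisk) {C : ℝ}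
    (hC : ∀ z, ‖z‖ < 1 → ‖φ z‖ ≤ C) :
    ∀ᵐ θ ∂lam, Tendsto (fun r : ℝ => φ (r * ee θ)) (𝓝[<] 1) (𝓝 (bdryVal φ (ee θ))) := by
  filter_upwards [fatou hφ hC] with θ ⟨L, hL⟩
  exact bdry_tendsto hL

lemma lam_ee_eq (ζ : ℂ) : ∀ᵐ θ ∂lam, ee θ ≠ ζ := by
  have hcount : ({θ : ℝ | ee θ = ζ}).Countable := by
    by_cases h : ∃ θ₀, ee θ₀ = ζ
    · obtain ⟨θ₀, h0⟩ := h
      refine (countable_range fun k : ℤ => θ₀ + k * (2 * Real.pi)).mono ?_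
      intro θ hθ
      have : ee θ = ee θ₀ := hθ.trans h0.symm
      unfold ee at this
      rw [Complex.exp_eq_exp_iff_exists_int] at this
      obtain ⟨k, hk⟩ := this
      refine ⟨k, ?_⟩
      have h2 : ((θ:ℂ) - (θ₀ + k * (2 * Real.pi))) * I = 0 := by linear_combination hk
      have h3 := (mul_eq_zero.1 h2).resolve_right I_ne_zero
      have h4 : θ - (θ₀ + k * (2 * Real.pi)) = 0 := by exact_mod_cast h3
      simp only
      linarith
    · push Not at h
      have : {θ : ℝ | ee θ = ζ} = ∅ := by ext θ; simp [h θ]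
      rw [this]; exact countable_empty
  have h0 : volume {θ : ℝ | ee θ = ζ} = 0 := hcount.measure_zero _
  unfold lam
  refine Measure.ae_smul_measure (ae_restrict_of_ae ?_) _
  rw [ae_iff]
  simpa using h0

lemma a1_ae_ne {n : ℕ} (ξ : Fin n → ℂ) (m : Fin n → ℕ) : ∀ᵐ θ ∂lam, a1fun ξ m (ee θ) ≠ 0 := by
  have : ∀ᵐ θ ∂lam, ∀ j, ee θ ≠ ξ j := ae_all_iff.2 fun j => lam_ee_eq (ξ j)
  filter_upwards [this] with θ hθ
  exact Finset.prod_ne_zero_iff.2 fun j _ => pow_ne_zero _ (sub_ne_zero.2 (hθ j))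

/-- radial sequence -/
def rs (k : ℕ) : ℝ := 1 - 1 / ((k : ℝ) + 2)

lemma rs_mem (k : ℕ) : 0 < rs k ∧ rs k < 1 := by
  unfold rs
  have : (0:ℝ) < (k:ℝ) + 2 := by positivity
  have h2 : 1 / ((k:ℝ) + 2) < 1 := by rw [div_lt_one this]; linarith
  have h3 : 0 < 1 / ((k:ℝ) + 2) := by positivity
  constructor <;> linarith

lemma rs_tendsto : Tendsto rs atTop (𝓝[<] 1) := by
  refine tendsto_nhdsWithin_iff.2 ⟨?_, Eventually.of_forall fun k => (rs_mem k).2⟩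
  unfold rs
  have h : Tendsto (fun k : ℕ => 1 / ((k:ℝ) + 2)) atTop (𝓝 0) := by
    have := (tendsto_const_div_atTop_nhds_zero_nat (1:ℝ)).comp (tendsto_add_atTop_nat 2)
    refine this.congr fun k => ?_
    simp
  simpa using h.const_sub 1

lemma bdry_aemeas {f : ℂ → ℂ} (hf : ContinuousOn f unitDisk)
    (h : ∀ᵐ θ ∂lam, Tendsto (fun r : ℝ => f (r * ee θ)) (𝓝[<] 1) (𝓝 (bdryVal f (ee θ)))) :
    AEMeasurable (fun θ => bdryVal f (ee θ)) lam := by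
  refine aemeasurable_of_tendsto_metrizable_ae atTop (f := fun k θ => f (rs k * ee θ))
    (fun k => (continuous_circle hf (rs_mem k).1.le (rs_mem k).2).aemeasurable) ?_
  filter_upwards [h] with θ hθ
  exact hθ.comp rs_tendsto

/-- Fatou lemma bound -/
lemma bdry_le_N2 {f : ℂ → ℂ} (hf : DifferentiableOn ℂ f unitDisk) {F : ℝ → ℂ}
    (h : ∀ᵐ θ ∂lam, Tendsto (fun r : ℝ => f (r * ee θ)) (𝓝[<] 1) (𝓝 (F θ))) :
    ∫⁻ θ, ENNReal.ofReal (‖F θ‖ ^ 2) ∂lam ≤ N2 f := by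
  calc ∫⁻ θ, ENNReal.ofReal (‖F θ‖ ^ 2) ∂lam
      = ∫⁻ θ, liminf (fun k => ENNReal.ofReal (‖f (rs k * ee θ)‖ ^ 2)) atTop ∂lam := by
        refine lintegral_congr_ae ?_
        filter_upwards [h] with θ hθ
        have := (ENNReal.continuous_ofReal.tendsto _).comp
          (((hθ.comp rs_tendsto).norm).pow 2)
        exact this.liminf_eq.symm
    _ ≤ liminf (fun k => ∫⁻ θ, ENNReal.ofReal (‖f (rs k * ee θ)‖ ^ 2) ∂lam) atTop := by
        refine lintegral_liminf_le fun k => ?_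
        have := continuous_circle hf.continuousOn (rs_mem k).1.le (rs_mem k).2
        exact (ENNReal.continuous_ofReal.comp (this.norm.pow 2)).measurable
    _ ≤ N2 f := by
        refine liminf_le_of_le (by isBoundedDefault) fun b hb => ?_
        obtain ⟨k, hk⟩ := hb.exists
        exact hk.trans (Mr_le_N2 hf (rs_mem k).1.le (rs_mem k).2)

section
variable {n p : ℕ} {ξ : Fin n → ℂ} {m : Fin n → ℕ} {Λ : Fin n → ℂ} {φ : ℂ → ℂ}

lemma Stp.bdryφ (S : Stp p ξ m Λ φ) :
    ∀ᵐ θ ∂lam, Tendsto (fun r : ℝ => φ (r * ee θ)) (𝓝[<] 1) (𝓝 (bdryVal φ (ee θ))) :=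
  fatou_bdry S.hφd fun z hz => (S.hφ1 z hz).le

lemma Stp.bdryφ_le (S : Stp p ξ m Λ φ) : ∀ᵐ θ ∂lam, ‖bdryVal φ (ee θ)‖ ≤ 1 := by
  filter_upwards [S.bdryφ] with θ hθ
  refine le_of_tendsto hθ.norm ?_
  filter_upwards [radial_mem] with r hr
  exact (S.hφ1 _ (radial_norm (norm_ee θ) hr)).le

lemma Stp.aemeasφ (S : Stp p ξ m Λ φ) : AEMeasurable (fun θ => bdryVal φ (ee θ)) lam :=
  bdry_aemeas S.hφd.continuousOn S.bdryφ

lemma Stp.bdryu (S : Stp p ξ m Λ φ) :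
    ∀ᵐ θ ∂lam, Tendsto (fun r : ℝ => ufun p ξ m Λ φ (r * ee θ)) (𝓝[<] 1)
      (𝓝 (bdryVal (ufun p ξ m Λ φ) (ee θ))) ∧
      bdryVal (ufun p ξ m Λ φ) (ee θ) =
        (GG p ξ m Λ).eval (bdryVal φ (ee θ)) / a1fun ξ m (ee θ) := by
  filter_upwards [S.bdryφ, a1_ae_ne ξ m] with θ h1 h2
  have h3 : Tendsto (fun r : ℝ => ufun p ξ m Λ φ (r * ee θ)) (𝓝[<] 1)
      (𝓝 ((GG p ξ m Λ).eval (bdryVal φ (ee θ)) / a1fun ξ m (ee θ))) := by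
    simp only [ufun_eq]
    refine Tendsto.div (((GG p ξ m Λ).continuous.tendsto _).comp h1) ?_ h2
    simp only [← A1_eval]
    exact poly_radial _ _
  exact ⟨bdry_tendsto h3, bdryVal_eq h3⟩

lemma Stp.udiff (S : Stp p ξ m Λ φ) : DifferentiableOn ℂ (ufun p ξ m Λ φ) unitDisk := by
  have h1 : DifferentiableOn ℂ (fun z => (GG p ξ m Λ).eval (φ z) / (A1 ξ m).eval z) unitDisk := by
    apply DifferentiableOn.fun_div
    · exact (GG p ξ m Λ).differentiable.comp_differentiableOn S.hφd
    · exact diff_poly _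
    · intro z hz
      rw [A1_eval]
      exact a1_ne_zero S.hξ (unitDisk_mem.1 hz)
  refine h1.congr fun z hz => ?_
  rw [ufun_eq, A1_eval]

lemma Stp.aemeasu (S : Stp p ξ m Λ φ) :
    AEMeasurable (fun θ => bdryVal (ufun p ξ m Λ φ) (ee θ)) lam :=
  bdry_aemeas S.udiff.continuousOn (S.bdryu.mono fun _ h => h.1)

end

/-- (iii) implies (ii) -/
lemma rep_to_vanishing {u φ : ℂ → ℂ}
    (h : ∀ ε > (0:ℝ), ∃ ρ ∈ Set.Ico (0:ℝ) 1, ∀ w ∈ unitDisk, ρ < ‖w‖ →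
        repKerInt u φ w < ENNReal.ofReal ε) : IsVanishingCarleson u φ := by
  intro ε hε
  obtain ⟨ρ, hρ, hw⟩ := h (ε / 4) (by positivity)
  refine ⟨min (1 - ρ) (1 / 2), ⟨lt_min (by linarith [hρ.2]) (by norm_num),
    (min_le_right _ _).trans_lt (by norm_num)⟩, fun r hr ζ hζ => ?_⟩
  have hζ1 := unitCircle_mem.1 hζ
  have hr0 : 0 < r := hr.1
  have hr1 : r < 1 - ρ := hr.2.trans_le (min_le_left _ _)
  have hr2 : r < 1 / 2 := hr.2.trans_le (min_le_right _ _)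
  set w : ℂ := ((1 - r : ℝ) : ℂ) * ζ with hwdef
  have hwn : ‖w‖ = 1 - r := by
    rw [hwdef, norm_mul, hζ1, mul_one, Complex.norm_real, Real.norm_of_nonneg (by linarith)]
  have hk := hw w (unitDisk_mem.2 (by rw [hwn]; linarith)) (by rw [hwn]; linarith)
  have hle : muMeas u φ (Metric.closedBall ζ r ∩ Metric.closedBall 0 1) ≤
      ENNReal.ofReal (4 * r) * repKerInt u φ w := by
    rw [muMeas_eq, repKerInt_eq, ← lintegral_const_mul' _ _ ENNReal.ofReal_ne_top]
    refine lintegral_mono fun θ => ?_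
    simp only
    split_ifs with hy
    · rw [← ENNReal.ofReal_mul (by positivity)]
      apply ENNReal.ofReal_le_ofReal
      set y := bdryVal φ (ee θ)
      have hy1 : ‖y - ζ‖ ≤ r := by simpa [dist_eq_norm] using hy.1
      have hy2 : ‖y‖ ≤ 1 := by simpa using hy.2
      have hne : (1 - (starRingEnd ℂ) w * y) ≠ 0 :=
        one_sub_mul_ne (by rw [Complex.norm_conj, hwn]; linarith) hy2
      have hζζ : (starRingEnd ℂ) ζ * ζ = 1 := by
        rw [← Complex.normSq_eq_conj_mul_self, Complex.normSq_eq_norm_sq, hζ1]; simp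
      have hD : ‖1 - (starRingEnd ℂ) w * y‖ ≤ 2 * r := by
        have e : 1 - (starRingEnd ℂ) w * y = (starRingEnd ℂ) ζ * (-(y - ζ) + (r:ℂ) * y) := by
          rw [hwdef, map_mul, conj_ofReal]; push_cast
          linear_combination -hζζ
        rw [e, norm_mul, Complex.norm_conj, hζ1, one_mul]
        refine (norm_add_le _ _).trans ?_
        rw [norm_neg, norm_mul, Complex.norm_real, Real.norm_of_nonneg hr0.le]
        nlinarith
      have hDpos : 0 < ‖1 - (starRingEnd ℂ) w * y‖ := norm_pos_iff.2 hne
      rw [← mul_div_assoc, le_div_iff₀ (by positivity), hwn]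
      have h1 : ‖1 - (starRingEnd ℂ) w * y‖ ^ 2 ≤ (2 * r) ^ 2 := by gcongr
      have h2 : (2 * r) ^ 2 ≤ 4 * r * (1 - (1 - r) ^ 2) := by nlinarith
      nlinarith [sq_nonneg ‖bdryVal u (ee θ)‖]
    · exact zero_le
  refine hle.trans ?_
  calc ENNReal.ofReal (4 * r) * repKerInt u φ w ≤ ENNReal.ofReal (4 * r) * ENNReal.ofReal (ε / 4) := by
        gcongr
    _ = ENNReal.ofReal (ε * r) := by
        rw [← ENNReal.ofReal_mul (by positivity)]; congr 1; ring

open scoped Topology ENNReal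

section
variable {n p : ℕ} {ξ : Fin n → ℂ} {m : Fin n → ℕ} {Λ : Fin n → ℂ} {φ : ℂ → ℂ}

lemma Stp.gp (S : Stp p ξ m Λ φ) : ∃ q, GP ξ m φ q ∧ ∀ j, q.eval (ξ j) = Λ j := by
  obtain ⟨⟨h, q⟩, hh, _, e⟩ := S.hb
  have hg : GP ξ m φ q := ⟨S.hφd, ⟨1, fun z hz => (S.hφ1 z hz).le⟩, h, hh,
    fun z hz => e z (unitDisk_mem.2 hz)⟩
  exact ⟨q, hg, fun j => hg.eval_eq S.hξ S.hm (S.hrad j)⟩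

/-- all interior and boundary values -/
def FF {n : ℕ} (m : Fin n → ℕ) (Λ : Fin n → ℂ) : Polynomial ℂ :=
  ∏ j, (Polynomial.X - Polynomial.C (Λ j)) ^ (m j)

lemma FF_comp_dvd {q : Polynomial ℂ} (hq : ∀ j, q.eval (ξ j) = Λ j) :
    A1 ξ m ∣ (FF m Λ).comp q := by
  unfold A1 FF
  rw [Polynomial.prod_comp]
  apply Finset.prod_dvd_prod_of_dvd
  intro j _
  rw [Polynomial.pow_comp]
  apply pow_dvd_pow_of_dvd
  rw [Polynomial.dvd_iff_isRoot]
  simp [hq]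

lemma Stp.FF_div (S : Stp p ξ m Λ φ) :
    MemH2 fun z => (FF m Λ).eval (φ z) / a1fun ξ m z := by
  obtain ⟨q, hq, hq1⟩ := S.gp
  exact (hq.comp (FF m Λ)).div S.hξ (FF_comp_dvd hq1)

/-- boundary part -/
def TT {n : ℕ} (p : ℕ) (m : Fin n → ℕ) (Λ : Fin n → ℂ) : Polynomial ℂ :=
  ∏ j ∈ Finset.univ.filter (fun j : Fin n => ¬ p ≤ (j : ℕ)),
    (Polynomial.X - Polynomial.C (Λ j)) ^ (m j)

lemma FF_eq : FF m Λ = BB p m Λ * TT p m Λ := by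
  unfold FF BB TT
  rw [Finset.prod_filter_mul_prod_filter_not]

lemma poly_comp_bdd (S : Stp p ξ m Λ φ) (P : Polynomial ℂ) :
    DifferentiableOn ℂ (fun z => P.eval (φ z)) unitDisk ∧
      ∃ C, 0 ≤ C ∧ ∀ z, ‖z‖ < 1 → ‖P.eval (φ z)‖ ≤ C := by
  refine ⟨P.differentiable.comp_differentiableOn S.hφd, ?_⟩
  obtain ⟨C, hC0, hC⟩ := poly_bdd P 1
  exact ⟨C, hC0, fun z hz => hC _ (S.hφ1 z hz).le⟩

lemma Stp.dvd_interior (S : Stp p ξ m Λ φ) {q : Polynomial ℂ} (hq : GP ξ m φ q) (j : Fin n)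
    (hj : p ≤ (j:ℕ)) :
    (Polynomial.X - Polynomial.C (ξ j)) ^ (m j) ∣ (GG p ξ m Λ).comp q := by
  obtain ⟨h1, ⟨C, hC⟩, h0, hh0, e0⟩ := hq.comp (GG p ξ m Λ)
  have hk : m j - 1 < m j := by have := S.hm j; omega
  obtain ⟨hd, C', _, hC'⟩ := poly_comp_bdd S (A1 ξ m)
  have hH : MemH2 fun z => (A1 ξ m).eval (φ z) * ((FF m Λ).eval (φ z) / a1fun ξ m z) :=
    S.FF_div.bdd_mul hd hC'
  have t1 := a1g_radial S.hξ j hk hH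
  have t2 : Tendsto (fun r : ℝ => (TT p m Λ).eval (φ ((r:ℂ) * ξ j))) (𝓝[<] 1)
      (𝓝 ((TT p m Λ).eval (Λ j))) := ((TT p m Λ).continuous.tendsto _).comp (S.hrad j)
  have hT : (TT p m Λ).eval (Λ j) ≠ 0 := by
    unfold TT
    rw [Polynomial.eval_prod]
    refine Finset.prod_ne_zero_iff.2 fun i hi => ?_
    simp only [Polynomial.eval_pow, Polynomial.eval_sub, Polynomial.eval_X, Polynomial.eval_C]
    refine pow_ne_zero _ (sub_ne_zero.2 fun h => ?_)
    have h1 := S.hΛd j hj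
    have h2 := S.hΛc i (not_le.1 (Finset.mem_filter.1 hi).2)
    rw [h] at h1; linarith
  have t3 := (t1.div t2 hT).sub (a1g_radial S.hξ j hk hh0)
  rw [zero_div, sub_zero] at t3
  refine dvd_of_radial (S.hξ j) (S.hm j) (t3.congr' ?_)
  filter_upwards [radial_mem, t2.eventually_ne hT] with r hr hr2
  have hz := radial_norm (S.hξ j) hr
  have ha := a1_ne_zero (m := m) S.hξ hz
  have e1 : (GG p ξ m Λ).eval (φ ((r:ℂ) * ξ j)) = _ := e0 _ hz
  have e3 : (GG p ξ m Λ).eval (φ ((r:ℂ) * ξ j)) = (A1 ξ m).eval (φ ((r:ℂ) * ξ j)) *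
      (BB p m Λ).eval (φ ((r:ℂ) * ξ j)) := by rw [GG, Polynomial.eval_mul]
  rw [e3] at e1
  simp only [Pi.div_apply]
  rw [FF_eq (p := p), Polynomial.eval_mul]
  have hx := pow_ne_zero (m j - 1) (radial_ne (S.hξ j) hr)
  rw [eq_div_iff hx, sub_mul, div_mul_cancel₀ _ hx]
  have e2 : a1fun ξ m (↑r * ξ j) *
            (Polynomial.eval (φ (↑r * ξ j)) (A1 ξ m) *
              (Polynomial.eval (φ (↑r * ξ j)) (BB p m Λ) * Polynomial.eval (φ (↑r * ξ j)) (TT p m Λ) /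
                a1fun ξ m (↑r * ξ j))) /
          ((r:ℂ) * ξ j - ξ j) ^ (m j - 1) /
        Polynomial.eval (φ (↑r * ξ j)) (TT p m Λ) *
      ((r:ℂ) * ξ j - ξ j) ^ (m j - 1) = Polynomial.eval (φ (↑r * ξ j)) (A1 ξ m) *
      Polynomial.eval (φ (↑r * ξ j)) (BB p m Λ) := by
    generalize ((r:ℂ) * ξ j - ξ j) ^ (m j - 1) = X at *
    field_simp
  rw [e2, e1]; ring

lemma taylor_bound (ζ : ℂ) (N k : ℕ) : ∃ K : ℝ, 0 ≤ K ∧ ∀ q : Polynomial ℂ,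
    q.degree < (N : WithBot ℕ) →
    ‖(Polynomial.taylor ζ q).coeff k‖ ≤ K * Real.sqrt (h2NormSq fun z => q.eval z) := by
  refine ⟨∑ i ∈ Finset.range N, ‖(Polynomial.taylor ζ (Polynomial.X ^ i)).coeff k‖,
    Finset.sum_nonneg fun i _ => norm_nonneg _, fun q hq => ?_⟩
  have e : q = ∑ i ∈ Finset.range N, q.coeff i • (Polynomial.X ^ i : Polynomial ℂ) := by
    by_cases h : q = 0
    · simp [h]
    · have hn : q.natDegree < N := (Polynomial.natDegree_lt_iff_degree_lt h).2 hq
      conv_lhs => rw [q.as_sum_range' N hn]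
      exact Finset.sum_congr rfl fun i _ => by
        rw [Polynomial.smul_X_eq_monomial]
  conv_lhs => rw [e]
  rw [map_sum, Polynomial.finsetSum_coeff, Finset.sum_mul]
  refine (norm_sum_le _ _).trans (Finset.sum_le_sum fun i _ => ?_)
  rw [map_smul, Polynomial.coeff_smul, smul_eq_mul, norm_mul, mul_comm]
  gcongr
  apply Real.le_sqrt_of_sq_le
  have := coeff_sq_le_h2NormSq (memH2_poly q) i
  rwa [taylorCoeff_poly] at this

/-- averaged test polynomial -/
def gK (L : ℂ) (K : ℕ) : Polynomial ℂ :=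
  ∑ i ∈ Finset.range K, Polynomial.monomial i ((K:ℂ)⁻¹ * (starRingEnd ℂ) L ^ i)

lemma gK_eval {L : ℂ} (hL : ‖L‖ = 1) {K : ℕ} (hK : 0 < K) : (gK L K).eval L = 1 := by
  unfold gK
  rw [Polynomial.eval_finsetSum]
  have hLL : (starRingEnd ℂ) L * L = 1 := by
    rw [← Complex.normSq_eq_conj_mul_self, Complex.normSq_eq_norm_sq, hL]; simp
  have : ∀ i ∈ Finset.range K, (Polynomial.monomial i ((K:ℂ)⁻¹ * (starRingEnd ℂ) L ^ i)).eval L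
      = (K:ℂ)⁻¹ := by
    intro i _
    rw [Polynomial.eval_monomial, mul_assoc, ← mul_pow, hLL, one_pow, mul_one]
  rw [Finset.sum_congr rfl this]
  have : (K:ℂ) ≠ 0 := by exact_mod_cast hK.ne'
  simp [this]

lemma gK_norm {L : ℂ} (hL : ‖L‖ = 1) {K : ℕ} (hK : 0 < K) :
    N2 (fun z => (gK L K).eval z) ≤ ENNReal.ofReal (1 / K) := by
  rw [N2_eq (memH2_poly _)]
  apply ENNReal.ofReal_le_ofReal
  rw [h2NormSq_poly]
  have hc : ∀ k, (gK L K).coeff k = if k < K then (K:ℂ)⁻¹ * (starRingEnd ℂ) L ^ k else 0 := by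
    intro k
    simp [gK, Polynomial.finsetSum_coeff, Polynomial.coeff_monomial]
  have hs : (gK L K).support ⊆ Finset.range K := by
    intro k hk
    rw [Polynomial.mem_support_iff, hc] at hk
    by_contra h
    simp at h
    simp [not_lt.2 h] at hk
  calc _ ≤ ∑ k ∈ Finset.range K, ‖(gK L K).coeff k‖ ^ 2 :=
        Finset.sum_le_sum_of_subset_of_nonneg hs fun _ _ _ => by positivity
    _ = ∑ k ∈ Finset.range K, ((K:ℝ)⁻¹) ^ 2 := by
        refine Finset.sum_congr rfl fun k hk => ?_
        rw [hc, if_pos (Finset.mem_range.1 hk)]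
        simp [hL]
    _ ≤ _ := by
        have : (K:ℝ) ≠ 0 := by exact_mod_cast hK.ne'
        simp only [Finset.sum_const, Finset.card_range, nsmul_eq_mul]
        apply le_of_eq; field_simp

lemma Stp.dvd_boundary (S : Stp p ξ m Λ φ) (hC : CompBddHb ξ m φ) {q : Polynomial ℂ}
    (hq : GP ξ m φ q) (j : Fin n)
    (hj : (j:ℕ) < p) :
    (Polynomial.X - Polynomial.C (ξ j)) ^ (m j) ∣ (GG p ξ m Λ).comp q := by
  set Q := (GG p ξ m Λ).comp q with hQ
  by_contra hnd
  have hQ0 : Q ≠ 0 := fun h => hnd (h ▸ dvd_zero _)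
  obtain ⟨Q1, hQ1, hQ1d⟩ := Q.exists_eq_pow_rootMultiplicity_mul_and_not_dvd hQ0 (ξ j)
  set k := Q.rootMultiplicity (ξ j) with hkdef
  have hk : k < m j := by
    by_contra h
    apply hnd
    rw [hQ1]
    exact (pow_dvd_pow _ (not_lt.1 h)).mul_right _
  have hQ1ne : Q1.eval (ξ j) ≠ 0 := fun h => hQ1d (Polynomial.dvd_iff_isRoot.2 h)
  obtain ⟨h1, -, h0, hh0, e0⟩ := hq.comp (GG p ξ m Λ)
  obtain ⟨hmaps, C, hCb⟩ := hC
  obtain ⟨K, hK0, hK⟩ := taylor_bound (ξ j) (∑ j, m j) k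
  obtain ⟨CB, hCB0, hCB⟩ := poly_bdd (BB p m Λ) 1
  -- key estimate
  have key : ∀ g : Polynomial ℂ, ‖Q1.eval (ξ j) * g.eval (Λ j)‖ ≤
      K * Real.sqrt (|C| * (CB ^ 2 * h2NormSq fun z => g.eval z)) := by
    intro g
    have hdec : HbDecompOf ξ m (fun z => (GG p ξ m Λ * g).eval z)
        (fun z => (BB p m Λ * g).eval z) 0 := by
      refine ⟨memH2_poly _, by rw [Polynomial.degree_zero]; exact WithBot.bot_lt_coe _, fun z _ => ?_⟩
      simp only [GG, Polynomial.eval_mul, A1_eval, Polynomial.eval_zero]; ring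
    have hmem : MemHb ξ m (fun z => (GG p ξ m Λ * g).eval z) := ⟨(_, _), hdec⟩
    have hn := hbNormSq_of_decomp S.hξ S.hinj S.hm hdec
    have hb := hCb _ hmem
    obtain ⟨⟨hg, qg⟩, hdg⟩ := hmaps _ hmem
    have hn2 := hbNormSq_of_decomp S.hξ S.hinj S.hm hdg
    obtain ⟨hhg, hqg, eg⟩ := hdg
    simp only at hhg hqg eg
    have ta := (a1g_radial S.hξ j hk hh0)
    have tb := (a1g_radial S.hξ j hk hhg)
    have tg : Tendsto (fun r : ℝ => g.eval (φ ((r:ℂ) * ξ j))) (𝓝[<] 1)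
      (𝓝 (g.eval (Λ j))) := (g.continuous.tendsto _).comp (S.hrad j)
    have tall := ((ta.add (poly_radial Q1 (ξ j))).mul tg).sub tb
    rw [zero_add, sub_zero] at tall
    obtain ⟨q1, hq1, hq1v⟩ := PL (S.hξ j) k (q := qg) (tall.congr' (by
      filter_upwards [radial_mem] with r hr
      have hz := radial_norm (S.hξ j) hr
      have e1 := e0 _ hz
      have e2 := eg _ (unitDisk_mem.2 hz)
      have hx := pow_ne_zero k (radial_ne (S.hξ j) hr)
      rw [← hQ, hQ1] at e1
      simp only [Polynomial.eval_mul, Polynomial.eval_pow, Polynomial.eval_sub, Polynomial.eval_X,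
        Polynomial.eval_C] at e1 e2
      generalize ((r:ℂ) * ξ j - ξ j) ^ k = X at *
      field_simp
      rw [e1] at e2
      linear_combination e2))
    rw [← hq1v]
    have hc : (Polynomial.taylor (ξ j) qg).coeff k = q1.eval (ξ j) := by
      rw [hq1, Polynomial.taylor_mul, Polynomial.taylor_pow]
      simp only [map_sub, Polynomial.taylor_X, Polynomial.taylor_C, add_sub_cancel_right]
      rw [Polynomial.coeff_X_pow_mul', if_pos le_rfl, Nat.sub_self, Polynomial.taylor_coeff_zero]
    rw [← hc]
    refine (hK qg hqg).trans ?_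
    gcongr
    have h5 : h2NormSq (fun z => qg.eval z) ≤ hbNormSq ξ m fun z => (GG p ξ m Λ * g).eval (φ z) := by
      rw [hn2]; linarith [h2NormSq_nonneg hg]
    refine h5.trans (hb.trans ?_)
    rw [hn]
    have h6 : h2NormSq (fun z => (0 : Polynomial ℂ).eval z) = 0 := by rw [h2NormSq_poly]; simp
    rw [h6, add_zero]
    have h7 : h2NormSq (fun z => (BB p m Λ * g).eval z) ≤ CB ^ 2 * h2NormSq fun z => g.eval z := by
      have := N2_bdd_mul hCB0 (diff_poly (BB p m Λ)) (fun z hz => hCB z hz.le) (diff_poly g)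
      simp only [← Polynomial.eval_mul] at this
      rw [N2_eq (memH2_poly _), N2_eq (memH2_poly _), ← ENNReal.ofReal_mul (by positivity)] at this
      exact (ENNReal.ofReal_le_ofReal_iff (by have := h2NormSq_nonneg (fun z => g.eval z); positivity)).1 this
    calc _ ≤ |C| * h2NormSq (fun z => (BB p m Λ * g).eval z) := by
          gcongr
          · exact h2NormSq_nonneg _
          · exact le_abs_self C
      _ ≤ _ := by gcongr
  have key2 : ∀ i : ℕ, ‖Q1.eval (ξ j)‖ ≤ K * Real.sqrt (|C| * (CB ^ 2 * (1 / ((i + 1 : ℕ) : ℝ)))) := by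
    intro i
    have h1 := key (gK (Λ j) (i + 1))
    rw [gK_eval (S.hΛc j hj) (Nat.succ_pos i), mul_one] at h1
    refine h1.trans ?_
    gcongr
    have := gK_norm (S.hΛc j hj) (Nat.succ_pos i)
    rw [N2_eq (memH2_poly _)] at this
    exact (ENNReal.ofReal_le_ofReal_iff (by positivity)).1 this
  have lim : Tendsto (fun i : ℕ => K * Real.sqrt (|C| * (CB ^ 2 * (1 / ((i + 1 : ℕ) : ℝ))))) atTop
      (𝓝 (K * Real.sqrt (|C| * (CB ^ 2 * 0)))) := by
    have h0 : Tendsto (fun i : ℕ => (1 / ((i + 1 : ℕ) : ℝ))) atTop (𝓝 0) := by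
      have := tendsto_one_div_add_atTop_nhds_zero_nat (𝕜 := ℝ)
      simpa using this
    exact ((Real.continuous_sqrt.tendsto _).comp ((h0.const_mul _).const_mul _)).const_mul _
  have := ge_of_tendsto lim (Eventually.of_forall key2)
  simp at this
  exact hQ1ne this

lemma Stp.memH2_u (S : Stp p ξ m Λ φ) (hC : CompBddHb ξ m φ) : MemH2 (ufun p ξ m Λ φ) := by
  obtain ⟨q, hq, _⟩ := S.gp
  have := (hq.comp (GG p ξ m Λ)).div S.hξ (A1_dvd S.hinj fun j => by
    rcases le_or_gt p (j:ℕ) with h | h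
    · exact S.dvd_interior hq j h
    · exact S.dvd_boundary hC hq j h)
  exact this.congr fun z _ => by rw [ufun_eq]

/-- normalized kernel -/
def kw (w z : ℂ) : ℂ := (Real.sqrt (1 - ‖w‖ ^ 2) : ℂ) / (1 - (starRingEnd ℂ) w * z)

lemma kw_H2 {w : ℂ} (hw : ‖w‖ < 1) : MemH2 (kw w) ∧ h2NormSq (kw w) = 1 := by
  have hw2 : ‖w‖ ^ 2 < 1 := pow_lt_one₀ (norm_nonneg w) hw (by norm_num)
  obtain ⟨h1, h2⟩ := powerSeries_unique (f := kw w)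
    (c := fun k => (Real.sqrt (1 - ‖w‖ ^ 2) : ℂ) * (starRingEnd ℂ) w ^ k) (fun z hz => by
      have : HasSum (fun k => ((starRingEnd ℂ) w * z) ^ k) (1 - (starRingEnd ℂ) w * z)⁻¹ := by
        apply hasSum_geometric_of_norm_lt_one
        rw [norm_mul, Complex.norm_conj]
        nlinarith [norm_nonneg w, norm_nonneg z]
      have := this.mul_left (Real.sqrt (1 - ‖w‖ ^ 2) : ℂ)
      simpa only [kw, div_eq_mul_inv, mul_assoc, mul_pow] using this)
  have hs : HasSum (fun k => ‖taylorCoeff (kw w) k‖ ^ 2) 1 := by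
    have := (hasSum_geometric_of_lt_one (by positivity) hw2).mul_left (1 - ‖w‖ ^ 2)
    rw [mul_inv_cancel₀ (by linarith)] at this
    have e : (fun k => ‖taylorCoeff (kw w) k‖ ^ 2) = fun i => (1 - ‖w‖ ^ 2) * (‖w‖ ^ 2) ^ i := by
     funext k
     rw [h2, norm_mul, mul_pow, Complex.norm_real, Real.norm_eq_abs, sq_abs,
       Real.sq_sqrt (by linarith), norm_pow, Complex.norm_conj, ← pow_mul, ← pow_mul, mul_comm k 2]
    rw [e]; exact this
  exact ⟨⟨h1, hs.summable⟩, hs.tsum_eq⟩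
end

open scoped Topology ENNReal

section
variable {n p : ℕ} {ξ : Fin n → ℂ} {m : Fin n → ℕ} {Λ : Fin n → ℂ} {φ : ℂ → ℂ}

lemma kw_bdd {w z : ℂ} (hw : ‖w‖ < 1) (hz : ‖z‖ ≤ 1) : ‖kw w z‖ ≤ 1 / (1 - ‖w‖) := by
  unfold kw
  rw [norm_div, Complex.norm_real, Real.norm_eq_abs, abs_of_nonneg (Real.sqrt_nonneg _)]
  have h1 : Real.sqrt (1 - ‖w‖ ^ 2) ≤ 1 := by
    rw [Real.sqrt_le_one]; nlinarith [norm_nonneg w]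
  have h2 : 1 - ‖w‖ ≤ ‖1 - (starRingEnd ℂ) w * z‖ := by
    have := norm_sub_norm_le (1:ℂ) ((starRingEnd ℂ) w * z)
    rw [norm_one, norm_mul, Complex.norm_conj] at this
    nlinarith [norm_nonneg w]
  exact div_le_div₀ zero_le_one h1 (by linarith) h2

lemma kw_small {w z : ℂ} (hw : ‖w‖ < 1) (hz : ‖z‖ < 1) :
    ‖kw w z‖ ≤ Real.sqrt (1 - ‖w‖ ^ 2) / (1 - ‖z‖) := by
  unfold kw
  rw [norm_div, Complex.norm_real, Real.norm_eq_abs, abs_of_nonneg (Real.sqrt_nonneg _)]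
  have h2 : 1 - ‖z‖ ≤ ‖1 - (starRingEnd ℂ) w * z‖ := by
    have := norm_sub_norm_le (1:ℂ) ((starRingEnd ℂ) w * z)
    rw [norm_one, norm_mul, Complex.norm_conj] at this
    nlinarith [norm_nonneg z]
  exact div_le_div_of_nonneg_left (Real.sqrt_nonneg _) (by linarith) h2

lemma Stp.kwφ_diff (S : Stp p ξ m Λ φ) {w : ℂ} (hw : ‖w‖ < 1) :
    DifferentiableOn ℂ (fun z => kw w (φ z)) unitDisk :=
  (kw_H2 hw).1.1.comp S.hφd fun z hz => unitDisk_mem.2 (S.hφ1 z (unitDisk_mem.1 hz))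

lemma Stp.rep_le_N2 (S : Stp p ξ m Λ φ) {w : ℂ} (hw : ‖w‖ < 1) :
    repKerInt (ufun p ξ m Λ φ) φ w ≤ N2 fun z => ufun p ξ m Λ φ z * kw w (φ z) := by
  rw [repKerInt_eq]
  have := bdry_le_N2 (F := fun θ => bdryVal (ufun p ξ m Λ φ) (ee θ) * kw w (bdryVal φ (ee θ)))
    (S.udiff.mul (S.kwφ_diff hw)) (by
      filter_upwards [S.bdryφ, S.bdryφ_le, S.bdryu] with θ h1 h2 h3
      refine h3.1.mul (Tendsto.div tendsto_const_nhds ?_ ?_)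
      · exact tendsto_const_nhds.sub (tendsto_const_nhds.mul h1)
      · exact one_sub_mul_ne (by rwa [Complex.norm_conj]) h2)
  refine le_trans (le_of_eq ?_) this
  congr 1
  funext θ
  congr 1
  rw [norm_mul, kw, norm_div, Complex.norm_real, Real.norm_eq_abs, mul_pow, div_pow, sq_abs,
    Real.sq_sqrt (by nlinarith [norm_nonneg w])]
  ring

lemma Stp.compact_to_rep (S : Stp p ξ m Λ φ) (hC : CompCompactHb ξ m φ) :
    ∀ ε > (0:ℝ), ∃ ρ ∈ Set.Ico (0:ℝ) 1, ∀ w ∈ unitDisk, ρ < ‖w‖ →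
        repKerInt (ufun p ξ m Λ φ) φ w < ENNReal.ofReal ε := by
  by_contra hcon
  push Not at hcon
  obtain ⟨ε, hε, hcon⟩ := hcon
  have hex : ∀ k : ℕ, ∃ w : ℂ, ‖w‖ < 1 ∧ 1 - 1 / ((k:ℝ) + 1) < ‖w‖ ∧
      ENNReal.ofReal ε ≤ repKerInt (ufun p ξ m Λ φ) φ w := by
    intro k
    have hk : 0 < 1 / ((k:ℝ) + 1) := by positivity
    have hk2 : 1 / ((k:ℝ) + 1) ≤ 1 := by
      rw [div_le_one (by positivity)]; linarith [(Nat.cast_nonneg k : (0:ℝ) ≤ k)]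
    obtain ⟨w, h1, h2, h3⟩ := hcon (1 - 1 / ((k:ℝ) + 1)) ⟨by linarith, by linarith⟩
    exact ⟨w, unitDisk_mem.1 h1, h2, h3⟩
  choose w hw1 hw2 hw3 using hex
  have hu := S.memH2_u hC.1
  set u := ufun p ξ m Λ φ with hudef
  have hW : ∀ k, MemH2 fun z => u z * kw (w k) (φ z) := fun k =>
    (hu.bdd_mul (S.kwφ_diff (hw1 k)) (fun z hz => kw_bdd (hw1 k) (S.hφ1 z hz).le)).congr
      fun z _ => mul_comm _ _
  obtain ⟨CB, hCB0, hCB⟩ := poly_bdd (BB p m Λ) 1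
  have hc0 : 0 < CB + 1 := by linarith
  set c : ℂ := ((1 / (CB + 1) : ℝ) : ℂ) with hcdef
  have hcn : ‖c‖ = 1 / (CB + 1) := by
    rw [hcdef, Complex.norm_real, Real.norm_eq_abs, abs_of_pos (by positivity)]
  have hdec : ∀ k, HbDecompOf ξ m (fun z => a1fun ξ m z * (c * ((BB p m Λ).eval z * kw (w k) z)))
      (fun z => c * ((BB p m Λ).eval z * kw (w k) z)) 0 := fun k =>
    ⟨((kw_H2 (hw1 k)).1.poly_mul _).const_mul c,
      by rw [Polynomial.degree_zero]; exact WithBot.bot_lt_coe _, fun z _ => by simp⟩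
  have hz0 : h2NormSq (fun z => (0 : Polynomial ℂ).eval z) = 0 := by rw [h2NormSq_poly]; simp
  have hball : ∀ k, hbNormSq ξ m (fun z => a1fun ξ m z * (c * ((BB p m Λ).eval z * kw (w k) z))) ≤ 1 := by
    intro k
    rw [hbNormSq_of_decomp S.hξ S.hinj S.hm (hdec k), hz0, add_zero, h2NormSq_eq]
    apply ENNReal.toReal_le_of_le_ofReal zero_le_one
    have hd := ((kw_H2 (hw1 k)).1.poly_mul (BB p m Λ))
    rw [N2_const_mul hd.1]
    have h1 := N2_bdd_mul hCB0 (diff_poly (BB p m Λ)) (fun z hz => hCB z hz.le) (kw_H2 (hw1 k)).1.1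
    rw [N2_eq (kw_H2 (hw1 k)).1, (kw_H2 (hw1 k)).2] at h1
    refine (mul_le_mul_right h1 _).trans ?_
    rw [← ENNReal.ofReal_mul (by positivity), ← ENNReal.ofReal_mul (by positivity), hcn]
    apply ENNReal.ofReal_le_ofReal
    rw [div_pow, one_pow, mul_one, one_div_mul_eq_div, div_le_one (by positivity)]
    nlinarith
  obtain ⟨κ, g, hκ, ⟨⟨g1, q1⟩, hg⟩, hlim⟩ := hC.2 _ fun k => ⟨⟨(_, _), hdec k⟩, hball k⟩
  simp only at hg
  have hdec2 : ∀ k, HbDecompOf ξ m (fun z => a1fun ξ m (φ z) * (c * ((BB p m Λ).eval (φ z) * kw (w k) (φ z))))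
      (fun z => c * (u z * kw (w k) (φ z))) 0 := fun k =>
    ⟨(hW k).const_mul c, by rw [Polynomial.degree_zero]; exact WithBot.bot_lt_coe _, fun z hz => by
      have ha := a1_ne_zero (m := m) S.hξ (unitDisk_mem.1 hz)
      simp only [hudef, ufun_eq, GG, Polynomial.eval_mul, A1_eval, Polynomial.eval_zero]
      field_simp
      ring⟩
  have hlim2 : Tendsto (fun i => h2NormSq fun z => c * (u z * kw (w (κ i)) (φ z)) - g1 z) atTop (𝓝 0) := by
    refine squeeze_zero (fun i => h2NormSq_nonneg _) (fun i => ?_) hlim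
    rw [hbNormSq_of_decomp S.hξ S.hinj S.hm ((hdec2 (κ i)).sub' hg)]
    linarith [h2NormSq_nonneg (fun z => (0 - q1).eval z)]
  have hwlim : Tendsto (fun k => ‖w k‖) atTop (𝓝 1) := by
    have h1 : Tendsto (fun k : ℕ => 1 - 1 / ((k:ℝ) + 1)) atTop (𝓝 (1 - 0)) :=
      tendsto_const_nhds.sub tendsto_one_div_add_atTop_nhds_zero_nat
    rw [sub_zero] at h1
    exact tendsto_of_tendsto_of_tendsto_of_le_of_le h1 tendsto_const_nhds (fun k => (hw2 k).le)
      (fun k => (hw1 k).le)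
  have hg0 : ∀ z, ‖z‖ < 1 → g1 z = 0 := by
    intro z hz
    have hzp : 0 < 1 - ‖z‖ ^ 2 := by nlinarith [norm_nonneg z]
    have t1 : Tendsto (fun i => c * (u z * kw (w (κ i)) (φ z)) - g1 z) atTop (𝓝 0) := by
      have : Tendsto (fun i => ‖c * (u z * kw (w (κ i)) (φ z)) - g1 z‖ ^ 2) atTop (𝓝 0) := by
        have h2 := hlim2.div_const (1 - ‖z‖ ^ 2)
        rw [zero_div] at h2
        refine squeeze_zero (fun i => by positivity) (fun i => ?_) h2
        rw [le_div_iff₀ hzp]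
        exact growth (((hW (κ i)).const_mul c).sub hg.1) hz
      rw [tendsto_zero_iff_norm_tendsto_zero]
      have h3 := (Real.continuous_sqrt.tendsto _).comp this
      simpa [Function.comp_def, Real.sqrt_sq (norm_nonneg _)] using h3
    have t2 : Tendsto (fun i => kw (w (κ i)) (φ z)) atTop (𝓝 0) := by
      rw [tendsto_zero_iff_norm_tendsto_zero]
      refine squeeze_zero (fun i => norm_nonneg _) (fun i => kw_small (hw1 _) (S.hφ1 z hz)) ?_
      have h4 := (Real.continuous_sqrt.tendsto _).comp
        ((tendsto_const_nhds (x := (1:ℝ))).sub ((hwlim.comp hκ.tendsto_atTop).pow 2))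
      have h5 := h4.div_const (1 - ‖φ z‖)
      simpa [Function.comp_def] using h5
    have t3 := ((t2.const_mul (u z)).const_mul c).sub (tendsto_const_nhds (x := g1 z))
    have := tendsto_nhds_unique t1 t3
    simpa using this.symm
  have hlow : ∀ i, ε * (1 / (CB + 1)) ^ 2 ≤ h2NormSq fun z => c * (u z * kw (w (κ i)) (φ z)) - g1 z := by
    intro i
    rw [h2NormSq_congr (g := fun z => c * (u z * kw (w (κ i)) (φ z))) fun z hz => by rw [hg0 z hz, sub_zero],
      h2NormSq_eq, N2_const_mul (hW _).1, hcn, N2_eq (hW _), ENNReal.toReal_mul,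
      ENNReal.toReal_ofReal (by positivity), ENNReal.toReal_ofReal (h2NormSq_nonneg _), mul_comm]
    gcongr
    have := (hw3 (κ i)).trans (S.rep_le_N2 (hw1 (κ i)))
    rw [N2_eq (hW _)] at this
    exact (ENNReal.ofReal_le_ofReal_iff (h2NormSq_nonneg _)).1 this
  have := ge_of_tendsto hlim2 (Eventually.of_forall hlow)
  have : 0 < ε * (1 / (CB + 1)) ^ 2 := by positivity
  linarith
end

open scoped Topology ENNReal

section
variable {n p : ℕ} {ξ : Fin n → ℂ} {m : Fin n → ℕ} {Λ : Fin n → ℂ} {φ : ℂ → ℂ}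

lemma N2_le_bdry {v : ℂ → ℂ} {C : ℝ} (hv : DifferentiableOn ℂ v unitDisk)
    (hb : ∀ z, ‖z‖ < 1 → ‖v z‖ ≤ C) {F : ℝ → ℂ}
    (h : ∀ᵐ θ ∂lam, Tendsto (fun r : ℝ => v (r * ee θ)) (𝓝[<] 1) (𝓝 (F θ))) :
    N2 v ≤ ∫⁻ θ, ENNReal.ofReal (‖F θ‖ ^ 2) ∂lam := by
  have hlim : Tendsto (fun k => Mr v (rs k)) atTop (𝓝 (∫⁻ θ, ENNReal.ofReal (‖F θ‖ ^ 2) ∂lam)) := by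
    unfold Mr
    refine tendsto_lintegral_of_dominated_convergence' (fun _ => ENNReal.ofReal (C ^ 2))
      (fun k => ?_) (fun k => ?_) ?_ ?_
    · have := continuous_circle hv.continuousOn (rs_mem k).1.le (rs_mem k).2
      exact (ENNReal.continuous_ofReal.comp (this.norm.pow 2)).aemeasurable
    · refine Eventually.of_forall fun θ => ?_
      apply ENNReal.ofReal_le_ofReal
      have := hb (rs k * ee θ) (radial_norm (norm_ee θ) (rs_mem k))
      gcongr
    · simp
    · filter_upwards [h] with θ hθ
      exact (ENNReal.continuous_ofReal.tendsto _).comp (((hθ.comp rs_tendsto).norm).pow 2)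
  refine N2_le hv (r0 := 0) one_pos fun r _ hr0 hr => ?_
  refine ge_of_tendsto hlim ?_
  have h1 : ∀ᶠ k in atTop, r < rs k := by
    have : Tendsto rs atTop (𝓝 1) := rs_tendsto.mono_right nhdsWithin_le_nhds
    exact this.eventually (lt_mem_nhds hr)
  filter_upwards [h1] with k hk
  exact Mr_mono hv hr0 hk.le (rs_mem k).2

lemma shift_ge {z ζ : ℂ} (hz : ‖z‖ ≤ 1) (hζ : ‖ζ‖ = 1) {e : ℝ} (he : 0 ≤ e) :
    ‖z - ζ‖ ≤ ‖z - ((1 + e : ℝ) : ℂ) * ζ‖ ∧ e ≤ ‖z - ((1 + e : ℝ) : ℂ) * ζ‖ := by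
  constructor
  · apply le_of_sq_le_sq _ (norm_nonneg _)
    have hr : (z * (starRingEnd ℂ) ζ).re ≤ 1 := by
      refine (Complex.re_le_norm _).trans ?_
      rw [norm_mul, Complex.norm_conj, hζ, mul_one]; exact hz
    have hζ2 : ζ.re * ζ.re + ζ.im * ζ.im = 1 := by
      have := Complex.sq_norm ζ
      rw [hζ, Complex.normSq_apply] at this; linarith
    rw [Complex.sq_norm, Complex.sq_norm, Complex.normSq_apply, Complex.normSq_apply]
    simp at hr ⊢
    nlinarith [mul_nonneg he (sub_nonneg.2 hr), mul_nonneg he he]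
  · have := norm_sub_norm_le (((1 + e : ℝ) : ℂ) * ζ) z
    rw [norm_mul, Complex.norm_real, hζ, mul_one, Real.norm_eq_abs, abs_of_nonneg (by linarith)] at this
    rw [norm_sub_rev]; linarith

lemma a1_shift (hξ : ∀ j, ‖ξ j‖ = 1) {e : ℝ} (he : 0 ≤ e) {z : ℂ} (hz : ‖z‖ ≤ 1) :
    ‖a1fun ξ m z‖ ≤ ‖a1fun (fun j => ((1 + e : ℝ) : ℂ) * ξ j) m z‖ ∧
    ∏ j, e ^ (m j) ≤ ‖a1fun (fun j => ((1 + e : ℝ) : ℂ) * ξ j) m z‖ := by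
  unfold a1fun
  rw [norm_prod, norm_prod]
  constructor
  · refine Finset.prod_le_prod (fun _ _ => norm_nonneg _) fun j _ => ?_
    rw [norm_pow, norm_pow]
    have := (shift_ge hz (hξ j) he).1
    gcongr
  · refine Finset.prod_le_prod (fun _ _ => by positivity) fun j _ => ?_
    rw [norm_pow]
    have := (shift_ge hz (hξ j) he).2
    gcongr

lemma Stp.smirnov (S : Stp p ξ m Λ φ) (g : Polynomial ℂ) :
    N2 (fun z => ufun p ξ m Λ φ z * g.eval (φ z)) ≤
      ∫⁻ θ, ENNReal.ofReal (‖bdryVal (ufun p ξ m Λ φ) (ee θ) * g.eval (bdryVal φ (ee θ))‖ ^ 2) ∂lam := by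
  obtain ⟨hPd, C, hC0, hC⟩ := poly_comp_bdd S (GG p ξ m Λ * g)
  obtain ⟨hgd, -⟩ := poly_comp_bdd S g
  have step : ∀ e : ℝ, 0 < e → N2 (fun z => (GG p ξ m Λ * g).eval (φ z) /
      a1fun (fun j => ((1 + e : ℝ) : ℂ) * ξ j) m z) ≤
      ∫⁻ θ, ENNReal.ofReal (‖bdryVal (ufun p ξ m Λ φ) (ee θ) * g.eval (bdryVal φ (ee θ))‖ ^ 2) ∂lam := by
    intro e he
    have hpos : 0 < ∏ j, e ^ (m j) := Finset.prod_pos fun j _ => pow_pos he _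
    have hne : ∀ z : ℂ, ‖z‖ ≤ 1 → a1fun (fun j => ((1 + e : ℝ) : ℂ) * ξ j) m z ≠ 0 := fun z hz =>
      norm_pos_iff.1 (hpos.trans_le (a1_shift S.hξ he.le hz).2)
    have h1 := N2_le_bdry (v := fun z => (GG p ξ m Λ * g).eval (φ z) /
      a1fun (fun j => ((1 + e : ℝ) : ℂ) * ξ j) m z) (C := C / ∏ j, e ^ (m j))
      (F := fun θ => (GG p ξ m Λ * g).eval (bdryVal φ (ee θ)) /
        a1fun (fun j => ((1 + e : ℝ) : ℂ) * ξ j) m (ee θ)) (by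
        simp only [← A1_eval]
        refine DifferentiableOn.fun_div hPd (diff_poly _) fun z hz => ?_
        rw [A1_eval]; exact hne z (unitDisk_mem.1 hz).le) (by
        intro z hz
        rw [norm_div]
        exact div_le_div₀ hC0 (hC z hz) hpos (a1_shift S.hξ he.le hz.le).2) (by
        filter_upwards [S.bdryφ] with θ h1
        refine Tendsto.div (((GG p ξ m Λ * g).continuous.tendsto _).comp h1) ?_ (hne _ (by simp))
        simp only [← A1_eval]
        exact poly_radial _ _)
    refine h1.trans (lintegral_mono_ae ?_)
    filter_upwards [S.bdryu, a1_ae_ne ξ m] with θ h2 h3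
    apply ENNReal.ofReal_le_ofReal
    rw [h2.2, Polynomial.eval_mul, div_mul_eq_mul_div, norm_div, norm_div]
    have := norm_pos_iff.2 h3
    gcongr
    exact (a1_shift S.hξ he.le (by simp)).1
  refine N2_le (S.udiff.mul hgd) (r0 := 0) one_pos fun r hr hr0 hr1 => ?_
  have hlim : ∀ θ, Tendsto (fun k : ℕ => (GG p ξ m Λ * g).eval (φ (r * ee θ)) /
      a1fun (fun j => ((1 + 1 / ((k:ℝ) + 1) : ℝ) : ℂ) * ξ j) m (r * ee θ)) atTop
      (𝓝 (ufun p ξ m Λ φ (r * ee θ) * g.eval (φ (r * ee θ)))) := by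
    intro θ
    have e : ufun p ξ m Λ φ (r * ee θ) * g.eval (φ (r * ee θ)) =
      (GG p ξ m Λ * g).eval (φ (r * ee θ)) / a1fun ξ m (r * ee θ) := by
      rw [ufun_eq, Polynomial.eval_mul]; ring
    rw [e]
    refine tendsto_const_nhds.div ?_ (a1_ne_zero S.hξ (radial_norm (norm_ee θ) ⟨hr, hr1⟩))
    unfold a1fun
    refine tendsto_finsetProd _ fun j _ => ?_
    have h0 : Tendsto (fun k : ℕ => (((1 + 1 / ((k:ℝ) + 1) : ℝ) : ℂ))) atTop (𝓝 1) := by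
      have := (tendsto_const_nhds (x := (1:ℝ))).add (tendsto_one_div_add_atTop_nhds_zero_nat (𝕜 := ℝ))
      have h := (Complex.continuous_ofReal.tendsto _).comp this
      simpa [Function.comp_def] using h
    have h1 := ((tendsto_const_nhds (x := (r:ℂ) * ee θ)).sub (h0.mul_const (ξ j))).pow (m j)
    rwa [one_mul] at h1
  calc Mr (fun z => ufun p ξ m Λ φ z * g.eval (φ z)) r
      = ∫⁻ θ, liminf (fun k : ℕ => ENNReal.ofReal (‖(GG p ξ m Λ * g).eval (φ (r * ee θ)) /
      a1fun (fun j => ((1 + 1 / ((k:ℝ) + 1) : ℝ) : ℂ) * ξ j) m (r * ee θ)‖ ^ 2)) atTop ∂lam := by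
        unfold Mr
        refine lintegral_congr fun θ => ?_
        exact (((ENNReal.continuous_ofReal.tendsto _).comp (((hlim θ).norm).pow 2)).liminf_eq).symm
    _ ≤ liminf (fun k : ℕ => Mr (fun z => (GG p ξ m Λ * g).eval (φ z) /
      a1fun (fun j => ((1 + 1 / ((k:ℝ) + 1) : ℝ) : ℂ) * ξ j) m z) r) atTop := by
        apply lintegral_liminf_le'
        intro k
        have h1 := continuous_circle hPd.continuousOn hr0 hr1
        have hm1 : Measurable fun θ => a1fun (fun j => ((1 + 1 / ((k:ℝ) + 1) : ℝ) : ℂ) * ξ j) m (r * ee θ) := by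
          unfold a1fun; fun_prop
        exact ((h1.measurable.div hm1).norm.pow_const 2).ennreal_ofReal.aemeasurable
    _ ≤ _ := by
        refine liminf_le_of_le (by isBoundedDefault) fun b hb => ?_
        obtain ⟨k, hk⟩ := hb.exists
        refine hk.trans ?_
        refine le_trans (Mr_le_N2 ?_ hr0 hr1) (step (1 / ((k:ℝ) + 1)) (by positivity))
        simp only [← A1_eval]
        refine DifferentiableOn.fun_div hPd (diff_poly _) fun z hz => ?_
        rw [A1_eval]
        have he : 0 < 1 / ((k:ℝ) + 1) := by positivity
        exact norm_pos_iff.1 ((Finset.prod_pos fun j _ => pow_pos he _).trans_le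
          (a1_shift S.hξ he.le (unitDisk_mem.1 hz).le).2)
end

open scoped Topology ENNReal

/-- Poisson kernel -/
def PK (w : ℂ) (t : ℝ) : ℝ := (1 - ‖w‖ ^ 2) / ‖ee t - w‖ ^ 2

/-- symmetric kernel -/
def HK (w v : ℂ) : ℝ := (1 - ‖w‖ ^ 2 * ‖v‖ ^ 2) / ‖1 - (starRingEnd ℂ) w * v‖ ^ 2

lemma PK_nonneg {w : ℂ} (hw : ‖w‖ < 1) (t : ℝ) : 0 ≤ PK w t := by
  unfold PK
  have : 0 ≤ 1 - ‖w‖ ^ 2 := by nlinarith [norm_nonneg w]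
  positivity

lemma HK_nonneg {w v : ℂ} (hw : ‖w‖ < 1) (hv : ‖v‖ ≤ 1) : 0 ≤ HK w v := by
  unfold HK
  have : 0 ≤ 1 - ‖w‖ ^ 2 * ‖v‖ ^ 2 := by
    have h1 : ‖w‖ ^ 2 ≤ 1 := pow_le_one₀ (norm_nonneg _) hw.le
    have h2 : ‖v‖ ^ 2 ≤ 1 := pow_le_one₀ (norm_nonneg _) hv
    nlinarith [sq_nonneg ‖w‖, sq_nonneg ‖v‖]
  positivity

lemma norm_one_sub_conj (w : ℂ) (t : ℝ) : ‖1 - (starRingEnd ℂ) w * ee t‖ = ‖ee t - w‖ := by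
  have h : (starRingEnd ℂ) (ee t) * ee t = 1 := by
    rw [← Complex.normSq_eq_conj_mul_self, Complex.normSq_eq_norm_sq, norm_ee]; simp
  have : 1 - (starRingEnd ℂ) w * ee t = (starRingEnd ℂ) (ee t - w) * ee t := by
    rw [map_sub, sub_mul, h]
  rw [this, norm_mul, Complex.norm_conj, norm_ee, mul_one]

lemma PK_symm (r : ℝ) (θ t : ℝ) : PK ((r:ℂ) * ee θ) t = PK ((r:ℂ) * ee t) θ := by
  unfold PK
  have h1 := norm_one_sub_conj ((r:ℂ) * ee θ) t
  have h2 := norm_one_sub_conj ((r:ℂ) * ee t) θ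
  rw [← h1, ← h2]
  have : ‖1 - (starRingEnd ℂ) ((r:ℂ) * ee t) * ee θ‖ = ‖1 - (starRingEnd ℂ) ((r:ℂ) * ee θ) * ee t‖ := by
    rw [← Complex.norm_conj]
    simp [mul_assoc, mul_comm]
  rw [this]; simp

lemma herglotz_re (w z : ℂ) :
    ((1 + (starRingEnd ℂ) w * z) / (1 - (starRingEnd ℂ) w * z)).re = HK w z := by
  unfold HK
  have e : ‖w‖ ^ 2 * ‖z‖ ^ 2 = Complex.normSq ((starRingEnd ℂ) w * z) := by
    rw [Complex.normSq_mul, Complex.normSq_conj, Complex.normSq_eq_norm_sq, Complex.normSq_eq_norm_sq]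
  rw [e, Complex.div_re, ← Complex.normSq_eq_norm_sq]
  generalize (starRingEnd ℂ) w * z = x at *
  rw [← add_div]
  congr 1
  simp [Complex.normSq_apply]
  ring

lemma HK_ee (w : ℂ) (t : ℝ) : HK w (ee t) = PK w t := by
  unfold HK PK
  rw [norm_one_sub_conj]; simp

lemma PK_continuous {w : ℂ} (hw : ‖w‖ < 1) : Continuous (PK w) := by
  unfold PK
  refine Continuous.div (by fun_prop) (by fun_prop) fun t => ?_
  have := ee_sub_ne hw t
  simpa using this

lemma PK_mul_int {w v : ℂ} (hw : ‖w‖ < 1) (hv : ‖v‖ < 1) :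
    ∫ t, PK v t * PK w t ∂lam = HK w v := by
  have hne : ∀ z : ℂ, ‖z‖ ≤ 1 → 1 - (starRingEnd ℂ) w * z ≠ 0 := fun z hz =>
    one_sub_mul_ne (by rwa [Complex.norm_conj]) hz
  have hf : DiffContOnCl ℂ (fun z => (1 + (starRingEnd ℂ) w * z) / (1 - (starRingEnd ℂ) w * z))
      (Metric.ball 0 1) := by
    apply DifferentiableOn.diffContOnCl
    rw [closure_ball _ one_ne_zero]
    refine DifferentiableOn.fun_div (by fun_prop) (by fun_prop) fun z hz => hne z (by simpa using hz)
  have h1 := poisson_lam hf hv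
  have hinteg : Integrable (fun θ => (((1 - ‖v‖ ^ 2) / ‖ee θ - v‖ ^ 2 : ℝ) : ℂ) *
      ((1 + (starRingEnd ℂ) w * ee θ) / (1 - (starRingEnd ℂ) w * ee θ))) lam := by
    apply integrable_lam_of_continuous
    refine Continuous.mul (Complex.continuous_ofReal.comp (PK_continuous hv)) ?_
    exact Continuous.div (by fun_prop) (by fun_prop) fun θ => hne _ (by simp)
  have h2 := congrArg Complex.re h1
  rw [herglotz_re] at h2
  rw [← h2]
  have h3 := integral_re hinteg
  simp only [RCLike.re_eq_complex_re] at h3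
  rw [← h3]
  refine integral_congr_ae (Eventually.of_forall fun θ => ?_)
  simp only
  rw [Complex.re_ofReal_mul, herglotz_re, HK_ee]
  rfl

lemma PK_mul_lint {w v : ℂ} (hw : ‖w‖ < 1) (hv : ‖v‖ < 1) :
    ∫⁻ t, ENNReal.ofReal (PK v t) * ENNReal.ofReal (PK w t) ∂lam = ENNReal.ofReal (HK w v) := by
  have hc : Continuous fun t => PK v t * PK w t := (PK_continuous hv).mul (PK_continuous hw)
  rw [← PK_mul_int hw hv, ofReal_integral_eq_lintegral_ofReal (integrable_lam_of_continuous hc)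
    (Eventually.of_forall fun t => mul_nonneg (PK_nonneg hv t) (PK_nonneg hw t))]
  refine lintegral_congr fun t => ?_
  rw [ENNReal.ofReal_mul (PK_nonneg hv t)]

lemma PK_lint {v : ℂ} (hv : ‖v‖ < 1) : ∫⁻ t, ENNReal.ofReal (PK v t) ∂lam = 1 := by
  have h1 : ∀ t, PK 0 t = 1 := fun t => by simp [PK]
  have := PK_mul_lint (w := 0) (by simp) hv
  simpa [h1, HK] using this

lemma HK_circle {w : ℂ} {r : ℝ} (θ : ℝ) : HK w ((r:ℂ) * ee θ) = PK ((r:ℂ) * w) θ := by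
  unfold HK PK
  rw [← norm_one_sub_conj]
  have e1 : (starRingEnd ℂ) w * ((r:ℂ) * ee θ) = (starRingEnd ℂ) ((r:ℂ) * w) * ee θ := by
    simp; ring
  rw [e1]
  simp only [norm_mul, norm_ee, Complex.norm_real, Real.norm_eq_abs, mul_one, mul_pow, sq_abs]
  ring

lemma poisson_norm_le {f : ℂ → ℂ} (hf : DiffContOnCl ℂ f (Metric.ball 0 1)) {w : ℂ} (hw : ‖w‖ < 1) :
    ENNReal.ofReal ‖f w‖ ≤ ∫⁻ t, ENNReal.ofReal (PK w t) * ENNReal.ofReal ‖f (ee t)‖ ∂lam := by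
  rw [← poisson_lam hf hw, ofReal_norm]
  refine (enorm_integral_le_lintegral_enorm _).trans (le_of_eq ?_)
  refine lintegral_congr fun t => ?_
  have e : (1 - ‖w‖ ^ 2) / ‖ee t - w‖ ^ 2 = PK w t := rfl
  rw [← ofReal_norm, norm_mul, Complex.norm_real, Real.norm_eq_abs, e, abs_of_nonneg (PK_nonneg hw t),
    ENNReal.ofReal_mul (PK_nonneg hw t)]

/-- scalar inequality -/
lemma amgm_enn (y c B : ℝ≥0∞) (hB0 : B ≠ 0) (hB : B ≠ ⊤) (hc : c ≠ ⊤) :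
    2 * c * y ≤ y ^ 2 / B + c ^ 2 * B := by
  rcases eq_or_ne y ⊤ with rfl | hy
  · simp [hB, ENNReal.top_div_of_ne_top]
  lift y to NNReal using hy
  lift c to NNReal using hc
  lift B to NNReal using hB
  have hB0' : B ≠ 0 := by exact_mod_cast hB0
  have : 2 * c * y ≤ y ^ 2 / B + c ^ 2 * B := by
    rw [← NNReal.coe_le_coe]
    push_cast
    have hBp : (0:ℝ) < B := by exact_mod_cast pos_iff_ne_zero.2 hB0'
    have : (y:ℝ) ^ 2 / B + c ^ 2 * B - 2 * c * y = (y - c * B) ^ 2 / B := by field_simp; ring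
    have h2 : 0 ≤ ((y:ℝ) - c * B) ^ 2 / B := by positivity
    linarith
  calc (2:ℝ≥0∞) * c * y = ((2 * c * y : NNReal) : ℝ≥0∞) := by push_cast; rfl
    _ ≤ ((y ^ 2 / B + c ^ 2 * B : NNReal) : ℝ≥0∞) := by exact_mod_cast this
    _ = _ := by push_cast [ENNReal.coe_div hB0']; rfl

lemma bell_pt {x E B α M : ℝ≥0∞} (hM0 : M ≠ 0) (hM : M ≠ ⊤) (hx : x ≠ ⊤) (hBM : M ≤ B)
    (hAM : B + α ≤ 2 * M) (h : 2 * (x / B) * x ≤ E + (x / B) ^ 2 * B) :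
    x ^ 2 / (B + α) + (4 * M ^ 2)⁻¹ * (α * x ^ 2) ≤ E := by
  rcases eq_or_ne E ⊤ with rfl | hE
  · simp
  have h2M : 2 * M ≠ ⊤ := ENNReal.mul_ne_top (by simp) hM
  have hBt : B ≠ ⊤ := ne_top_of_le_ne_top h2M (le_self_add.trans hAM)
  have hαt : α ≠ ⊤ := ne_top_of_le_ne_top h2M (le_add_self.trans hAM)
  have hB0 : B ≠ 0 := fun h0 => hM0 (le_antisymm (h0 ▸ hBM) bot_le)
  lift x to NNReal using hx
  lift E to NNReal using hE
  lift B to NNReal using hBt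
  lift α to NNReal using hαt
  lift M to NNReal using hM
  have hB0' : B ≠ 0 := by exact_mod_cast hB0
  have hM0' : M ≠ 0 := by exact_mod_cast hM0
  have hBA : B + α ≠ 0 := by simp [hB0']
  have h4 : 4 * M ^ 2 ≠ 0 := by simp [hM0']
  have h' : 2 * (x / B) * x ≤ E + (x / B) ^ 2 * B := by
    have e1 : (((2 * (x / B) * x : NNReal)) : ℝ≥0∞) ≤ ((E + (x / B) ^ 2 * B : NNReal) : ℝ≥0∞) := by
      push_cast [ENNReal.coe_div hB0']; exact h
    exact_mod_cast e1
  have hBM' : M ≤ B := by exact_mod_cast hBM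
  have hAM' : B + α ≤ 2 * M := by exact_mod_cast hAM
  have goal : x ^ 2 / (B + α) + (4 * M ^ 2)⁻¹ * (α * x ^ 2) ≤ E := by
    rw [← NNReal.coe_le_coe] at h' hBM' hAM' ⊢
    push_cast at h' hBM' hAM' ⊢
    have hBp : (0:ℝ) < B := by exact_mod_cast pos_iff_ne_zero.2 hB0'
    have hMp : (0:ℝ) < M := by exact_mod_cast pos_iff_ne_zero.2 hM0'
    have hαp : (0:ℝ) ≤ α := α.2
    have e1 : 2 * ((x:ℝ) / (B:ℝ)) * (x:ℝ) - ((x:ℝ) / (B:ℝ)) ^ 2 * (B:ℝ) = (x:ℝ) ^ 2 / (B:ℝ) := by field_simp; ring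
    have e2 : (x:ℝ) ^ 2 / (B:ℝ) - (x:ℝ) ^ 2 / ((B:ℝ) + α) = (α:ℝ) * (x:ℝ) ^ 2 / ((B:ℝ) * ((B:ℝ) + α)) := by field_simp; ring
    have e3 : (4 * (M:ℝ) ^ 2)⁻¹ * ((α:ℝ) * (x:ℝ) ^ 2) ≤ (α:ℝ) * (x:ℝ) ^ 2 / ((B:ℝ) * ((B:ℝ) + α)) := by
      rw [inv_mul_eq_div]
      apply div_le_div_of_nonneg_left (by positivity) (by positivity)
      nlinarith
    linarith
  have := (ENNReal.coe_le_coe.2 goal)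
  push_cast [ENNReal.coe_div hBA, ENNReal.coe_inv h4] at this
  exact this

lemma bell_step {P : ℝ → ℝ → ℝ≥0∞} (hP : Measurable (Function.uncurry P))
    (h1 : ∀ θ, ∫⁻ t, P θ t ∂lam = 1) (h2 : ∀ t, ∫⁻ θ, P θ t ∂lam = 1)
    {X Y A' A α : ℝ → ℝ≥0∞} (hX : Measurable X) (hY : Measurable Y) (hA' : Measurable A')
    (hα : Measurable α) (hXt : ∀ θ, X θ ≠ ⊤)
    (hXY : ∀ θ, X θ ≤ ∫⁻ t, P θ t * Y t ∂lam) {M : ℝ≥0∞} (hM0 : M ≠ 0) (hM : M ≠ ⊤)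
    (hA'M : ∀ t, A' t ≤ M) (hAM : ∀ t, A t ≤ M)
    (hA : ∀ θ, A θ = α θ + ∫⁻ t, P θ t * A' t ∂lam) :
    ∫⁻ θ, X θ ^ 2 / (M + A θ) ∂lam + (4 * M ^ 2)⁻¹ * ∫⁻ θ, α θ * X θ ^ 2 ∂lam ≤
      ∫⁻ t, Y t ^ 2 / (M + A' t) ∂lam := by
  have hPθ : ∀ θ, Measurable (P θ) := fun θ => hP.of_uncurry_left
  set E : ℝ → ℝ≥0∞ := fun θ => ∫⁻ t, P θ t * (Y t ^ 2 / (M + A' t)) ∂lam with hE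
  have hEint : ∫⁻ θ, E θ ∂lam = ∫⁻ t, Y t ^ 2 / (M + A' t) ∂lam := by
    rw [hE, lintegral_lintegral_swap]
    · refine lintegral_congr fun t => ?_
      rw [lintegral_mul_const _ (hP.of_uncurry_right), h2, one_mul]
    · have : Measurable fun q : ℝ × ℝ => Function.uncurry P q * (Y q.2 ^ 2 / (M + A' q.2)) := by
        fun_prop
      exact this.aemeasurable
  have hm1 : Measurable fun θ => α θ * X θ ^ 2 := hα.mul (hX.pow_const 2)
  rw [← hEint, ← lintegral_const_mul _ hm1, ← lintegral_add_right _ (hm1.const_mul _)]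
  refine lintegral_mono fun θ => ?_
  set B := M + ∫⁻ t, P θ t * A' t ∂lam with hB
  have hBeq : B = ∫⁻ t, P θ t * (M + A' t) ∂lam := by
    simp only [mul_add]
    rw [lintegral_add_left ((hPθ θ).mul_const M), lintegral_mul_const _ (hPθ θ), h1, one_mul]
  have hAe : M + A θ = B + α θ := by rw [hA, hB]; ring
  have hBM : M ≤ B := le_self_add
  have h2M : B + α θ ≤ 2 * M := by
    rw [← hAe, two_mul]; gcongr; exact hAM θ
  have h2Mt : 2 * M ≠ ⊤ := ENNReal.mul_ne_top (by simp) hM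
  have hBt : B ≠ ⊤ := ne_top_of_le_ne_top h2Mt (le_self_add.trans h2M)
  have hB0 : B ≠ 0 := fun h0 => hM0 (le_antisymm (h0 ▸ hBM) bot_le)
  rw [hAe]
  refine bell_pt hM0 hM (hXt θ) hBM h2M ?_
  have hc : X θ / B ≠ ⊤ := ENNReal.div_ne_top (hXt θ) hB0
  calc 2 * (X θ / B) * X θ ≤ 2 * (X θ / B) * ∫⁻ t, P θ t * Y t ∂lam := by gcongr; exact hXY θ
    _ = ∫⁻ t, P θ t * (2 * (X θ / B) * Y t) ∂lam := by
        have hm2 : Measurable fun t => P θ t * Y t := (hPθ θ).mul hY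
        rw [← lintegral_const_mul _ hm2]
        refine lintegral_congr fun t => by ring
    _ ≤ ∫⁻ t, P θ t * (Y t ^ 2 / (M + A' t) + (X θ / B) ^ 2 * (M + A' t)) ∂lam := by
        refine lintegral_mono fun t => ?_
        have h3 : M + A' t ≠ 0 := by simp [hM0]
        have h4 : M + A' t ≠ ⊤ := ENNReal.add_ne_top.2 ⟨hM, ne_top_of_le_ne_top hM (hA'M t)⟩
        have := amgm_enn (Y t) (X θ / B) (M + A' t) h3 h4 hc
        gcongr
    _ = E θ + (X θ / B) ^ 2 * B := by
        have hm3 : Measurable fun t => P θ t * (M + A' t) := (hPθ θ).mul (hA'.const_add M)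
        have hm4 : Measurable fun t => P θ t * (Y t ^ 2 / (M + A' t)) :=
          (hPθ θ).mul ((hY.pow_const 2).div (hA'.const_add M))
        generalize hcc : X θ / B = c
        rw [hE, hBeq, ← lintegral_const_mul _ hm3, ← lintegral_add_left hm4]
        refine lintegral_congr fun t => by ring

open scoped Topology ENNReal

/-- normalized kernel, squared -/
def KK (w z : ℂ) : ℝ := (1 - ‖w‖ ^ 2) / ‖1 - (starRingEnd ℂ) w * z‖ ^ 2

/-- dyadic annuli -/
def LL (i : ℕ) : Set ℂ := {z | 1 - (1 / 2 : ℝ) ^ i ≤ ‖z‖ ∧ ‖z‖ < 1 - (1 / 2 : ℝ) ^ i / 2}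

/-- radii -/
def rr (i : ℕ) : ℝ := 1 - (1 / 2 : ℝ) ^ i / 4

lemma rr_mem (i : ℕ) : 3 / 4 ≤ rr i ∧ rr i < 1 := by
  unfold rr
  have h1 : (1 / 2 : ℝ) ^ i ≤ 1 := pow_le_one₀ (by norm_num) (by norm_num)
  have h2 : 0 < (1 / 2 : ℝ) ^ i := by positivity
  constructor <;> linarith

lemma rr_mono {i j : ℕ} (h : i ≤ j) : rr i ≤ rr j := by
  unfold rr
  have : (1 / 2 : ℝ) ^ j ≤ (1 / 2 : ℝ) ^ i := pow_le_pow_of_le_one (by norm_num) (by norm_num) h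
  linarith

lemma LL_scaled {i j : ℕ} (hij : i ≤ j) {z : ℂ} (hz : z ∈ LL j) :
    ‖((rr i / rr j ^ 2 : ℝ) : ℂ) * z‖ ≤ 1 - (1 / 2 : ℝ) ^ j / 4 := by
  obtain ⟨h1, h2⟩ := hz
  have hi := rr_mem i
  have hj := rr_mem j
  have hm := rr_mono hij
  have hjp : 0 < rr j := by linarith
  have hip : 0 < rr i := by linarith
  rw [norm_mul, Complex.norm_real, Real.norm_eq_abs, abs_of_nonneg (by positivity)]
  rw [div_mul_eq_mul_div, div_le_iff₀ (by positivity)]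
  have e : rr j = 1 - (1 / 2 : ℝ) ^ j / 4 := rfl
  rw [← e]
  have hd : 0 < (1 / 2 : ℝ) ^ j := by positivity
  have h3 : ‖z‖ ≤ rr j ^ 2 := by rw [e]; nlinarith
  calc rr i * ‖z‖ ≤ rr j * rr j ^ 2 := by gcongr
    _ = _ := by ring

lemma LL_scaled_lt {i j : ℕ} (hij : i ≤ j) {z : ℂ} (hz : z ∈ LL j) :
    ‖((rr i / rr j ^ 2 : ℝ) : ℂ) * z‖ < 1 := by
  have hd : 0 < (1 / 2 : ℝ) ^ j := by positivity
  linarith [LL_scaled hij hz]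

lemma PK_le_KK {i j : ℕ} (hij : i ≤ j) {z : ℂ} (hz : z ∈ LL j) (θ : ℝ) :
    PK (((rr i / rr j ^ 2 : ℝ) : ℂ) * z) θ ≤ 90 * KK ((rr i : ℂ) * ee θ) z := by
  have hs := LL_scaled hij hz
  obtain ⟨h1, h2⟩ := hz
  have hi := rr_mem i
  have hj := rr_mem j
  have hjp : 0 < rr j := by linarith
  have hip : 0 < rr i := by linarith
  have hd : 0 < (1 / 2 : ℝ) ^ j := by positivity
  have hdη : (1 / 2 : ℝ) ^ j ≤ (1 / 2 : ℝ) ^ i := pow_le_pow_of_le_one (by norm_num) (by norm_num) hij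
  have ei : rr i = 1 - (1 / 2 : ℝ) ^ i / 4 := rfl
  have ej : rr j = 1 - (1 / 2 : ℝ) ^ j / 4 := rfl
  set δ := (1 / 2 : ℝ) ^ j
  set η := (1 / 2 : ℝ) ^ i
  set w := ((rr i / rr j ^ 2 : ℝ) : ℂ) * z with hw
  have hδ1 : δ ≤ 1 := by linarith
  have hwz : rr i * ‖z‖ ≤ ‖w‖ := by
    rw [hw, norm_mul, Complex.norm_real, Real.norm_eq_abs, abs_of_nonneg (by positivity)]
    gcongr
    rw [le_div_iff₀ (by positivity)]
    have : rr j ^ 2 ≤ 1 := pow_le_one₀ hjp.le hj.2.le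
    nlinarith
  -- numerators
  have hn1 : 1 - ‖w‖ ^ 2 ≤ 10 * (1 - rr i ^ 2) := by
    have h3 : 1 - ‖w‖ ≤ 5 / 4 * η := by
      have : rr i * (1 - δ) ≤ ‖w‖ := le_trans (by gcongr) hwz
      nlinarith
    nlinarith [norm_nonneg w]
  -- denominators
  have hden : ‖1 - (starRingEnd ℂ) ((rr i : ℂ) * ee θ) * z‖ ≤ 3 * ‖ee θ - w‖ := by
    have e1 : ‖1 - (starRingEnd ℂ) ((rr i : ℂ) * ee θ) * z‖ = ‖ee θ - (rr i : ℂ) * z‖ := by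
      rw [← norm_one_sub_conj, ← Complex.norm_conj]
      simp [mul_assoc, mul_comm, mul_left_comm]
    rw [e1]
    have e2 : ee θ - (rr i : ℂ) * z = (ee θ - w) + ((1 - rr j ^ 2 : ℝ) : ℂ) * w := by
      rw [hw]
      have : (rr j : ℂ) ≠ 0 := by exact_mod_cast hjp.ne'
      push_cast
      field_simp
      ring
    rw [e2]
    refine (norm_add_le _ _).trans ?_
    have e3 : ‖((1 - rr j ^ 2 : ℝ) : ℂ) * w‖ ≤ δ / 2 := by
      have h5 : 0 ≤ 1 - rr j ^ 2 := by nlinarith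
      rw [norm_mul, Complex.norm_real, Real.norm_eq_abs, abs_of_nonneg h5]
      have h6 : 1 - rr j ^ 2 ≤ δ / 2 := by rw [ej]; nlinarith
      nlinarith [norm_nonneg w]
    have e4 : δ / 4 ≤ ‖ee θ - w‖ := by
      have := norm_sub_norm_le (ee θ) w
      rw [norm_ee] at this; linarith
    linarith
  have hwp : 0 < ‖ee θ - w‖ := by
    have := norm_sub_norm_le (ee θ) w
    rw [norm_ee] at this; linarith
  have hn2 : ‖(rr i : ℂ) * ee θ‖ = rr i := norm_r_ee (by linarith) θ
  have hkp : 0 < ‖1 - (starRingEnd ℂ) ((rr i : ℂ) * ee θ) * z‖ := by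
    rw [norm_pos_iff]
    exact one_sub_mul_ne (by rw [Complex.norm_conj, hn2]; exact hi.2) (by linarith)
  unfold PK KK
  rw [hn2, ← mul_div_assoc, div_le_div_iff₀ (by positivity) (by positivity)]
  have hi2 : 0 ≤ 1 - rr i ^ 2 := by nlinarith
  calc (1 - ‖w‖ ^ 2) * ‖1 - (starRingEnd ℂ) ((rr i : ℂ) * ee θ) * z‖ ^ 2
      ≤ (10 * (1 - rr i ^ 2)) * (3 * ‖ee θ - w‖) ^ 2 := by gcongr
    _ = _ := by ring

lemma LL_meas (i : ℕ) : MeasurableSet (LL i) := by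
  unfold LL
  exact (measurableSet_le measurable_const measurable_norm).inter
    (measurableSet_lt measurable_norm measurable_const)

lemma LL_disj : Pairwise (Function.onFun Disjoint LL) := by
  have key : ∀ i j : ℕ, i < j → Disjoint (LL i) (LL j) := by
    intro i j hij
    rw [Set.disjoint_left]
    rintro z ⟨_, h2⟩ ⟨h3, _⟩
    have : (1 / 2 : ℝ) ^ j ≤ (1 / 2 : ℝ) ^ (i + 1) :=
      pow_le_pow_of_le_one (by norm_num) (by norm_num) hij
    rw [pow_succ] at this
    linarith
  intro i j hij
  rcases lt_or_gt_of_ne hij with h | h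
  · exact key i j h
  · exact (key j i h).symm

lemma LL_cover {z : ℂ} (hz : ‖z‖ < 1) : ∃ i, z ∈ LL i := by
  have hex : ∃ i : ℕ, ‖z‖ < 1 - (1 / 2 : ℝ) ^ i / 2 := by
    obtain ⟨i, hi⟩ := exists_pow_lt_of_lt_one (sub_pos.2 hz) (by norm_num : (1 / 2 : ℝ) < 1)
    have hd : 0 < (1 / 2 : ℝ) ^ i := by positivity
    exact ⟨i, by linarith⟩
  refine ⟨Nat.find hex, ?_, Nat.find_spec hex⟩
  rcases h : Nat.find hex with _ | k
  · simp
  · have := Nat.find_min hex (m := k) (by omega)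
    rw [pow_succ]
    linarith

lemma PK_meas (c : ℂ) : Measurable fun q : ℝ × ℂ => ENNReal.ofReal (PK (c * q.2) q.1) := by
  unfold PK
  have : Measurable ee := continuous_ee.measurable
  fun_prop

lemma PK_meas' (c : ℂ) (t : ℝ) : Measurable fun z : ℂ => ENNReal.ofReal (PK (c * z) t) := by
  unfold PK
  fun_prop

/-- accumulated potential -/
def AA (ν : Measure ℂ) (i : ℕ) (θ : ℝ) : ℝ≥0∞ :=
  ∑' k, ∫⁻ z in LL (i + k), ENNReal.ofReal (PK (((rr i / rr (i + k) ^ 2 : ℝ) : ℂ) * z) θ) ∂ν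

/-- one level -/
def al (ν : Measure ℂ) (i : ℕ) (θ : ℝ) : ℝ≥0∞ :=
  ∫⁻ z in LL i, ENNReal.ofReal (PK (((rr i / rr i ^ 2 : ℝ) : ℂ) * z) θ) ∂ν

section
variable {ν : Measure ℂ} [IsFiniteMeasure ν]


lemma AA_meas (i : ℕ) : Measurable (AA ν i) := by
  unfold AA
  exact Measurable.ennreal_tsum fun k => (PK_meas _).lintegral_prod_right'

lemma al_meas (i : ℕ) : Measurable (al ν i) := (PK_meas _).lintegral_prod_right'

lemma AA_rec (i : ℕ) (θ : ℝ) : AA ν i θ = al ν i θ +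
    ∫⁻ t, ENNReal.ofReal (PK (((rr i / rr (i + 1) : ℝ) : ℂ) * ee θ) t) * AA ν (i + 1) t ∂lam := by
  have hr1 : 0 < rr (i + 1) := by linarith [(rr_mem (i + 1)).1]
  have hr0 : 0 < rr i := by linarith [(rr_mem i).1]
  have hlt : rr i < rr (i + 1) := by
    unfold rr
    rw [pow_succ]
    have hd : 0 < (1 / 2 : ℝ) ^ i := by positivity
    linarith
  set ρ := rr i / rr (i + 1) with hρ
  have hρ0 : 0 < ρ := by positivity
  have hρ1 : ρ < 1 := (div_lt_one hr1).2 hlt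
  have hρn : ‖(ρ : ℂ) * ee θ‖ < 1 := by rw [norm_r_ee hρ0.le]; exact hρ1
  have hPm : Measurable fun t => ENNReal.ofReal (PK ((ρ : ℂ) * ee θ) t) :=
    (PK_continuous hρn).measurable.ennreal_ofReal
  conv_lhs => rw [AA, tsum_eq_zero_add' ENNReal.summable]
  congr 1
  have : ∀ t, ENNReal.ofReal (PK ((ρ : ℂ) * ee θ) t) * AA ν (i + 1) t = ∑' k,
      ENNReal.ofReal (PK ((ρ : ℂ) * ee θ) t) * ∫⁻ z in LL (i + 1 + k),
        ENNReal.ofReal (PK (((rr (i + 1) / rr (i + 1 + k) ^ 2 : ℝ) : ℂ) * z) t) ∂ν := by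
    intro t; rw [AA, ENNReal.tsum_mul_left]
  simp_rw [this]
  rw [lintegral_tsum]
  · refine tsum_congr fun k => ?_
    rw [show i + (k + 1) = i + 1 + k by ring]
    have e1 : ∀ t, ENNReal.ofReal (PK ((ρ : ℂ) * ee θ) t) * ∫⁻ z in LL (i + 1 + k),
        ENNReal.ofReal (PK (((rr (i + 1) / rr (i + 1 + k) ^ 2 : ℝ) : ℂ) * z) t) ∂ν =
        ∫⁻ z in LL (i + 1 + k), ENNReal.ofReal (PK ((ρ : ℂ) * ee θ) t) *
        ENNReal.ofReal (PK (((rr (i + 1) / rr (i + 1 + k) ^ 2 : ℝ) : ℂ) * z) t) ∂ν := by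
      intro t
      rw [lintegral_const_mul]
      exact PK_meas' _ t
    simp_rw [e1]
    rw [lintegral_lintegral_swap]
    · refine setLIntegral_congr_fun (LL_meas _) fun z hz => ?_
      have hs := LL_scaled_lt (i := i + 1) (by omega) hz
      rw [PK_mul_lint hs hρn, HK_circle]
      congr 2
      rw [hρ]
      have h1 : (rr (i + 1) : ℂ) ≠ 0 := by exact_mod_cast hr1.ne'
      push_cast
      field_simp
    · have := (hPm.comp measurable_fst).mul (PK_meas ((rr (i + 1) / rr (i + 1 + k) ^ 2 : ℝ) : ℂ))
      exact this.aemeasurable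
  · intro k
    exact (hPm.mul ((PK_meas _).lintegral_prod_right')).aemeasurable

lemma AA_le {κ : ℝ≥0∞} (hκ : ∀ w : ℂ, ‖w‖ < 1 → ∫⁻ z, ENNReal.ofReal (KK w z) ∂ν ≤ κ)
    (i : ℕ) (θ : ℝ) : AA ν i θ ≤ 90 * κ := by
  have hi := rr_mem i
  have hdisj : Pairwise (Function.onFun Disjoint fun k => LL (i + k)) := fun a b hab =>
    LL_disj (by omega)
  calc AA ν i θ ≤ ∑' k, ∫⁻ z in LL (i + k), 90 * ENNReal.ofReal (KK ((rr i : ℂ) * ee θ) z) ∂ν := by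
        unfold AA
        refine ENNReal.tsum_le_tsum fun k => setLIntegral_mono' (LL_meas _) fun z hz => ?_
        have h9 : (90 : ℝ≥0∞) = ENNReal.ofReal 90 := by norm_num
        rw [h9, ← ENNReal.ofReal_mul (by norm_num)]
        exact ENNReal.ofReal_le_ofReal (PK_le_KK (by omega) hz θ)
    _ = ∫⁻ z in ⋃ k, LL (i + k), 90 * ENNReal.ofReal (KK ((rr i : ℂ) * ee θ) z) ∂ν := by
        rw [lintegral_iUnion (fun k => LL_meas _) hdisj]
    _ ≤ ∫⁻ z, 90 * ENNReal.ofReal (KK ((rr i : ℂ) * ee θ) z) ∂ν := setLIntegral_le_lintegral _ _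
    _ = 90 * ∫⁻ z, ENNReal.ofReal (KK ((rr i : ℂ) * ee θ) z) ∂ν := by
        rw [lintegral_const_mul']; simp
    _ ≤ _ := by
        gcongr
        exact hκ _ (by rw [norm_r_ee (by linarith)]; exact hi.2)

lemma poly_dilate_dcl (g : Polynomial ℂ) (r : ℝ) :
    DiffContOnCl ℂ (fun z => g.eval ((r:ℂ) * z)) (Metric.ball 0 1) := by
  apply Differentiable.diffContOnCl
  exact g.differentiable.comp (by fun_prop)

lemma carleson_open {κ : ℝ≥0∞} (hκ0 : κ ≠ 0) (hκt : κ ≠ ⊤)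
    (hκ : ∀ w : ℂ, ‖w‖ < 1 → ∫⁻ z, ENNReal.ofReal (KK w z) ∂ν ≤ κ) (g : Polynomial ℂ) :
    ∫⁻ z in {z | ‖z‖ < 1}, ENNReal.ofReal (‖g.eval z‖ ^ 2) ∂ν ≤ 360 * κ * N2 fun z => g.eval z := by
  set M := 90 * κ with hM
  have hM0 : M ≠ 0 := by simp [hM, hκ0]
  have hMt : M ≠ ⊤ := ENNReal.mul_ne_top (by simp) hκt
  set X : ℕ → ℝ → ℝ≥0∞ := fun i θ => ENNReal.ofReal ‖g.eval ((rr i : ℂ) * ee θ)‖ with hX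
  have hXm : ∀ i, Measurable (X i) := by
    intro i
    have : Continuous fun θ => g.eval ((rr i : ℂ) * ee θ) := g.continuous.comp (by fun_prop)
    exact this.norm.measurable.ennreal_ofReal
  have step : ∀ i, ∫⁻ θ, X i θ ^ 2 / (M + AA ν i θ) ∂lam + (4 * M ^ 2)⁻¹ * ∫⁻ θ, al ν i θ * X i θ ^ 2 ∂lam
      ≤ ∫⁻ t, X (i + 1) t ^ 2 / (M + AA ν (i + 1) t) ∂lam := by
    intro i
    have hr1 : 0 < rr (i + 1) := by linarith [(rr_mem (i + 1)).1]
    have hr0 : 0 < rr i := by linarith [(rr_mem i).1]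
    have hlt : rr i < rr (i + 1) := by
      unfold rr
      rw [pow_succ]
      have hd : 0 < (1 / 2 : ℝ) ^ i := by positivity
      linarith
    have hρ0 : 0 < rr i / rr (i + 1) := by positivity
    have hρ1 : rr i / rr (i + 1) < 1 := (div_lt_one hr1).2 hlt
    have hρn : ∀ θ, ‖((rr i / rr (i + 1) : ℝ) : ℂ) * ee θ‖ < 1 := fun θ => by
      rw [norm_r_ee hρ0.le]; exact hρ1
    refine bell_step (P := fun θ t => ENNReal.ofReal (PK (((rr i / rr (i + 1) : ℝ) : ℂ) * ee θ) t))
      ?_ (fun θ => PK_lint (hρn θ)) ?_ (hXm i) (hXm _) (AA_meas _) (al_meas i) (fun θ => by simp [hX]) ?_ hM0 hMt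
      (AA_le hκ _) (AA_le hκ _) (AA_rec i)
    · have : Measurable ee := continuous_ee.measurable
      unfold PK Function.uncurry
      fun_prop
    · intro t
      simp_rw [PK_symm _ _ t]
      exact PK_lint (hρn t)
    · intro θ
      have := poisson_norm_le (poly_dilate_dcl g (rr (i + 1))) (hρn θ)
      have e : (rr (i + 1) : ℂ) * (((rr i / rr (i + 1) : ℝ) : ℂ) * ee θ) = (rr i : ℂ) * ee θ := by
        have h1 : (rr (i + 1) : ℂ) ≠ 0 := by exact_mod_cast hr1.ne'
        push_cast
        field_simp
      simp only [e] at this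
      exact this
  have sums : ∀ K, (4 * M ^ 2)⁻¹ * ∑ i ∈ Finset.range K, ∫⁻ θ, al ν i θ * X i θ ^ 2 ∂lam
      ≤ ∫⁻ t, X K t ^ 2 / (M + AA ν K t) ∂lam := by
    intro K
    induction K with
    | zero => simp
    | succ K ih =>
      rw [Finset.sum_range_succ, mul_add]
      exact (add_le_add_left ih _).trans (step K)
  have low : ∀ i, ∫⁻ z in LL i, ENNReal.ofReal (‖g.eval z‖ ^ 2) ∂ν ≤ ∫⁻ θ, al ν i θ * X i θ ^ 2 ∂lam := by
    intro i
    have hr0 : 0 < rr i := by linarith [(rr_mem i).1]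
    have e1 : ∀ θ, al ν i θ * X i θ ^ 2 = ∫⁻ z in LL i,
        ENNReal.ofReal (PK (((rr i / rr i ^ 2 : ℝ) : ℂ) * z) θ) * X i θ ^ 2 ∂ν := by
      intro θ
      rw [al, lintegral_mul_const]
      exact PK_meas' _ θ
    simp_rw [e1]
    rw [lintegral_lintegral_swap]
    · refine setLIntegral_mono' (LL_meas i) fun z hz => ?_
      have hs := LL_scaled_lt le_rfl hz
      have h1 := poisson_norm_le (f := fun z => g.eval ((rr i : ℂ) * z) ^ 2) (by
        apply Differentiable.diffContOnCl
        exact (g.differentiable.comp (by fun_prop)).pow 2) hs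
      have e : (rr i : ℂ) * (((rr i / rr i ^ 2 : ℝ) : ℂ) * z) = z := by
        have h1 : (rr i : ℂ) ≠ 0 := by exact_mod_cast hr0.ne'
        push_cast
        field_simp
      simp only [e, norm_pow] at h1
      refine h1.trans (le_of_eq (lintegral_congr fun t => ?_))
      rw [hX, ENNReal.ofReal_pow (norm_nonneg _)]
    · have := (PK_meas ((rr i / rr i ^ 2 : ℝ) : ℂ)).mul (((hXm i).pow_const 2).comp measurable_fst)
      exact this.aemeasurable
  have fin : ∀ K, ∑ i ∈ Finset.range K, ∫⁻ z in LL i, ENNReal.ofReal (‖g.eval z‖ ^ 2) ∂ν ≤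
      360 * κ * N2 fun z => g.eval z := by
    intro K
    have h1 : ∫⁻ t, X K t ^ 2 / (M + AA ν K t) ∂lam ≤ M⁻¹ * N2 fun z => g.eval z := by
      calc ∫⁻ t, X K t ^ 2 / (M + AA ν K t) ∂lam ≤ ∫⁻ t, M⁻¹ * X K t ^ 2 ∂lam := by
            refine lintegral_mono fun t => ?_
            rw [ENNReal.div_eq_inv_mul]
            gcongr
            exact le_self_add
        _ = M⁻¹ * Mr (fun z => g.eval z) (rr K) := by
            rw [lintegral_const_mul _ ((hXm K).pow_const 2), Mr]
            congr 1
            refine lintegral_congr fun t => ?_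
            rw [hX, ENNReal.ofReal_pow (norm_nonneg _)]
        _ ≤ _ := by
            gcongr
            exact Mr_le_N2 (diff_poly g) (by linarith [(rr_mem K).1]) (rr_mem K).2
    have h2 := (sums K).trans h1
    have h4 : (4 * M ^ 2) ≠ 0 := by simp [hM0]
    have h4t : (4 * M ^ 2) ≠ ⊤ := ENNReal.mul_ne_top (by simp) (ENNReal.pow_ne_top hMt)
    calc _ ≤ ∑ i ∈ Finset.range K, ∫⁻ θ, al ν i θ * X i θ ^ 2 ∂lam := Finset.sum_le_sum fun i _ => low i
      _ = (4 * M ^ 2) * ((4 * M ^ 2)⁻¹ * ∑ i ∈ Finset.range K, ∫⁻ θ, al ν i θ * X i θ ^ 2 ∂lam) := by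
          rw [← mul_assoc, ENNReal.mul_inv_cancel h4 h4t, one_mul]
      _ ≤ (4 * M ^ 2) * (M⁻¹ * N2 fun z => g.eval z) := by gcongr
      _ = 4 * M * (M * M⁻¹) * N2 fun z => g.eval z := by ring
      _ = _ := by rw [ENNReal.mul_inv_cancel hM0 hMt, hM]; ring
  have hU : {z : ℂ | ‖z‖ < 1} ⊆ ⋃ i, LL i := fun z hz => Set.mem_iUnion.2 (LL_cover hz)
  refine (lintegral_mono_set hU).trans ?_
  rw [lintegral_iUnion LL_meas LL_disj, ENNReal.tsum_eq_iSup_nat]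
  exact iSup_le fin
end

open scoped Topology ENNReal

lemma KK_meas (w : ℂ) : Measurable fun z => ENNReal.ofReal (KK w z) := by
  unfold KK
  fun_prop

lemma poly_meas (g : Polynomial ℂ) : Measurable fun z => ENNReal.ofReal (‖g.eval z‖ ^ 2) := by
  have : Continuous fun z => ‖g.eval z‖ ^ 2 := g.continuous.norm.pow 2
  exact this.measurable.ennreal_ofReal

lemma KK_dilate {w z : ℂ} {s : ℝ} (hs0 : 0 ≤ s) (hs1 : s ≤ 1) :
    KK w ((s:ℂ) * z) ≤ KK ((s:ℂ) * w) z := by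
  unfold KK
  have e : (starRingEnd ℂ) w * ((s:ℂ) * z) = (starRingEnd ℂ) ((s:ℂ) * w) * z := by
    simp; ring
  rw [e, norm_mul, Complex.norm_real, Real.norm_eq_abs, abs_of_nonneg hs0]
  gcongr
  nlinarith [norm_nonneg w]

lemma carleson_closed {ν : Measure ℂ} [IsFiniteMeasure ν] (hν : ∀ᵐ z ∂ν, ‖z‖ ≤ 1)
    {κ : ℝ≥0∞} (hκ0 : κ ≠ 0) (hκt : κ ≠ ⊤)
    (hκ : ∀ w : ℂ, ‖w‖ < 1 → ∫⁻ z, ENNReal.ofReal (KK w z) ∂ν ≤ κ) (g : Polynomial ℂ) :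
    ∫⁻ z, ENNReal.ofReal (‖g.eval z‖ ^ 2) ∂ν ≤ 360 * κ * N2 fun z => g.eval z := by
  have key : ∀ k, ∫⁻ z, ENNReal.ofReal (‖g.eval ((rs k : ℂ) * z)‖ ^ 2) ∂ν ≤
      360 * κ * N2 fun z => g.eval z := by
    intro k
    have hs := rs_mem k
    have hm : Measurable fun z : ℂ => (rs k : ℂ) * z := by fun_prop
    have h1 : ∀ w : ℂ, ‖w‖ < 1 →
        ∫⁻ z, ENNReal.ofReal (KK w z) ∂(ν.map fun z : ℂ => (rs k : ℂ) * z) ≤ κ := by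
      intro w hw
      rw [lintegral_map (KK_meas w) hm]
      refine le_trans (lintegral_mono fun z => ENNReal.ofReal_le_ofReal
        (KK_dilate hs.1.le hs.2.le)) (hκ _ ?_)
      rw [norm_mul, Complex.norm_real, Real.norm_eq_abs, abs_of_nonneg hs.1.le]
      nlinarith [norm_nonneg w]
    have h2 := carleson_open hκ0 hκt h1 g
    have hms : MeasurableSet {z : ℂ | ‖z‖ < 1} := measurableSet_lt measurable_norm measurable_const
    rw [setLIntegral_map hms (poly_meas g) hm] at h2
    refine le_trans (le_of_eq ?_) h2
    rw [Measure.restrict_eq_self_of_ae_mem]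
    filter_upwards [hν] with z hz
    simp only [Set.mem_preimage, Set.mem_setOf_eq]
    rw [norm_mul, Complex.norm_real, Real.norm_eq_abs, abs_of_nonneg hs.1.le]
    nlinarith [norm_nonneg z]
  calc ∫⁻ z, ENNReal.ofReal (‖g.eval z‖ ^ 2) ∂ν
      = ∫⁻ z, liminf (fun k => ENNReal.ofReal (‖g.eval ((rs k : ℂ) * z)‖ ^ 2)) atTop ∂ν := by
        refine lintegral_congr fun z => ?_
        have hr : Tendsto (fun k => (rs k : ℂ)) atTop (𝓝 1) := by
          have := (rs_tendsto.mono_right nhdsWithin_le_nhds)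
          exact_mod_cast (Complex.continuous_ofReal.tendsto 1).comp this
        have hc : Continuous fun v : ℂ => ENNReal.ofReal (‖g.eval (v * z)‖ ^ 2) := by
          have : Continuous fun v : ℂ => g.eval (v * z) := g.continuous.comp (by fun_prop)
          exact ENNReal.continuous_ofReal.comp (this.norm.pow 2)
        have := (hc.tendsto 1).comp hr
        simp only [one_mul] at this
        exact this.liminf_eq.symm
    _ ≤ liminf (fun k => ∫⁻ z, ENNReal.ofReal (‖g.eval ((rs k : ℂ) * z)‖ ^ 2) ∂ν) atTop := by
        refine lintegral_liminf_le fun k => ?_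
        have hm : Measurable fun z : ℂ => (rs k : ℂ) * z := by fun_prop
        exact (poly_meas g).comp hm
    _ ≤ _ := by
        refine liminf_le_of_le (by isBoundedDefault) fun b hb => ?_
        obtain ⟨k, hk⟩ := hb.exists
        exact hk.trans (key k)

lemma carleson_restrict {ν : Measure ℂ} [IsFiniteMeasure ν] {R : ℝ} (hR0 : 0 < R) (hR1 : R < 1)
    (hν : ∀ᵐ z ∂ν, R ≤ ‖z‖ ∧ ‖z‖ ≤ 1) {ε : ℝ≥0∞}
    (hε : ∀ w : ℂ, R ≤ ‖w‖ → ‖w‖ < 1 → ∫⁻ z, ENNReal.ofReal (KK w z) ∂ν ≤ ε) (w : ℂ) (hw : ‖w‖ < 1) :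
    ∫⁻ z, ENNReal.ofReal (KK w z) ∂ν ≤ 2 * ε := by
  by_cases hwR : R ≤ ‖w‖
  · refine (hε w hwR hw).trans ?_
    rw [two_mul]; exact le_self_add
  push Not at hwR
  obtain ⟨v, hv, rfl⟩ : ∃ v : ℂ, ‖v‖ < 1 ∧ w = (R:ℂ) * v := by
    have hRc : (R:ℂ) ≠ 0 := by exact_mod_cast hR0.ne'
    refine ⟨w / R, ?_, by field_simp⟩
    rw [norm_div, Complex.norm_real, Real.norm_eq_abs, abs_of_pos hR0, div_lt_one hR0]
    exact hwR
  have hPv : Measurable fun t => ENNReal.ofReal (PK v t) := (PK_continuous hv).measurable.ennreal_ofReal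
  calc ∫⁻ z, ENNReal.ofReal (KK ((R:ℂ) * v) z) ∂ν
      ≤ ∫⁻ z, ∫⁻ t, ENNReal.ofReal (PK v t) * ENNReal.ofReal (PK ((R:ℂ) * z) t) ∂lam ∂ν := by
        refine lintegral_mono_ae ?_
        filter_upwards [hν] with z ⟨hz1, hz2⟩
        have hRz : ‖(R:ℂ) * z‖ < 1 := by
          rw [norm_mul, Complex.norm_real, Real.norm_eq_abs, abs_of_pos hR0]
          nlinarith
        rw [PK_mul_lint hRz hv]
        apply ENNReal.ofReal_le_ofReal
        unfold KK HK
        have e : ‖1 - (starRingEnd ℂ) ((R:ℂ) * z) * v‖ = ‖1 - (starRingEnd ℂ) ((R:ℂ) * v) * z‖ := by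
          rw [← Complex.norm_conj]
          congr 1
          simp; ring
        rw [e]
        gcongr
        rw [norm_mul, norm_mul, Complex.norm_real, Real.norm_eq_abs, abs_of_pos hR0]
        have : R ^ 2 * ‖v‖ ^ 2 * ‖z‖ ^ 2 ≤ R ^ 2 * ‖v‖ ^ 2 * 1 := by
          gcongr
          exact pow_le_one₀ (norm_nonneg _) hz2
        nlinarith
    _ = ∫⁻ t, ∫⁻ z, ENNReal.ofReal (PK v t) * ENNReal.ofReal (PK ((R:ℂ) * z) t) ∂ν ∂lam := by
        rw [lintegral_lintegral_swap]
        have h := ((hPv.comp measurable_fst).mul (PK_meas (R:ℂ))).comp measurable_swap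
        exact h.aemeasurable
    _ ≤ ∫⁻ t, ENNReal.ofReal (PK v t) * (2 * ε) ∂lam := by
        refine lintegral_mono fun t => ?_
        dsimp only
        rw [lintegral_const_mul _ (PK_meas' _ t)]
        gcongr
        have hn : ‖(R:ℂ) * ee t‖ = R := norm_r_ee hR0.le t
        calc ∫⁻ z, ENNReal.ofReal (PK ((R:ℂ) * z) t) ∂ν
            ≤ ∫⁻ z, 2 * ENNReal.ofReal (KK ((R:ℂ) * ee t) z) ∂ν := by
              refine lintegral_mono_ae ?_
              filter_upwards [hν] with z ⟨hz1, hz2⟩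
              have h9 : (2 : ℝ≥0∞) = ENNReal.ofReal 2 := by norm_num
              rw [h9, ← ENNReal.ofReal_mul (by norm_num)]
              apply ENNReal.ofReal_le_ofReal
              unfold PK KK
              have e1 : ‖1 - (starRingEnd ℂ) ((R : ℂ) * ee t) * z‖ = ‖ee t - (R : ℂ) * z‖ := by
                rw [← norm_one_sub_conj, ← Complex.norm_conj]
                simp [mul_assoc, mul_comm]
              rw [e1, hn, ← mul_div_assoc]
              gcongr
              rw [norm_mul, Complex.norm_real, Real.norm_eq_abs, abs_of_pos hR0]
              have h1 : R ^ 2 * R ^ 2 ≤ R ^ 2 * ‖z‖ ^ 2 := by gcongr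
              nlinarith [sq_nonneg (1 - R ^ 2)]
          _ = 2 * ∫⁻ z, ENNReal.ofReal (KK ((R:ℂ) * ee t) z) ∂ν := lintegral_const_mul _ (KK_meas _)
          _ ≤ _ := by
              gcongr
              exact hε _ hn.ge (by rw [hn]; exact hR1)
    _ = 2 * ε := by
        rw [lintegral_mul_const _ hPv, PK_lint hv, one_mul]

open scoped Topology ENNReal
section
variable {n p : ℕ} {ξ : Fin n → ℂ} {m : Fin n → ℕ} {Λ : Fin n → ℂ} {φ : ℂ → ℂ}

lemma Stp.inner_fin (S : Stp p ξ m Λ φ) {ρ : ℝ} (hρ : ρ < 1) :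
    ∫⁻ θ, (if ‖bdryVal φ (ee θ)‖ ≤ ρ then
      ENNReal.ofReal (‖bdryVal (ufun p ξ m Λ φ) (ee θ)‖ ^ 2) else 0) ∂lam ≠ ⊤ := by
  have hT : ∀ y : ℂ, ‖y‖ ≤ ρ → (TT p m Λ).eval y ≠ 0 := by
    intro y hy
    unfold TT
    rw [Polynomial.eval_prod, Finset.prod_ne_zero_iff]
    intro j hj
    simp only [Polynomial.eval_pow, Polynomial.eval_sub, Polynomial.eval_X, Polynomial.eval_C]
    refine pow_ne_zero _ (sub_ne_zero.2 ?_)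
    rintro rfl
    have := S.hΛc j (by simpa using hj)
    linarith
  have hcont : ContinuousOn (fun y : ℂ => (A1 ξ m).eval y / (TT p m Λ).eval y)
      (Metric.closedBall 0 ρ) :=
    (A1 ξ m).continuous.continuousOn.div (TT p m Λ).continuous.continuousOn fun y hy =>
      hT y (by simpa using hy)
  obtain ⟨C, hC⟩ := (isCompact_closedBall (0:ℂ) ρ).exists_bound_of_continuousOn hcont
  have hGF : ∀ y : ℂ, ‖y‖ ≤ ρ → ‖(GG p ξ m Λ).eval y‖ ≤ C * ‖(FF m Λ).eval y‖ := by
    intro y hy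
    have h1 := hC y (by simpa using hy)
    have hTy := norm_pos_iff.2 (hT y hy)
    rw [norm_div, div_le_iff₀ hTy] at h1
    rw [FF_eq (p := p), GG, Polynomial.eval_mul, Polynomial.eval_mul, norm_mul, norm_mul]
    nlinarith [norm_nonneg ((BB p m Λ).eval y)]
  obtain ⟨hd, hN⟩ := MemH2_iff.1 S.FF_div
  have hlim : ∀ᵐ θ ∂lam, Tendsto (fun r : ℝ => (FF m Λ).eval (φ (r * ee θ)) / a1fun ξ m (r * ee θ))
      (𝓝[<] 1) (𝓝 ((FF m Λ).eval (bdryVal φ (ee θ)) / a1fun ξ m (ee θ))) := by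
    filter_upwards [S.bdryφ, a1_ae_ne ξ m] with θ h1 h2
    have h3 : Tendsto (fun r : ℝ => a1fun ξ m (r * ee θ)) (𝓝[<] 1) (𝓝 (a1fun ξ m (ee θ))) := by
      have := poly_radial (A1 ξ m) (ee θ)
      simpa only [A1_eval] using this
    exact (((FF m Λ).continuous.tendsto _).comp h1).div h3 h2
  have hI := bdry_le_N2 hd hlim
  have hle : ∫⁻ θ, (if ‖bdryVal φ (ee θ)‖ ≤ ρ then
      ENNReal.ofReal (‖bdryVal (ufun p ξ m Λ φ) (ee θ)‖ ^ 2) else 0) ∂lam ≤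
      ∫⁻ θ, ENNReal.ofReal (C ^ 2) *
        ENNReal.ofReal (‖(FF m Λ).eval (bdryVal φ (ee θ)) / a1fun ξ m (ee θ)‖ ^ 2) ∂lam := by
    refine lintegral_mono_ae ?_
    filter_upwards [S.bdryu] with θ hθ
    split_ifs with h
    · rw [← ENNReal.ofReal_mul (sq_nonneg _), hθ.2]
      apply ENNReal.ofReal_le_ofReal
      rw [← mul_pow]
      gcongr
      rw [norm_div, norm_div, ← mul_div_assoc]
      gcongr
      exact hGF _ h
    · exact zero_le
  rw [lintegral_const_mul' _ _ ENNReal.ofReal_ne_top] at hle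
  exact ne_top_of_le_ne_top (ENNReal.mul_ne_top ENNReal.ofReal_ne_top
    (ne_top_of_le_ne_top hN hI)) hle

lemma Stp.exists_mu (S : Stp p ξ m Λ φ) : ∃ μ : Measure ℂ, ∀ f : ℂ → ℝ≥0∞, Measurable f →
    ∫⁻ z, f z ∂μ = ∫⁻ θ, f (bdryVal φ (ee θ)) *
      ENNReal.ofReal (‖bdryVal (ufun p ξ m Λ φ) (ee θ)‖ ^ 2) ∂lam := by
  have hU : AEMeasurable (fun θ => ENNReal.ofReal (‖bdryVal (ufun p ξ m Λ φ) (ee θ)‖ ^ 2)) lam :=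
    (S.aemeasu.norm.pow_const 2).ennreal_ofReal
  refine ⟨(lam.withDensity (hU.mk _)).map (S.aemeasφ.mk _), fun f hf => ?_⟩
  rw [lintegral_map hf S.aemeasφ.measurable_mk, lintegral_withDensity_eq_lintegral_mul _
    hU.measurable_mk (g := fun θ => f (S.aemeasφ.mk _ θ)) (hf.comp S.aemeasφ.measurable_mk)]
  refine lintegral_congr_ae ?_
  filter_upwards [hU.ae_eq_mk, S.aemeasφ.ae_eq_mk] with θ h1 h2
  rw [Pi.mul_apply, ← h1, ← h2, mul_comm]

lemma Stp.mu_meas (S : Stp p ξ m Λ φ) {μ : Measure ℂ} (hμ : ∀ f : ℂ → ℝ≥0∞, Measurable f →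
    ∫⁻ z, f z ∂μ = ∫⁻ θ, f (bdryVal φ (ee θ)) *
      ENNReal.ofReal (‖bdryVal (ufun p ξ m Λ φ) (ee θ)‖ ^ 2) ∂lam) {E : Set ℂ} (hE : MeasurableSet E) :
    μ E = muMeas (ufun p ξ m Λ φ) φ E := by
  rw [← lintegral_indicator_one hE, hμ _ (measurable_one.indicator hE), muMeas_eq]
  refine lintegral_congr fun θ => ?_
  by_cases h : bdryVal φ (ee θ) ∈ E <;> simp [h]

lemma Stp.mu_closed (S : Stp p ξ m Λ φ) {μ : Measure ℂ} (hμ : ∀ f : ℂ → ℝ≥0∞, Measurable f →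
    ∫⁻ z, f z ∂μ = ∫⁻ θ, f (bdryVal φ (ee θ)) *
      ENNReal.ofReal (‖bdryVal (ufun p ξ m Λ φ) (ee θ)‖ ^ 2) ∂lam) : ∀ᵐ z ∂μ, ‖z‖ ≤ 1 := by
  have hm : MeasurableSet {z : ℂ | ¬ ‖z‖ ≤ 1} :=
    (measurableSet_le measurable_norm measurable_const).compl
  rw [ae_iff, S.mu_meas hμ hm, muMeas_eq]
  rw [lintegral_eq_zero_of_ae_eq_zero]
  filter_upwards [S.bdryφ_le] with θ hθ
  simp [hθ]

lemma ann_cover {r : ℝ} (hr : 0 < r) (hr1 : r < 1) : ∃ t : Finset ℂ, (∀ ζ ∈ t, ‖ζ‖ = 1) ∧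
    ∀ z : ℂ, 1 - r / 2 ≤ ‖z‖ → ‖z‖ ≤ 1 → ∃ ζ ∈ t, z ∈ Metric.closedBall ζ r ∩ Metric.closedBall 0 1 := by
  obtain ⟨t, ht, htf, hc⟩ := (isCompact_sphere (0:ℂ) 1).finite_cover_balls (e := r / 2) (by positivity)
  refine ⟨htf.toFinset, fun ζ hζ => ?_, fun z h1 h2 => ?_⟩
  · simpa using ht (htf.mem_toFinset.1 hζ)
  · have hz : 0 < ‖z‖ := by linarith
    have hs : z / ‖z‖ ∈ Metric.sphere (0:ℂ) 1 := by
      simp [hz.ne']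
    have := hc hs
    simp only [Set.mem_iUnion] at this
    obtain ⟨ζ, hζ, hd⟩ := this
    refine ⟨ζ, htf.mem_toFinset.2 hζ, ?_, by simpa using h2⟩
    rw [Metric.mem_closedBall]
    rw [Metric.mem_ball] at hd
    have h3 : dist z (z / ‖z‖) ≤ r / 2 := by
      have e : z - z / ‖z‖ = ((‖z‖ - 1 : ℝ) : ℂ) * (z / ‖z‖) := by
        have : (‖z‖ : ℂ) ≠ 0 := by exact_mod_cast hz.ne'
        push_cast
        field_simp
      rw [dist_eq_norm, e, norm_mul, mem_sphere_zero_iff_norm.1 hs, Complex.norm_real,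
        Real.norm_eq_abs, abs_of_nonpos (by linarith)]
      linarith
    linarith [dist_triangle z (z / ‖z‖) ζ]

lemma Stp.mu_finite (S : Stp p ξ m Λ φ) {μ : Measure ℂ} (hμ : ∀ f : ℂ → ℝ≥0∞, Measurable f →
    ∫⁻ z, f z ∂μ = ∫⁻ θ, f (bdryVal φ (ee θ)) *
      ENNReal.ofReal (‖bdryVal (ufun p ξ m Λ φ) (ee θ)‖ ^ 2) ∂lam)
    (hV : IsVanishingCarleson (ufun p ξ m Λ φ) φ) : IsFiniteMeasure μ := by
  obtain ⟨r₀, hr₀, h⟩ := hV 1 one_pos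
  have hr : 0 < r₀ / 2 := by linarith [hr₀.1]
  have hr1 : r₀ / 2 < 1 := by linarith [hr₀.2]
  obtain ⟨t, ht, hcov⟩ := ann_cover hr hr1
  have hsub : (Set.univ : Set ℂ) ⊆ {z | ¬ ‖z‖ ≤ 1} ∪ ({z | ‖z‖ ≤ 1 - r₀ / 2 / 2} ∪
      ⋃ ζ ∈ t, (Metric.closedBall ζ (r₀ / 2) ∩ Metric.closedBall 0 1)) := by
    intro z _
    by_cases h1 : ‖z‖ ≤ 1
    · by_cases h2 : ‖z‖ ≤ 1 - r₀ / 2 / 2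
      · exact Or.inr (Or.inl h2)
      · obtain ⟨ζ, h3, h4⟩ := hcov z (not_le.1 h2).le h1
        exact Or.inr (Or.inr (Set.mem_biUnion h3 h4))
    · exact Or.inl h1
  constructor
  refine lt_of_le_of_lt (measure_mono hsub) ?_
  refine lt_of_le_of_lt (measure_union_le _ _) (ENNReal.add_lt_top.2 ⟨?_, ?_⟩)
  · rw [show μ {z | ¬ ‖z‖ ≤ 1} = 0 from S.mu_closed hμ]; simp
  refine lt_of_le_of_lt (measure_union_le _ _) (ENNReal.add_lt_top.2 ⟨?_, ?_⟩)
  · rw [S.mu_meas hμ (measurableSet_le measurable_norm measurable_const), muMeas_eq]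
    exact lt_top_iff_ne_top.2 (S.inner_fin (ρ := 1 - r₀ / 2 / 2) (by linarith))
  · refine lt_of_le_of_lt (measure_biUnion_finset_le _ _) (ENNReal.sum_lt_top.2 fun ζ hζ => ?_)
    rw [S.mu_meas hμ (Metric.isClosed_closedBall.measurableSet.inter
      Metric.isClosed_closedBall.measurableSet)]
    exact lt_of_le_of_lt (h _ ⟨hr, by linarith⟩ ζ (unitCircle_mem.2 (ht ζ hζ))) ENNReal.ofReal_lt_top
end

lemma KK_dyadic {w z ζ : ℂ} {δ : ℝ} (hδ : 0 < δ) (hδ1 : δ ≤ 1) (hζ : ‖ζ‖ = 1) (hw : w = ((1 - δ : ℝ) : ℂ) * ζ)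
    (hz : ‖z‖ ≤ 1) (J : ℕ) :
    ENNReal.ofReal (KK w z) ≤ ∑ j ∈ Finset.range J, (Metric.closedBall ζ (2 ^ j * δ)).indicator
      (fun _ => ENNReal.ofReal (32 / 4 ^ j / δ)) z + ENNReal.ofReal (32 / 4 ^ J / δ) := by
  have hwn : ‖w‖ = 1 - δ := by
    rw [hw, norm_mul, Complex.norm_real, Real.norm_eq_abs, abs_of_nonneg (by linarith), hζ, mul_one]
  have hD : δ ≤ ‖1 - (starRingEnd ℂ) w * z‖ := by
    have := norm_sub_norm_le (1:ℂ) ((starRingEnd ℂ) w * z)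
    rw [norm_mul, Complex.norm_conj, hwn, norm_one] at this
    nlinarith
  have hD2 : dist z ζ ≤ 2 * ‖1 - (starRingEnd ℂ) w * z‖ := by
    have hcc : (starRingEnd ℂ) ζ * ζ = 1 := by
      rw [← Complex.normSq_eq_conj_mul_self, Complex.normSq_eq_norm_sq, hζ]; simp
    have e : ζ - z = ζ * ((1 - (starRingEnd ℂ) w * z) - (δ:ℂ) * (starRingEnd ℂ) ζ * z) := by
      rw [hw]
      simp only [map_mul, Complex.conj_ofReal]
      push_cast
      linear_combination z * hcc
    rw [dist_comm, dist_eq_norm, e, norm_mul, hζ, one_mul]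
    refine (norm_sub_le _ _).trans ?_
    rw [norm_mul, norm_mul, Complex.norm_conj, hζ, Complex.norm_real, Real.norm_eq_abs, abs_of_pos hδ]
    nlinarith
  have hDp : 0 < ‖1 - (starRingEnd ℂ) w * z‖ := by linarith
  have hnum : 1 - ‖w‖ ^ 2 ≤ 2 * δ := by rw [hwn]; nlinarith
  -- main pointwise bound
  have hb : ∀ j : ℕ, (∀ i < j, 2 ^ i * δ < dist z ζ) → KK w z ≤ 32 / 4 ^ j / δ := by
    intro j hj
    have h1 : 2 ^ j * δ ≤ 4 * ‖1 - (starRingEnd ℂ) w * z‖ := by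
      rcases j with _ | k
      · simp; linarith
      · have := hj k (by omega)
        rw [pow_succ]; linarith
    unfold KK
    rw [div_div, div_le_div_iff₀ (by positivity) (by positivity)]
    have h2 : (2 ^ j * δ) ^ 2 ≤ (4 * ‖1 - (starRingEnd ℂ) w * z‖) ^ 2 := by gcongr
    have e4 : (4:ℝ) ^ j = (2 ^ j) ^ 2 := by rw [← pow_mul, mul_comm, pow_mul]; norm_num
    calc (1 - ‖w‖ ^ 2) * (4 ^ j * δ) ≤ (2 * δ) * (4 ^ j * δ) := by gcongr
      _ = 2 * (2 ^ j * δ) ^ 2 := by rw [e4]; ring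
      _ ≤ 2 * (4 * ‖1 - (starRingEnd ℂ) w * z‖) ^ 2 := by gcongr
      _ = _ := by ring
  by_cases hex : ∃ j, j < J ∧ dist z ζ ≤ 2 ^ j * δ
  · have hs := Nat.find_spec hex
    set j := Nat.find hex with hj
    have h1 := hb j fun i hi => by
      have := Nat.find_min hex hi
      push Not at this
      exact this (by omega)
    refine le_trans (ENNReal.ofReal_le_ofReal h1) (le_trans ?_ le_self_add)
    refine le_trans (le_of_eq ?_) (Finset.single_le_sum (f := fun j => (Metric.closedBall ζ (2 ^ j * δ)).indicator
      (fun _ => ENNReal.ofReal (32 / 4 ^ j / δ)) z) (fun i _ => zero_le) (Finset.mem_range.2 hs.1))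
    rw [Set.indicator_of_mem (Metric.mem_closedBall.2 hs.2)]
  · push Not at hex
    exact le_trans (ENNReal.ofReal_le_ofReal (hb J hex)) le_add_self

lemma vanishing_rep {μ : Measure ℂ} [IsFiniteMeasure μ] (hc : ∀ᵐ z ∂μ, ‖z‖ ≤ 1)
    (hV : ∀ ε > (0:ℝ), ∃ r₀ ∈ Set.Ioo (0:ℝ) 1, ∀ r ∈ Set.Ioo (0:ℝ) r₀, ∀ ζ : ℂ, ‖ζ‖ = 1 →
      μ (Metric.closedBall ζ r) ≤ ENNReal.ofReal (ε * r)) {ε : ℝ} (hε : 0 < ε) :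
    ∃ ρ ∈ Set.Ioo (0:ℝ) 1, ∀ w : ℂ, ρ < ‖w‖ → ‖w‖ < 1 →
      ∫⁻ z, ENNReal.ofReal (KK w z) ∂μ ≤ ENNReal.ofReal ε := by
  obtain ⟨r₀, hr₀, hV⟩ := hV (ε / 128) (by positivity)
  set Mm := (μ Set.univ).toReal with hMm
  have hMm0 : 0 ≤ Mm := ENNReal.toReal_nonneg
  have hMe : μ Set.univ = ENNReal.ofReal Mm := (ENNReal.ofReal_toReal (measure_ne_top _ _)).symm
  set δ₀ := min (1 / 2) (ε / 2 * r₀ ^ 2 / (32 * (Mm + 1))) with hδ₀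
  have hr0p := hr₀.1
  have hδ₀p : 0 < δ₀ := by
    apply lt_min (by norm_num); positivity
  have hδ₀h : δ₀ ≤ 1 / 2 := min_le_left _ _
  refine ⟨1 - δ₀, ⟨by linarith, by linarith⟩, fun w hw1 hw2 => ?_⟩
  set δ := 1 - ‖w‖ with hδ
  have hδp : 0 < δ := by linarith
  have hwp : 0 < ‖w‖ := by linarith
  have hδlt : δ < δ₀ := by linarith
  set ζ := w / ‖w‖ with hζ
  have hζ1 : ‖ζ‖ = 1 := by simp [hζ, hwp.ne']
  have hwe : w = ((1 - δ : ℝ) : ℂ) * ζ := by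
    have : (‖w‖ : ℂ) ≠ 0 := by exact_mod_cast hwp.ne'
    rw [hδ, hζ]; push_cast; field_simp; ring
  have hex : ∃ J : ℕ, r₀ ≤ 2 ^ J * δ := by
    obtain ⟨J, hJ⟩ := pow_unbounded_of_one_lt (r₀ / δ) (by norm_num : (1:ℝ) < 2)
    exact ⟨J, by rw [div_lt_iff₀ hδp] at hJ; exact hJ.le⟩
  set J := Nat.find hex with hJ
  have hJs : r₀ ≤ 2 ^ J * δ := Nat.find_spec hex
  have hJm : ∀ j < J, 2 ^ j * δ < r₀ := fun j hj => not_le.1 (Nat.find_min hex hj)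
  have hmeas : ∀ j : ℕ, MeasurableSet (Metric.closedBall ζ (2 ^ j * δ)) := fun j =>
    Metric.isClosed_closedBall.measurableSet
  calc ∫⁻ z, ENNReal.ofReal (KK w z) ∂μ
      ≤ ∫⁻ z, (∑ j ∈ Finset.range J, (Metric.closedBall ζ (2 ^ j * δ)).indicator
      (fun _ => ENNReal.ofReal (32 / 4 ^ j / δ)) z + ENNReal.ofReal (32 / 4 ^ J / δ)) ∂μ := by
        refine lintegral_mono_ae ?_
        filter_upwards [hc] with z hz
        exact KK_dyadic hδp (by linarith) hζ1 hwe hz J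
    _ = ∑ j ∈ Finset.range J, ENNReal.ofReal (32 / 4 ^ j / δ) * μ (Metric.closedBall ζ (2 ^ j * δ)) +
        ENNReal.ofReal (32 / 4 ^ J / δ) * μ Set.univ := by
        rw [lintegral_add_right _ measurable_const, lintegral_finset_sum _ fun j _ =>
          measurable_const.indicator (hmeas j), lintegral_const]
        congr 1
        refine Finset.sum_congr rfl fun j _ => ?_
        rw [lintegral_indicator_const (hmeas j)]
    _ ≤ ∑ j ∈ Finset.range J, ENNReal.ofReal (ε / 4 * (1 / 2) ^ j) + ENNReal.ofReal (ε / 2) := by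
        refine add_le_add (Finset.sum_le_sum fun j hj => ?_) ?_
        · have h1 := hV (2 ^ j * δ) ⟨by positivity, hJm j (Finset.mem_range.1 hj)⟩ ζ hζ1
          refine (mul_le_mul_right h1 _).trans ?_
          rw [← ENNReal.ofReal_mul (by positivity)]
          apply ENNReal.ofReal_le_ofReal
          have e4 : (4:ℝ) ^ j = 2 ^ j * 2 ^ j := by rw [← mul_pow]; norm_num
          rw [e4, one_div_pow]
          apply le_of_eq
          field_simp
          norm_num
        · rw [hMe, ← ENNReal.ofReal_mul (by positivity)]
          apply ENNReal.ofReal_le_ofReal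
          have e4 : (4:ℝ) ^ J = 2 ^ J * 2 ^ J := by rw [← mul_pow]; norm_num
          have h1 : r₀ ^ 2 ≤ (2 ^ J * δ) ^ 2 := by gcongr
          have h2 : δ ≤ ε / 2 * r₀ ^ 2 / (32 * (Mm + 1)) := hδlt.le.trans (min_le_right _ _)
          rw [le_div_iff₀ (by positivity)] at h2
          rw [div_div, div_mul_eq_mul_div, div_le_iff₀ (by positivity)]
          have h3 : 32 * Mm * δ ≤ ε / 2 * (4 ^ J * δ * δ) := by
            calc 32 * Mm * δ ≤ δ * (32 * (Mm + 1)) := by nlinarith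
              _ ≤ ε / 2 * r₀ ^ 2 := h2
              _ ≤ ε / 2 * (2 ^ J * δ) ^ 2 := by gcongr
              _ = _ := by rw [e4]; ring
          have : 32 * Mm * δ ≤ (ε / 2 * (4 ^ J * δ)) * δ := by linarith
          exact le_of_mul_le_mul_right this hδp
    _ ≤ ENNReal.ofReal ε := by
        rw [← ENNReal.ofReal_sum_of_nonneg fun j _ => by positivity, ← ENNReal.ofReal_add
          (Finset.sum_nonneg fun j _ => by positivity) (by positivity)]
        apply ENNReal.ofReal_le_ofReal
        rw [← Finset.mul_sum]
        have : ∑ j ∈ Finset.range J, (1 / 2 : ℝ) ^ j ≤ 2 := sum_geometric_two_le J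
        nlinarith

open scoped Topology ENNReal
section
variable {n p : ℕ} {ξ : Fin n → ℂ} {m : Fin n → ℕ} {Λ : Fin n → ℂ} {φ : ℂ → ℂ}

lemma Stp.key_poly (S : Stp p ξ m Λ φ) (hV : IsVanishingCarleson (ufun p ξ m Λ φ) φ) :
    ∃ L : ℝ≥0∞, L ≠ ⊤ ∧ ∀ ε > (0:ℝ), ∃ R ∈ Set.Ioo (0:ℝ) 1, ∀ g : Polynomial ℂ,
      N2 (fun z => ufun p ξ m Λ φ z * g.eval (φ z)) ≤
        L * (∑' k, ENNReal.ofReal (‖g.coeff k‖ * R ^ k)) ^ 2 + ENNReal.ofReal ε * N2 fun z => g.eval z := by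
  obtain ⟨μ, hμ⟩ := S.exists_mu
  haveI := S.mu_finite hμ hV
  have hc := S.mu_closed hμ
  have hVμ : ∀ ε > (0:ℝ), ∃ r₀ ∈ Set.Ioo (0:ℝ) 1, ∀ r ∈ Set.Ioo (0:ℝ) r₀, ∀ ζ : ℂ, ‖ζ‖ = 1 →
      μ (Metric.closedBall ζ r) ≤ ENNReal.ofReal (ε * r) := by
    intro ε hε
    obtain ⟨r₀, hr₀, h⟩ := hV ε hε
    refine ⟨r₀, hr₀, fun r hr ζ hζ => ?_⟩
    refine le_trans (measure_mono_ae ?_) (le_trans (le_of_eq (S.mu_meas hμ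
      (Metric.isClosed_closedBall.measurableSet.inter
      Metric.isClosed_closedBall.measurableSet))) (h r hr ζ (unitCircle_mem.2 hζ)))
    filter_upwards [hc] with z hz hz2
    exact ⟨hz2, by simpa using hz⟩
  refine ⟨μ Set.univ, measure_ne_top _ _, fun ε hε => ?_⟩
  obtain ⟨ρ, hρ, hK⟩ := vanishing_rep hc hVμ (ε := ε / 720) (by positivity)
  set R := (1 + ρ) / 2 with hR
  have hR0 : 0 < R := by linarith [hρ.1]
  have hR1 : R < 1 := by linarith [hρ.2]
  have hρR : ρ < R := by linarith [hρ.2]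
  refine ⟨R, ⟨hR0, hR1⟩, fun g => ?_⟩
  have hE : MeasurableSet {z : ℂ | R ≤ ‖z‖} := measurableSet_le measurable_const measurable_norm
  have h1 : ∫⁻ z in {z : ℂ | R ≤ ‖z‖}, ENNReal.ofReal (‖g.eval z‖ ^ 2) ∂μ ≤
      ENNReal.ofReal ε * N2 fun z => g.eval z := by
    have hν : ∀ᵐ z ∂(μ.restrict {z : ℂ | R ≤ ‖z‖}), R ≤ ‖z‖ ∧ ‖z‖ ≤ 1 := by
      filter_upwards [ae_restrict_of_ae hc, ae_restrict_mem hE] with z h1 h2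
      exact ⟨h2, h1⟩
    have h2 := carleson_restrict (ν := μ.restrict {z : ℂ | R ≤ ‖z‖}) hR0 hR1 hν
      (ε := ENNReal.ofReal (ε / 720)) fun w hw1 hw2 =>
        (setLIntegral_le_lintegral _ _).trans (hK w (by linarith) hw2)
    have h3 := carleson_closed (hν.mono fun z h => h.2) (κ := 2 * ENNReal.ofReal (ε / 720))
      (by simp; positivity) (ENNReal.mul_ne_top (by simp) ENNReal.ofReal_ne_top) h2 g
    refine h3.trans (le_of_eq ?_)
    congr 1
    rw [← mul_assoc, show (360 * 2 : ℝ≥0∞) = ENNReal.ofReal 720 by norm_num,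
      ← ENNReal.ofReal_mul (by norm_num)]
    congr 1
    ring
  have h2 : ∫⁻ z in {z : ℂ | R ≤ ‖z‖}ᶜ, ENNReal.ofReal (‖g.eval z‖ ^ 2) ∂μ ≤
      μ Set.univ * (∑' k, ENNReal.ofReal (‖g.coeff k‖ * R ^ k)) ^ 2 := by
    calc ∫⁻ z in {z : ℂ | R ≤ ‖z‖}ᶜ, ENNReal.ofReal (‖g.eval z‖ ^ 2) ∂μ
        ≤ ∫⁻ z in {z : ℂ | R ≤ ‖z‖}ᶜ, (∑' k, ENNReal.ofReal (‖g.coeff k‖ * R ^ k)) ^ 2 ∂μ := by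
          refine setLIntegral_mono' hE.compl fun z hz => ?_
          have hz : ‖z‖ < R := not_le.1 hz
          rw [ENNReal.ofReal_pow (norm_nonneg _)]
          gcongr
          rw [Polynomial.eval_eq_sum, Polynomial.sum]
          refine le_trans (ENNReal.ofReal_le_ofReal (norm_sum_le _ _)) ?_
          rw [ENNReal.ofReal_sum_of_nonneg fun _ _ => norm_nonneg _]
          refine le_trans (Finset.sum_le_sum fun k _ => ?_) (ENNReal.sum_le_tsum g.support)
          apply ENNReal.ofReal_le_ofReal
          rw [norm_mul, norm_pow]
          gcongr
      _ ≤ ∫⁻ z, (∑' k, ENNReal.ofReal (‖g.coeff k‖ * R ^ k)) ^ 2 ∂μ := setLIntegral_le_lintegral _ _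
      _ = _ := by rw [lintegral_const, mul_comm]
  refine (S.smirnov g).trans ?_
  calc _ = ∫⁻ z, ENNReal.ofReal (‖g.eval z‖ ^ 2) ∂μ := by
        rw [hμ _ (poly_meas g)]
        refine lintegral_congr fun θ => ?_
        rw [← ENNReal.ofReal_mul (by positivity), norm_mul, mul_pow, mul_comm]
    _ = _ := (lintegral_add_compl _ hE).symm
    _ ≤ _ := by rw [add_comm]; exact add_le_add h2 h1

lemma Stp.key (S : Stp p ξ m Λ φ) (hV : IsVanishingCarleson (ufun p ξ m Λ φ) φ) :
    ∃ L : ℝ≥0∞, L ≠ ⊤ ∧ ∀ ε > (0:ℝ), ∃ R ∈ Set.Ioo (0:ℝ) 1, ∀ d, MemH2 d →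
      N2 (fun z => ufun p ξ m Λ φ z * d (φ z)) ≤
        L * (∑' k, ENNReal.ofReal (‖taylorCoeff d k‖ * R ^ k)) ^ 2 + ENNReal.ofReal ε * N2 d := by
  obtain ⟨L, hL, h⟩ := S.key_poly hV
  refine ⟨L, hL, fun ε hε => ?_⟩
  obtain ⟨R, hR, h⟩ := h ε hε
  refine ⟨R, hR, fun d hd => ?_⟩
  have hR0 := hR.1
  set g : ℕ → Polynomial ℂ := fun K => ∑ k ∈ Finset.range K, Polynomial.monomial k (taylorCoeff d k) with hg
  have hcoeff : ∀ K k, (g K).coeff k = if k < K then taylorCoeff d k else 0 := by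
    intro K k
    simp [hg, Polynomial.finset_sum_coeff, Polynomial.coeff_monomial]
  have hnc : ∀ K k, ‖(g K).coeff k‖ ≤ ‖taylorCoeff d k‖ := by
    intro K k
    rw [hcoeff]; split_ifs <;> simp
  have hgN : ∀ K, N2 (fun z => (g K).eval z) ≤ N2 d := by
    intro K
    unfold N2
    refine ENNReal.tsum_le_tsum fun k => ENNReal.ofReal_le_ofReal ?_
    rw [taylorCoeff_poly]
    gcongr
    exact hnc K k
  set B := L * (∑' k, ENNReal.ofReal (‖taylorCoeff d k‖ * R ^ k)) ^ 2 + ENNReal.ofReal ε * N2 d with hB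
  have hgB : ∀ K, N2 (fun z => ufun p ξ m Λ φ z * (g K).eval (φ z)) ≤ B := by
    intro K
    refine (h (g K)).trans ?_
    rw [hB]
    refine add_le_add ?_ (mul_le_mul_right (hgN K) _)
    refine mul_le_mul_right (pow_le_pow_left' (ENNReal.tsum_le_tsum fun k => ?_) 2) _
    exact ENNReal.ofReal_le_ofReal (mul_le_mul_of_nonneg_right (hnc K k) (by positivity))
  have hmaps : Set.MapsTo φ unitDisk unitDisk := fun z hz =>
    unitDisk_mem.2 (S.hφ1 z (unitDisk_mem.1 hz))
  have hgd : ∀ K, DifferentiableOn ℂ (fun z => ufun p ξ m Λ φ z * (g K).eval (φ z)) unitDisk := fun K =>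
    S.udiff.mul ((g K).differentiable.comp_differentiableOn S.hφd)
  refine N2_le (S.udiff.mul (hd.1.comp S.hφd hmaps)) (r0 := 0) one_pos fun r _ hr0 hr => ?_
  have hlim : ∀ z : ℂ, ‖z‖ < 1 → Tendsto (fun K => ENNReal.ofReal (‖ufun p ξ m Λ φ z * (g K).eval (φ z)‖ ^ 2))
      atTop (𝓝 (ENNReal.ofReal (‖ufun p ξ m Λ φ z * d (φ z)‖ ^ 2))) := by
    intro z hz
    have h1 := (hasSum_taylor hd.1 (S.hφ1 z hz)).tendsto_sum_nat
    have h2 : ∀ K, (g K).eval (φ z) = ∑ k ∈ Finset.range K, taylorCoeff d k * φ z ^ k := by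
      intro K; simp [hg, Polynomial.eval_finset_sum]
    simp_rw [h2]
    exact (ENNReal.continuous_ofReal.tendsto _).comp (((h1.const_mul _).norm).pow 2)
  calc Mr (fun z => ufun p ξ m Λ φ z * d (φ z)) r
      = ∫⁻ θ, liminf (fun K => ENNReal.ofReal (‖ufun p ξ m Λ φ (r * ee θ) *
          (g K).eval (φ (r * ee θ))‖ ^ 2)) atTop ∂lam := by
        unfold Mr
        refine lintegral_congr fun θ => ?_
        exact (hlim _ (by rw [norm_r_ee hr0]; exact hr)).liminf_eq.symm
    _ ≤ liminf (fun K => ∫⁻ θ, ENNReal.ofReal (‖ufun p ξ m Λ φ (r * ee θ) *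
          (g K).eval (φ (r * ee θ))‖ ^ 2) ∂lam) atTop := by
        refine lintegral_liminf_le fun K => ?_
        have := continuous_circle (hgd K).continuousOn hr0 hr
        exact (this.norm.pow 2).measurable.ennreal_ofReal
    _ ≤ B := by
        refine liminf_le_of_le (by isBoundedDefault) fun b hb => ?_
        obtain ⟨K, hK⟩ := hb.exists
        exact hK.trans ((Mr_le_N2 (hgd K) hr0 hr).trans (hgB K))
end

open scoped Topology ENNReal

/-- bounded division with remainder in the Hardy space -/
def DivProp (P : Polynomial ℂ) : Prop :=
  ∃ C : ℝ≥0∞, C ≠ ⊤ ∧ ∃ d0 : ℕ, ∀ g, MemH2 g → ∃ (s : ℂ → ℂ) (t : Polynomial ℂ), MemH2 s ∧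
    N2 s ≤ C * N2 g ∧ (N2 fun z => t.eval z) ≤ C * N2 g ∧ t.natDegree < d0 ∧
    ∀ z, ‖z‖ < 1 → g z = P.eval z * s z + t.eval z

lemma N2_poly_ne_top (q : Polynomial ℂ) : (N2 fun z => q.eval z) ≠ ⊤ := (MemH2_iff.1 (memH2_poly q)).2

lemma divProp_one : DivProp 1 :=
  ⟨1, by simp, 1, fun g hg => ⟨g, 0, hg, by simp, by simp [N2_zero], by simp, fun z _ => by simp⟩⟩

lemma N2_poly_mul (P : Polynomial ℂ) : ∃ C : ℝ≥0∞, C ≠ ⊤ ∧ ∀ f, DifferentiableOn ℂ f unitDisk →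
    N2 (fun z => P.eval z * f z) ≤ C * N2 f := by
  obtain ⟨C, hC0, hC⟩ := poly_bdd P 1
  exact ⟨ENNReal.ofReal (C ^ 2), ENNReal.ofReal_ne_top, fun f hf =>
    N2_bdd_mul hC0 (diff_poly P) (fun z hz => hC z hz.le) hf⟩

lemma DivProp.mul {P Q : Polynomial ℂ} (hP : DivProp P) (hQ : DivProp Q) : DivProp (P * Q) := by
  obtain ⟨C, hC, d, h⟩ := hP
  obtain ⟨C', hC', d', h'⟩ := hQ
  obtain ⟨D, hD, hDm⟩ := N2_poly_mul P
  refine ⟨C' * C + (2 * (D * (C' * C)) + 2 * C), ?_, P.natDegree + d' + d, fun g hg => ?_⟩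
  · have := ENNReal.mul_ne_top hC' hC
    have h2 := ENNReal.mul_ne_top hD this
    have h3 := ENNReal.mul_ne_top (by simp : (2:ℝ≥0∞) ≠ ⊤) h2
    have h4 := ENNReal.mul_ne_top (by simp : (2:ℝ≥0∞) ≠ ⊤) hC
    exact ENNReal.add_ne_top.2 ⟨this, ENNReal.add_ne_top.2 ⟨h3, h4⟩⟩
  obtain ⟨s, t, hs, hsn, htn, htd, e⟩ := h g hg
  obtain ⟨s', t', hs', hsn', htn', htd', e'⟩ := h' s hs
  have hs2 : N2 s' ≤ C' * C * N2 g := by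
    rw [mul_assoc]; exact hsn'.trans (by gcongr)
  have ht2 : (N2 fun z => t'.eval z) ≤ C' * C * N2 g := by
    rw [mul_assoc]; exact htn'.trans (by gcongr)
  refine ⟨s', P * t' + t, hs', ?_, ?_, ?_, fun z hz => ?_⟩
  · refine hs2.trans ?_
    gcongr
    exact le_self_add
  · simp only [Polynomial.eval_add, Polynomial.eval_mul]
    calc _ ≤ 2 * N2 (fun z => P.eval z * t'.eval z) + 2 * N2 (fun z => t.eval z) :=
          N2_add_le ((diff_poly P).mul (diff_poly t')) (diff_poly t)
      _ ≤ 2 * (D * (C' * C * N2 g)) + 2 * (C * N2 g) := by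
          gcongr
          exact (hDm _ (diff_poly t')).trans (by gcongr)
      _ = (2 * (D * (C' * C)) + 2 * C) * N2 g := by ring
      _ ≤ _ := mul_le_mul_left le_add_self _
  · refine lt_of_le_of_lt (Polynomial.natDegree_add_le _ _) ?_
    have := Polynomial.natDegree_mul_le (p := P) (q := t')
    omega
  · rw [e z hz, e' z hz]
    simp only [Polynomial.eval_add, Polynomial.eval_mul]
    ring

lemma ofReal_growth {g : ℂ → ℂ} (hg : MemH2 g) {z : ℂ} (hz : ‖z‖ < 1) :
    ENNReal.ofReal (‖g z‖ ^ 2) ≤ ENNReal.ofReal (1 - ‖z‖ ^ 2)⁻¹ * N2 g := by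
  have h1 : 0 < 1 - ‖z‖ ^ 2 := by nlinarith [norm_nonneg z]
  rw [N2_eq hg, ← ENNReal.ofReal_mul (by positivity)]
  apply ENNReal.ofReal_le_ofReal
  rw [inv_mul_eq_div, le_div_iff₀ h1]
  exact growth hg hz

lemma divProp_lin {l : ℂ} (hl : ‖l‖ < 1) : DivProp (Polynomial.X - Polynomial.C l) := by
  set G := ENNReal.ofReal (1 - ‖l‖ ^ 2)⁻¹ with hG
  set r0 := (1 + ‖l‖) / 2 with hr0
  set K := 2 * ((r0 - ‖l‖)⁻¹) ^ 2 with hK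
  have hK0 : 0 ≤ K := by positivity
  have hrl : 0 < r0 - ‖l‖ := by linarith
  refine ⟨ENNReal.ofReal K * (1 + G) + G, ?_, 1, fun g hg => ?_⟩
  · have h1 : 1 + G ≠ ⊤ := ENNReal.add_ne_top.2 ⟨by simp, ENNReal.ofReal_ne_top⟩
    exact ENNReal.add_ne_top.2 ⟨ENNReal.mul_ne_top ENNReal.ofReal_ne_top h1, ENNReal.ofReal_ne_top⟩
  have hsd : DifferentiableOn ℂ (dslope g l) unitDisk :=
    (Complex.differentiableOn_dslope (isOpen_unitDisk.mem_nhds (unitDisk_mem.2 hl))).2 hg.1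
  have hgl := ofReal_growth hg hl
  have hsn : N2 (dslope g l) ≤ ENNReal.ofReal K * (1 + G) * N2 g := by
    refine N2_le hsd (r0 := r0) (by linarith) fun r hr hr0' hr1 => ?_
    have hpt : ∀ θ, ENNReal.ofReal (‖dslope g l (r * ee θ)‖ ^ 2) ≤ ENNReal.ofReal K *
        (ENNReal.ofReal (‖g (r * ee θ)‖ ^ 2) + ENNReal.ofReal (‖g l‖ ^ 2)) := by
      intro θ
      rw [← ENNReal.ofReal_add (by positivity) (by positivity), ← ENNReal.ofReal_mul hK0]
      apply ENNReal.ofReal_le_ofReal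
      have hn : ‖(r:ℂ) * ee θ‖ = r := norm_r_ee hr0' θ
      have hd : r0 - ‖l‖ ≤ ‖(r:ℂ) * ee θ - l‖ := by
        have := norm_sub_norm_le ((r:ℂ) * ee θ) l
        rw [hn] at this; linarith
      have hne : (r:ℂ) * ee θ ≠ l := by
        intro h; rw [h, sub_self, norm_zero] at hd; linarith
      have hdp : 0 < ‖(r:ℂ) * ee θ - l‖ := by linarith
      rw [dslope_of_ne _ hne, slope_def_field, norm_div, div_pow]
      have h2 := norm_add_sq_le (g (r * ee θ)) (-g l)
      rw [norm_neg, ← sub_eq_add_neg] at h2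
      calc ‖g (r * ee θ) - g l‖ ^ 2 / ‖(r:ℂ) * ee θ - l‖ ^ 2
          ≤ (2 * ‖g (r * ee θ)‖ ^ 2 + 2 * ‖g l‖ ^ 2) / (r0 - ‖l‖) ^ 2 := by gcongr
        _ = _ := by rw [hK]; field_simp
    calc Mr (dslope g l) r ≤ ∫⁻ θ, ENNReal.ofReal K *
        (ENNReal.ofReal (‖g (r * ee θ)‖ ^ 2) + ENNReal.ofReal (‖g l‖ ^ 2)) ∂lam := lintegral_mono hpt
      _ = ENNReal.ofReal K * (Mr g r + ENNReal.ofReal (‖g l‖ ^ 2)) := by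
          rw [lintegral_const_mul' _ _ ENNReal.ofReal_ne_top, lintegral_add_right _ measurable_const]
          simp [Mr]
      _ ≤ ENNReal.ofReal K * (N2 g + G * N2 g) := by
          gcongr
          exact Mr_le_N2 hg.1 hr0' hr1
      _ = _ := by ring
  refine ⟨dslope g l, Polynomial.C (g l), MemH2_iff.2 ⟨hsd, ?_⟩, ?_, ?_, by simp, fun z hz => ?_⟩
  · refine ne_top_of_le_ne_top (ENNReal.mul_ne_top (ENNReal.mul_ne_top ENNReal.ofReal_ne_top ?_)
      (MemH2_iff.1 hg).2) hsn
    exact ENNReal.add_ne_top.2 ⟨by simp, ENNReal.ofReal_ne_top⟩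
  · refine hsn.trans ?_
    gcongr
    exact le_self_add
  · have e : (N2 fun z => (Polynomial.C (g l)).eval z) = ENNReal.ofReal (‖g l‖ ^ 2) := by
      unfold N2
      rw [tsum_eq_single 0]
      · rw [taylorCoeff_poly, Polynomial.coeff_C_zero]
      · intro k hk
        rw [taylorCoeff_poly, Polynomial.coeff_C_of_ne_zero hk]; simp
    rw [e]
    refine hgl.trans ?_
    gcongr
    exact le_add_self
  · have := sub_smul_dslope g l z
    simp only [smul_eq_mul] at this
    simp only [Polynomial.eval_sub, Polynomial.eval_X, Polynomial.eval_C]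
    rw [this]; ring

section
variable {n p : ℕ} {ξ : Fin n → ℂ} {m : Fin n → ℕ} {Λ : Fin n → ℂ} {φ : ℂ → ℂ}

lemma Stp.divBB (S : Stp p ξ m Λ φ) : DivProp (BB p m Λ) := by
  unfold BB
  refine Finset.prod_induction _ DivProp (fun _ _ => DivProp.mul) divProp_one fun j hj => ?_
  have h1 := divProp_lin (S.hΛd j (by simpa using hj))
  induction m j with
  | zero => simpa using divProp_one
  | succ k ih => rw [pow_succ]; exact ih.mul h1

/-- normal form of members of the space -/
lemma Stp.normal (S : Stp p ξ m Λ φ) : ∃ C : ℝ≥0∞, C ≠ ⊤ ∧ ∃ d0 : ℕ, ∀ f g q, HbDecompOf ξ m f g q →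
    ∃ (s : ℂ → ℂ) (c : Fin d0 → ℂ), MemH2 s ∧ N2 s ≤ C * (N2 g + N2 fun z => q.eval z) ∧
      (∀ i, ENNReal.ofReal (‖c i‖ ^ 2) ≤ C * (N2 g + N2 fun z => q.eval z)) ∧
      ∀ z, ‖z‖ < 1 → f z = (GG p ξ m Λ).eval z * s z + ∑ i, c i * z ^ (i : ℕ) := by
  obtain ⟨C, hC, d, h⟩ := S.divBB
  obtain ⟨D, hD, hDm⟩ := N2_poly_mul (A1 ξ m)
  refine ⟨C + (2 * (D * C) + 2), ?_, (A1 ξ m).natDegree + d + ∑ j, m j + 1, fun f g q hf => ?_⟩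
  · have h2 := ENNReal.mul_ne_top hD hC
    have h3 := ENNReal.mul_ne_top (by simp : (2:ℝ≥0∞) ≠ ⊤) h2
    exact ENNReal.add_ne_top.2 ⟨hC, ENNReal.add_ne_top.2 ⟨h3, by simp⟩⟩
  obtain ⟨hg, hq, e⟩ := hf
  obtain ⟨s, t, hs, hsn, htn, htd, e'⟩ := h g hg
  have hTd : (A1 ξ m * t + q).natDegree < (A1 ξ m).natDegree + d + ∑ j, m j + 1 := by
    refine lt_of_le_of_lt (Polynomial.natDegree_add_le _ _) ?_
    have h1 := Polynomial.natDegree_mul_le (p := A1 ξ m) (q := t)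
    have h2 : q.natDegree ≤ ∑ j, m j := Polynomial.natDegree_le_of_degree_le hq.le
    omega
  have hTn : (N2 fun z => (A1 ξ m * t + q).eval z) ≤ (2 * (D * C) + 2) * (N2 g + N2 fun z => q.eval z) := by
    simp only [Polynomial.eval_add, Polynomial.eval_mul]
    calc _ ≤ 2 * N2 (fun z => (A1 ξ m).eval z * t.eval z) + 2 * N2 (fun z => q.eval z) :=
          N2_add_le ((diff_poly _).mul (diff_poly t)) (diff_poly q)
      _ ≤ 2 * (D * (C * N2 g)) + 2 * N2 (fun z => q.eval z) := by
          gcongr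
          exact (hDm _ (diff_poly t)).trans (by gcongr)
      _ = 2 * (D * C) * N2 g + 2 * N2 (fun z => q.eval z) := by ring
      _ ≤ (2 * (D * C) + 2) * N2 g + (2 * (D * C) + 2) * N2 (fun z => q.eval z) := by
          gcongr
          · exact le_self_add
          · exact le_add_self
      _ = _ := by ring
  refine ⟨s, fun i => (A1 ξ m * t + q).coeff i, hs, ?_, fun i => ?_, fun z hz => ?_⟩
  · refine hsn.trans ?_
    gcongr
    · exact le_self_add
    · exact le_self_add
  · calc ENNReal.ofReal (‖(A1 ξ m * t + q).coeff i‖ ^ 2)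
        = ENNReal.ofReal (‖taylorCoeff (fun z => (A1 ξ m * t + q).eval z) i‖ ^ 2) := by
          rw [taylorCoeff_poly]
      _ ≤ N2 fun z => (A1 ξ m * t + q).eval z :=
          ENNReal.le_tsum (f := fun k => ENNReal.ofReal (‖taylorCoeff (fun z => (A1 ξ m * t + q).eval z) k‖ ^ 2)) _
      _ ≤ _ := hTn
      _ ≤ _ := mul_le_mul_left le_add_self _
  · rw [e z (unitDisk_mem.2 hz), e' z hz]
    have h1 := Polynomial.eval_eq_sum_range' hTd z
    rw [← Fin.sum_univ_eq_sum_range (fun i => (A1 ξ m * t + q).coeff i * z ^ i)] at h1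
    rw [← h1, GG, ← A1_eval]
    simp only [Polynomial.eval_add, Polynomial.eval_mul]
    ring

/-- image decomposition -/
lemma Stp.image (S : Stp p ξ m Λ φ) (d0 : ℕ) : ∃ C : ℝ≥0∞, C ≠ ⊤ ∧ ∀ (f s : ℂ → ℂ) (c : Fin d0 → ℂ),
    MemH2 (fun z => ufun p ξ m Λ φ z * s (φ z)) →
    (∀ z, ‖z‖ < 1 → f z = (GG p ξ m Λ).eval (φ z) * s (φ z) + ∑ i, c i * φ z ^ (i : ℕ)) →
    MemHb ξ m f ∧ ENNReal.ofReal (hbNormSq ξ m f) ≤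
      C * (N2 (fun z => ufun p ξ m Λ φ z * s (φ z)) + ∑ i, ENNReal.ofReal (‖c i‖ ^ 2)) := by
  obtain ⟨q, hq, -⟩ := S.gp
  have hpw : ∀ i : ℕ, ∃ h Q, HbDecompOf ξ m (fun z => φ z ^ i) h Q := by
    intro i
    obtain ⟨-, -, h, hh, e⟩ := (hq.comp (Polynomial.X ^ i))
    exact ⟨_, _, memHb_of_poly (Q := (Polynomial.X ^ i).comp q) hh fun z hz => by simpa using e z hz⟩
  choose h Q hd using hpw
  set M := ∑ i : Fin d0, (N2 (h i) + N2 fun z => (Q i).eval z) with hM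
  have hMt : M ≠ ⊤ := by
    refine ENNReal.sum_ne_top.2 fun i _ => ENNReal.add_ne_top.2 ⟨(MemH2_iff.1 (hd i).1).2, N2_poly_ne_top _⟩
  refine ⟨2 + 4 * 2 ^ d0 * M, ?_, fun f s c hus hf => ?_⟩
  · exact ENNReal.add_ne_top.2 ⟨by simp, ENNReal.mul_ne_top (ENNReal.mul_ne_top (by simp) (by simp)) hMt⟩
  have hsumH : MemH2 fun z => ∑ i : Fin d0, c i * h i z :=
    MemH2.sum _ fun i _ => (hd i).1.const_mul _
  have hdec : HbDecompOf ξ m f (fun z => ufun p ξ m Λ φ z * s (φ z) + ∑ i : Fin d0, c i * h i z)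
      (∑ i : Fin d0, Polynomial.C (c i) * Q i) := by
    refine ⟨hus.add hsumH, ?_, fun z hz => ?_⟩
    · refine lt_of_le_of_lt (Polynomial.degree_sum_le _ _) ?_
      rw [Finset.sup_lt_iff (WithBot.bot_lt_coe _)]
      intro i _
      rw [← Polynomial.smul_eq_C_mul]
      exact lt_of_le_of_lt (Polynomial.degree_smul_le _ _) (hd i).2.1
    · have hz' := unitDisk_mem.1 hz
      have ha := a1_ne_zero (m := m) S.hξ hz'
      rw [hf z hz', Polynomial.eval_finsetSum]
      beta_reduce
      rw [ufun_eq]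
      simp only [Polynomial.eval_mul, Polynomial.eval_C]
      have : ∑ i : Fin d0, c i * φ z ^ (i : ℕ) = a1fun ξ m z * ∑ i : Fin d0, c i * h i z +
          ∑ i : Fin d0, c i * (Q i).eval z := by
        rw [Finset.mul_sum, ← Finset.sum_add_distrib]
        refine Finset.sum_congr rfl fun i _ => ?_
        have := (hd i).2.2 z hz
        beta_reduce at this
        rw [this]; ring
      rw [this]
      field_simp
      ring
  refine ⟨⟨(_, _), hdec⟩, ?_⟩
  rw [hbNormSq_of_decomp S.hξ S.hinj S.hm hdec, ENNReal.ofReal_add (h2NormSq_nonneg _) (h2NormSq_nonneg _),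
    ← N2_eq hdec.1, ← N2_eq (memH2_poly _)]
  set V := ∑ i, ENNReal.ofReal (‖c i‖ ^ 2) with hV
  have hcV : ∀ i, ENNReal.ofReal (‖c i‖ ^ 2) ≤ V := fun i =>
    Finset.single_le_sum (f := fun i => ENNReal.ofReal (‖c i‖ ^ 2)) (fun _ _ => zero_le) (Finset.mem_univ i)
  have b1 : N2 (fun z => ∑ i : Fin d0, c i * h i z) ≤ 2 ^ d0 * (M * V) := by
    have := N2_sum_le (Finset.univ : Finset (Fin d0)) (f := fun i z => c i * h i z)
      fun i _ => (hd i).1.1.const_mul _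
    refine this.trans ?_
    simp only [Finset.card_univ, Fintype.card_fin]
    gcongr
    rw [hM, Finset.sum_mul]
    refine Finset.sum_le_sum fun i _ => ?_
    rw [N2_const_mul (hd i).1.1, mul_comm]
    gcongr
    · exact le_self_add
    · exact hcV i
  have b2 : N2 (fun z => (∑ i : Fin d0, Polynomial.C (c i) * Q i).eval z) ≤ 2 ^ d0 * (M * V) := by
    have := N2_sum_le (Finset.univ : Finset (Fin d0)) (f := fun i z => c i * (Q i).eval z)
      fun i _ => (diff_poly (Q i)).const_mul _
    simp only [Polynomial.eval_finsetSum, Polynomial.eval_mul, Polynomial.eval_C]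
    refine this.trans ?_
    simp only [Finset.card_univ, Fintype.card_fin]
    gcongr
    rw [hM, Finset.sum_mul]
    refine Finset.sum_le_sum fun i _ => ?_
    rw [N2_const_mul (diff_poly (Q i)), mul_comm]
    gcongr
    · exact le_add_self
    · exact hcV i
  set W := N2 (fun z => ufun p ξ m Λ φ z * s (φ z)) with hW
  calc _ ≤ (2 * W + 2 * (2 ^ d0 * (M * V))) + 2 ^ d0 * (M * V) := by
        refine add_le_add ((N2_add_le hus.1 hsumH.1).trans ?_) b2
        gcongr
    _ ≤ (2 * W + 2 * (2 ^ d0 * (M * V))) + 2 * (2 ^ d0 * (M * V)) := by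
        refine add_le_add le_rfl ?_
        rw [two_mul (2 ^ d0 * (M * V))]; exact le_self_add
    _ = 2 * W + (4 * 2 ^ d0 * M) * V := by ring
    _ ≤ (2 + 4 * 2 ^ d0 * M) * W + (2 + 4 * 2 ^ d0 * M) * V := by
        gcongr
        · exact le_self_add
        · exact le_add_self
    _ = _ := by ring
end

open scoped Topology ENNReal

section
variable {n p : ℕ} {ξ : Fin n → ℂ} {m : Fin n → ℕ} {Λ : Fin n → ℂ} {φ : ℂ → ℂ}

lemma hbNormSq_nonneg (ξ : Fin n → ℂ) (m : Fin n → ℕ) (f : ℂ → ℂ) : 0 ≤ hbNormSq ξ m f :=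
  add_nonneg (h2NormSq_nonneg _) (h2NormSq_nonneg _)

lemma tsumR_le {d : ℂ → ℂ} (hd : MemH2 d) {R : ℝ} (hR : R ∈ Set.Ioo (0:ℝ) 1) :
    (∑' k, ENNReal.ofReal (‖taylorCoeff d k‖ * R ^ k)) ^ 2 ≤ ENNReal.ofReal ((1 - R)⁻¹ ^ 2) * N2 d := by
  have hR1 : 0 < 1 - R := by linarith [hR.2]
  have hR0 := hR.1
  have h1 : ∑' k, ENNReal.ofReal (‖taylorCoeff d k‖ * R ^ k) ≤
      ENNReal.ofReal (Real.sqrt (h2NormSq d) * (1 - R)⁻¹) := by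
    calc _ ≤ ∑' k, ENNReal.ofReal (Real.sqrt (h2NormSq d) * R ^ k) := by
          refine ENNReal.tsum_le_tsum fun k => ENNReal.ofReal_le_ofReal ?_
          gcongr
          exact Real.le_sqrt_of_sq_le (coeff_sq_le_h2NormSq hd k)
      _ = ENNReal.ofReal (∑' k, Real.sqrt (h2NormSq d) * R ^ k) := by
          rw [ENNReal.ofReal_tsum_of_nonneg (fun k => by positivity)]
          exact (summable_geometric_of_lt_one hR0.le hR.2).mul_left _
      _ = _ := by rw [tsum_mul_left, tsum_geometric_of_lt_one hR0.le hR.2]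
  calc _ ≤ (ENNReal.ofReal (Real.sqrt (h2NormSq d) * (1 - R)⁻¹)) ^ 2 := by gcongr
    _ = _ := by
      rw [← ENNReal.ofReal_pow (by positivity), mul_pow, Real.sq_sqrt (h2NormSq_nonneg _), N2_eq hd,
        ← ENNReal.ofReal_mul (by positivity), mul_comm]

lemma Stp.wbdd (S : Stp p ξ m Λ φ) (hV : IsVanishingCarleson (ufun p ξ m Λ φ) φ) :
    ∃ C : ℝ≥0∞, C ≠ ⊤ ∧ ∀ d, MemH2 d → MemH2 (fun z => ufun p ξ m Λ φ z * d (φ z)) ∧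
      N2 (fun z => ufun p ξ m Λ φ z * d (φ z)) ≤ C * N2 d := by
  obtain ⟨L, hL, h⟩ := S.key hV
  obtain ⟨R, hR, h⟩ := h 1 one_pos
  have hC : L * ENNReal.ofReal ((1 - R)⁻¹ ^ 2) + 1 ≠ ⊤ :=
    ENNReal.add_ne_top.2 ⟨ENNReal.mul_ne_top hL ENNReal.ofReal_ne_top, by simp⟩
  refine ⟨_, hC, fun d hd => ?_⟩
  have hmaps : Set.MapsTo φ unitDisk unitDisk := fun z hz =>
    unitDisk_mem.2 (S.hφ1 z (unitDisk_mem.1 hz))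
  have h2 : N2 (fun z => ufun p ξ m Λ φ z * d (φ z)) ≤
      (L * ENNReal.ofReal ((1 - R)⁻¹ ^ 2) + 1) * N2 d := by
    calc _ ≤ _ := h d hd
      _ ≤ L * (ENNReal.ofReal ((1 - R)⁻¹ ^ 2) * N2 d) + ENNReal.ofReal 1 * N2 d :=
        add_le_add (mul_le_mul_right (tsumR_le hd hR) _) le_rfl
      _ = _ := by rw [ENNReal.ofReal_one]; ring
  exact ⟨MemH2_iff.2 ⟨S.udiff.mul (hd.1.comp S.hφd hmaps),
    ne_top_of_le_ne_top (ENNReal.mul_ne_top hC (MemH2_iff.1 hd).2) h2⟩, h2⟩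

lemma Stp.norm_decomp (S : Stp p ξ m Λ φ) {f g : ℂ → ℂ} {q : Polynomial ℂ} (h : HbDecompOf ξ m f g q) :
    (N2 g + N2 fun z => q.eval z) = ENNReal.ofReal (hbNormSq ξ m f) := by
  rw [hbNormSq_of_decomp S.hξ S.hinj S.hm h, ENNReal.ofReal_add (h2NormSq_nonneg _) (h2NormSq_nonneg _),
    ← N2_eq h.1, ← N2_eq (memH2_poly _)]

lemma Stp.bdd (S : Stp p ξ m Λ φ) (hV : IsVanishingCarleson (ufun p ξ m Λ φ) φ) :
    CompBddHb ξ m φ := by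
  obtain ⟨Cu, hCu, hu⟩ := S.wbdd hV
  obtain ⟨C, hC, d0, hn⟩ := S.normal
  obtain ⟨D, hD, hi⟩ := S.image d0
  have key : ∀ f, MemHb ξ m f → MemHb ξ m (fun z => f (φ z)) ∧
      ENNReal.ofReal (hbNormSq ξ m (fun z => f (φ z))) ≤
        D * (Cu * C + d0 * C) * ENNReal.ofReal (hbNormSq ξ m f) := by
    rintro f ⟨⟨g, q⟩, hf⟩
    obtain ⟨s, c, hs, hsn, hcn, e⟩ := hn f g q hf
    rw [S.norm_decomp hf] at hsn hcn
    obtain ⟨h1, h2⟩ := hi (fun z => f (φ z)) s c (hu s hs).1 fun z hz => e (φ z) (S.hφ1 z hz)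
    refine ⟨h1, h2.trans ?_⟩
    rw [mul_assoc, add_mul, mul_assoc, mul_assoc]
    refine mul_le_mul_right (add_le_add ((hu s hs).2.trans (mul_le_mul_right hsn _)) ?_) _
    refine (Finset.sum_le_sum fun i _ => hcn i).trans ?_
    simp
  refine ⟨fun f hf => (key f hf).1, (D * (Cu * C + d0 * C)).toReal, fun f hf => ?_⟩
  have hT : D * (Cu * C + d0 * C) ≠ ⊤ := ENNReal.mul_ne_top hD (ENNReal.add_ne_top.2
    ⟨ENNReal.mul_ne_top hCu hC, ENNReal.mul_ne_top (by simp) hC⟩)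
  have h := (key f hf).2
  have h2 := ENNReal.toReal_mono (ENNReal.mul_ne_top hT ENNReal.ofReal_ne_top) h
  rwa [ENNReal.toReal_mul, ENNReal.toReal_ofReal (hbNormSq_nonneg _ _ _),
    ENNReal.toReal_ofReal (hbNormSq_nonneg _ _ _)] at h2

/-- weak sequential compactness of bounded sets, coefficientwise -/
lemma extract_subseq {d0 : ℕ} {A : ℝ} (s : ℕ → ℂ → ℂ) (hs : ∀ k, MemH2 (s k)) (hA : ∀ k, h2NormSq (s k) ≤ A)
    (c : ℕ → Fin d0 → ℂ) (hc : ∀ k i, ‖c k i‖ ^ 2 ≤ A) :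
    ∃ (κ : ℕ → ℕ) (t : ℂ → ℂ) (y : Fin d0 → ℂ), StrictMono κ ∧ MemH2 t ∧ h2NormSq t ≤ A ∧
      (∀ j, Tendsto (fun i => taylorCoeff (s (κ i)) j) atTop (𝓝 (taylorCoeff t j))) ∧
      ∀ l, Tendsto (fun i => c (κ i) l) atTop (𝓝 (y l)) := by
  set x : ℕ → (ℕ ⊕ Fin d0) → ℂ := fun k => Sum.elim (fun j => taylorCoeff (s k) j) (c k) with hx
  have hK : IsCompact (Set.pi Set.univ fun _ : ℕ ⊕ Fin d0 => Metric.closedBall (0:ℂ) (Real.sqrt A)) :=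
    isCompact_univ_pi fun _ => isCompact_closedBall _ _
  obtain ⟨y, -, κ, hκ, hy⟩ := hK.tendsto_subseq (x := x) (by
    intro k i _
    rw [mem_closedBall_zero_iff]
    apply Real.le_sqrt_of_sq_le
    rcases i with j | l
    · exact (coeff_sq_le_h2NormSq (hs k) j).trans (hA k)
    · exact hc k l)
  rw [tendsto_pi_nhds] at hy
  have hy1 : ∀ j : ℕ, Tendsto (fun i => taylorCoeff (s (κ i)) j) atTop (𝓝 (y (Sum.inl j))) :=
    fun j => hy (Sum.inl j)
  have hpart : ∀ N, ∑ j ∈ Finset.range N, ‖y (Sum.inl j)‖ ^ 2 ≤ A := by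
    intro N
    refine le_of_tendsto (tendsto_finset_sum (Finset.range N) fun j _ => ((hy1 j).norm.pow 2)) ?_
    refine Eventually.of_forall fun i => ?_
    exact ((hs (κ i)).2.sum_le_tsum _ fun _ _ => by positivity).trans (hA (κ i))
  have hsum : Summable fun j : ℕ => ‖y (Sum.inl j)‖ ^ 2 :=
    summable_of_sum_range_le (fun _ => by positivity) hpart
  obtain ⟨h1, h2⟩ := memH2_ofCoeff hsum
  refine ⟨κ, _, fun l => y (Sum.inr l), hκ, h1, ?_, fun j => ?_, fun l => hy (Sum.inr l)⟩
  · unfold h2NormSq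
    simp only [h2]
    exact hsum.tsum_le_of_sum_range_le hpart
  · rw [h2]; exact hy1 j

lemma N2_sub_le {f g : ℂ → ℂ} (hf : DifferentiableOn ℂ f unitDisk)
    (hg : DifferentiableOn ℂ g unitDisk) :
    N2 (fun z => f z - g z) ≤ 2 * N2 f + 2 * N2 g := by
  have h := N2_add_le hf (hg.const_mul (-1))
  rw [N2_const_mul hg] at h
  simpa [sub_eq_add_neg] using h

lemma tendsto_tsumR {d : ℕ → ℂ → ℂ} {A : ℝ} (hA : ∀ i k, ‖taylorCoeff (d i) k‖ ≤ A)
    (h : ∀ k, Tendsto (fun i => taylorCoeff (d i) k) atTop (𝓝 0)) {R : ℝ} (hR : R ∈ Set.Ioo (0:ℝ) 1) :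
    Tendsto (fun i => ∑' k, ENNReal.ofReal (‖taylorCoeff (d i) k‖ * R ^ k)) atTop (𝓝 0) := by
  have hR0 := hR.1
  have hb : Summable fun k : ℕ => A * R ^ k := (summable_geometric_of_lt_one hR0.le hR.2).mul_left _
  have hle : ∀ i k, ‖taylorCoeff (d i) k‖ * R ^ k ≤ A * R ^ k := fun i k =>
    mul_le_mul_of_nonneg_right (hA i k) (by positivity)
  have h1 : Tendsto (fun i => ∑' k, ‖taylorCoeff (d i) k‖ * R ^ k) atTop (𝓝 (∑' _ : ℕ, (0:ℝ))) := by
    refine tendsto_tsum_of_dominated_convergence hb (fun k => ?_) (Eventually.of_forall fun i k => ?_)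
    · simpa using (h k).norm.mul_const (R ^ k)
    · rw [Real.norm_of_nonneg (by positivity)]; exact hle i k
  rw [tsum_zero] at h1
  have h2 := ENNReal.tendsto_ofReal h1
  rw [ENNReal.ofReal_zero] at h2
  refine h2.congr fun i => ?_
  exact ENNReal.ofReal_tsum_of_nonneg (fun k => by positivity)
    (Summable.of_nonneg_of_le (fun k => by positivity) (hle i) hb)

lemma Stp.vanishing_to_compact (S : Stp p ξ m Λ φ) (hV : IsVanishingCarleson (ufun p ξ m Λ φ) φ) :
    CompCompactHb ξ m φ := by
  refine ⟨S.bdd hV, fun f hf => ?_⟩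
  obtain ⟨Cu, hCu, hu⟩ := S.wbdd hV
  obtain ⟨C, hC, d0, hn⟩ := S.normal
  obtain ⟨D, hD, hi⟩ := S.image d0
  obtain ⟨L, hL, hk⟩ := S.key hV
  have hex : ∀ k, ∃ (s : ℂ → ℂ) (c : Fin d0 → ℂ), MemH2 s ∧ h2NormSq s ≤ C.toReal ∧
      (∀ i, ‖c i‖ ^ 2 ≤ C.toReal) ∧
      ∀ z, ‖z‖ < 1 → f k z = (GG p ξ m Λ).eval z * s z + ∑ i, c i * z ^ (i : ℕ) := by
    intro k
    obtain ⟨⟨⟨g, q⟩, hd⟩, hle⟩ := hf k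
    obtain ⟨s, c, hs, hsn, hcn, e⟩ := hn (f k) g q hd
    rw [S.norm_decomp hd] at hsn hcn
    have hle2 : C * ENNReal.ofReal (hbNormSq ξ m (f k)) ≤ C := by
      refine (mul_le_mul_right (ENNReal.ofReal_le_ofReal hle) _).trans ?_
      simp
    refine ⟨s, c, hs, ?_, fun i => ?_, e⟩
    · rw [h2NormSq_eq]
      exact ENNReal.toReal_mono hC (hsn.trans hle2)
    · have := ENNReal.toReal_mono hC ((hcn i).trans hle2)
      rwa [ENNReal.toReal_ofReal (by positivity)] at this
  choose s c hs hsA hcA e using hex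
  obtain ⟨κ, t, y, hκ, ht, htA, hts, hty⟩ := extract_subseq s hs hsA c hcA
  set g : ℂ → ℂ := fun z => (GG p ξ m Λ).eval (φ z) * t (φ z) + ∑ i, y i * φ z ^ (i : ℕ) with hg
  obtain ⟨hgm, -⟩ := hi g t y (hu t ht).1 fun z hz => rfl
  refine ⟨κ, g, hκ, hgm, ?_⟩
  set d : ℕ → ℂ → ℂ := fun i z => s (κ i) z - t z with hd
  have hdm : ∀ i, MemH2 (d i) := fun i => (hs (κ i)).sub ht
  have hdN : ∀ i, N2 (d i) ≤ 4 * C := by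
    intro i
    have b1 : ∀ {v}, MemH2 v → h2NormSq v ≤ C.toReal → N2 v ≤ C := fun hv hvC => by
      rw [N2_eq hv]; exact ENNReal.ofReal_le_of_le_toReal hvC
    calc N2 (d i) ≤ 2 * N2 (s (κ i)) + 2 * N2 t := N2_sub_le (hs _).1 ht.1
      _ ≤ 2 * C + 2 * C := add_le_add (mul_le_mul_right (b1 (hs _) (hsA _)) _)
          (mul_le_mul_right (b1 ht htA) _)
      _ = _ := by ring
  have hdc : ∀ i k, taylorCoeff (d i) k = taylorCoeff (s (κ i)) k - taylorCoeff t k := fun i k =>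
    taylorCoeff_sub (hs _).1 ht.1 k
  have hdb : ∀ i k, ‖taylorCoeff (d i) k‖ ≤ Real.sqrt C.toReal + Real.sqrt C.toReal := by
    intro i k
    rw [hdc]
    exact (norm_sub_le _ _).trans (add_le_add
      (Real.le_sqrt_of_sq_le ((coeff_sq_le_h2NormSq (hs _) k).trans (hsA _)))
      (Real.le_sqrt_of_sq_le ((coeff_sq_le_h2NormSq ht k).trans htA)))
  have hd0 : ∀ k, Tendsto (fun i => taylorCoeff (d i) k) atTop (𝓝 0) := by
    intro k
    simp only [hdc]
    simpa using (hts k).sub_const (taylorCoeff t k)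
  have hW : Tendsto (fun i => N2 (fun z => ufun p ξ m Λ φ z * d i (φ z))) atTop (𝓝 0) := by
    rw [ENNReal.tendsto_nhds_zero]
    intro ε hε
    have hε2 : ε / 2 ≠ 0 := (ENNReal.half_pos hε.ne').ne'
    obtain ⟨δ, hδ, hδε⟩ := ENNReal.exists_nnreal_pos_mul_lt
      (ENNReal.mul_ne_top (by simp : (4:ℝ≥0∞) ≠ ⊤) hC) hε2
    obtain ⟨R, hR, hkR⟩ := hk δ hδ
    have h1 : Tendsto (fun i => L * (∑' k, ENNReal.ofReal (‖taylorCoeff (d i) k‖ * R ^ k)) ^ 2)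
        atTop (𝓝 0) := by
      have h2 := ENNReal.Tendsto.pow (n := 2) (tendsto_tsumR hdb hd0 hR)
      have h3 := ENNReal.Tendsto.const_mul (a := L) h2 (Or.inr hL)
      simpa using h3
    filter_upwards [(ENNReal.tendsto_nhds_zero.1 h1) (ε / 2) hε2.bot_lt] with i hi'
    calc _ ≤ _ := hkR (d i) (hdm i)
      _ ≤ ε / 2 + ε / 2 := by
        refine add_le_add hi' ((mul_le_mul_right (hdN i) _).trans ?_)
        rw [ENNReal.ofReal_coe_nnreal]
        exact hδε.le
      _ = ε := ENNReal.add_halves ε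
  have hY : Tendsto (fun i => ∑ l, ENNReal.ofReal (‖c (κ i) l - y l‖ ^ 2)) atTop (𝓝 0) := by
    have : Tendsto (fun i => ∑ l, ENNReal.ofReal (‖c (κ i) l - y l‖ ^ 2)) atTop
        (𝓝 (∑ l : Fin d0, (0:ℝ≥0∞))) := by
      refine tendsto_finset_sum _ fun l _ => ?_
      have h1 := ENNReal.tendsto_ofReal (((hty l).sub_const (y l)).norm.pow 2)
      simpa using h1
    simpa using this
  have hT : Tendsto (fun i => D * (N2 (fun z => ufun p ξ m Λ φ z * d i (φ z)) +
      ∑ l, ENNReal.ofReal (‖c (κ i) l - y l‖ ^ 2))) atTop (𝓝 0) := by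
    have h3 := ENNReal.Tendsto.const_mul (a := D) (hW.add hY) (Or.inr hD)
    simpa using h3
  have hfin : Tendsto (fun i => ENNReal.ofReal (hbNormSq ξ m fun z => f (κ i) (φ z) - g z)) atTop (𝓝 0) := by
    refine tendsto_of_tendsto_of_tendsto_of_le_of_le tendsto_const_nhds hT (fun _ => zero_le) fun i => ?_
    refine (hi (fun z => f (κ i) (φ z) - g z) (d i) (fun l => c (κ i) l - y l) (hu (d i) (hdm i)).1
      fun z hz => ?_).2
    simp only [hg, hd]
    rw [e (κ i) (φ z) (S.hφ1 z hz)]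
    simp only [sub_mul, Finset.sum_sub_distrib]
    ring
  have := (ENNReal.tendsto_toReal ENNReal.zero_ne_top).comp hfin
  simp only [ENNReal.toReal_zero] at this
  refine this.congr fun i => ?_
  exact ENNReal.toReal_ofReal (hbNormSq_nonneg _ _ _)
end

lemma main_cycle (b a : ℂ → ℂ) (n : ℕ) (ξ : Fin n → ℂ) (m : Fin n → ℕ)
    (hset : RationalSetting b a n ξ m)
    (φ : ℂ → ℂ) (hφb : MemHb ξ m φ) (hφball : MemBallHinf φ)
    (hφmap : ∀ z ∈ unitDisk, φ z ∈ unitDisk)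
    (Λ : Fin n → ℂ) (hΛ : ∀ j, NTLimit φ (ξ j) (Λ j))
    (p : ℕ)
    (hΛcirc : ∀ j : Fin n, (j : ℕ) < p → ∃ i, Λ j = ξ i)
    (hΛdisk : ∀ j : Fin n, p ≤ (j : ℕ) → Λ j ∈ unitDisk) :
    (CompCompactHb ξ m φ ↔ IsVanishingCarleson (ufun p ξ m Λ φ) φ) ∧
    (CompCompactHb ξ m φ ↔
      ∀ ε > (0:ℝ), ∃ ρ ∈ Set.Ico (0:ℝ) 1, ∀ w ∈ unitDisk, ρ < ‖w‖ →
        repKerInt (ufun p ξ m Λ φ) φ w < ENNReal.ofReal ε) := by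
  have hξ : ∀ j, ‖ξ j‖ = 1 := fun j => unitCircle_mem.1 (hset.zeros_mem j)
  have S : Stp p ξ m Λ φ :=
    { hξ := hξ
      hinj := hset.zeros_inj
      hm := hset.mult_pos
      hφd := hφball.1
      hφ1 := fun z hz => unitDisk_mem.1 (hφmap z (unitDisk_mem.2 hz))
      hrad := fun j => ntlimit_radial (hξ j) (hΛ j)
      hΛc := fun j hj => by
        obtain ⟨i, hi⟩ := hΛcirc j hj
        rw [hi]; exact hξ i
      hΛd := fun j hj => unitDisk_mem.1 (hΛdisk j hj)
      hb := hφb }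
  have h13 := S.compact_to_rep
  have h32 := rep_to_vanishing (u := ufun p ξ m Λ φ) (φ := φ)
  have h21 := S.vanishing_to_compact
  exact ⟨⟨fun h => h32 (h13 h), h21⟩, ⟨h13, fun h => h21 (h32 h)⟩⟩

/-- Corollary 5.3. `C_φ` is compact on `H(b)` iff `μ_{u,φ}` is a
vanishing Carleson measure, iff `∫_T (1−|w|²)|u|²/|1 − conj(w)φ|² dm → 0` as `|w| → 1`. -/
theorem comp_compact_iff_vanishing_carleson
    (b a : ℂ → ℂ) (n : ℕ) (ξ : Fin n → ℂ) (m : Fin n → ℕ)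
    (hset : RationalSetting b a n ξ m)
    (φ : ℂ → ℂ) (hφb : MemHb ξ m φ) (hφball : MemBallHinf φ)
    (hφmap : ∀ z ∈ unitDisk, φ z ∈ unitDisk)
    (Λ : Fin n → ℂ) (hΛ : ∀ j, NTLimit φ (ξ j) (Λ j))
    (p : ℕ) (hp : p ≤ n)
    (hΛcirc : ∀ j : Fin n, (j : ℕ) < p → ∃ i, Λ j = ξ i)
    (hΛdisk : ∀ j : Fin n, p ≤ (j : ℕ) → Λ j ∈ unitDisk) :
    (CompCompactHb ξ m φ ↔ IsVanishingCarleson (ufun p ξ m Λ φ) φ) ∧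
    (CompCompactHb ξ m φ ↔
      ∀ ε > (0:ℝ), ∃ ρ ∈ Set.Ico (0:ℝ) 1, ∀ w ∈ unitDisk, ρ < ‖w‖ →
        repKerInt (ufun p ξ m Λ φ) φ w < ENNReal.ofReal ε) := by
  exact main_cycle b a n ξ m hset φ hφb hφball hφmap Λ hΛ p hΛcirc hΛdisk

end
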